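/- arXiv:1906.11650 — 3 statements merged into one kernel-verified Lean document; each statement's English description precedes it below -/
import Mathlib

section
/- Let F be a field with at least 4 elements and v : F^× → ℤ a surjective discrete valuation whose residue field k is either finite, or quadratically closed (every element of k is a square), or real closed, and suppose U_n ⊆ U_1² for some n ≥ 1, where U_m := 1 + M_v^m. Then the restriction to I_F·RP′(F)[1/2] of the quotient map RP′(F)[1/2] → (RP′(F)[1/2])_{χ_v} is an isomorphism of R_F-modules, and consequently I_F·RP′(F)[1/2] ≅ P(k)[1/2]{v} as R_F-modules via the specialization homomorphism. -/
open scoped Classical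

noncomputable section

variable (F : Type) [Field F]

/-- The group of square classes `G_F = F^× / (F^×)²`. -/
def SqCl (F : Type) [Field F] : Type :=
  Fˣ ⧸ (powMonoidHom 2 : Fˣ →* Fˣ).range

instance : CommGroup (SqCl F) := QuotientGroup.Quotient.commGroup _

/-- The square class of a unit. -/
def sqc : Fˣ →* SqCl F := QuotientGroup.mk' _

/-- The group ring `R_F = ℤ[F^×/(F^×)²]`. -/
abbrev RF (F : Type) [Field F] : Type := MonoidAlgebra ℤ (SqCl F)

/-- `⟨x⟩ ∈ R_F`, the square class of a unit as an element of the group ring. -/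
def cls (x : Fˣ) : RF F := MonoidAlgebra.of ℤ (SqCl F) (sqc F x)

/-- The free `R_F`-module on the set `F^×`. -/
abbrev FreeRP (F : Type) [Field F] : Type := Fˣ →₀ RF F

/-- The generator `[x]` of the free module. -/
def gen (x : Fˣ) : FreeRP F := Finsupp.single x 1

/-- units from nonzero field elements -/
def U (x : F) (h : x ≠ 0) : Fˣ := Units.mk0 x h

variable {F}

theorem one_sub_ne {x : Fˣ} (hx : (x : F) ≠ 1) : (1 : F) - x ≠ 0 :=
  sub_ne_zero.mpr (Ne.symm hx)

theorem inv_sub_one_ne {x : Fˣ} (hx : (x : F) ≠ 1) : ((x : F)⁻¹ - 1) ≠ 0 :=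
  sub_ne_zero.mpr (fun h => hx (by rwa [inv_eq_one] at h))

theorem one_sub_inv_ne {x : Fˣ} (hx : (x : F) ≠ 1) : (1 - (x : F)⁻¹) ≠ 0 :=
  sub_ne_zero.mpr (fun h => hx (by rw [eq_comm, inv_eq_one] at h; exact h.symm ▸ rfl))

variable (F)

/-- The five term relation `S_{x,y}` as an element of the free module. -/
def FT (x y : Fˣ) (hx : (x : F) ≠ 1) (hy : (y : F) ≠ 1) : FreeRP F :=
  gen F x - gen F y + cls F x • gen F (y * x⁻¹)
    - cls F (U F ((x : F)⁻¹ - 1) (inv_sub_one_ne hx)) •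
        gen F (U F ((1 - (x : F)⁻¹) / (1 - (y : F)⁻¹))
          (div_ne_zero (one_sub_inv_ne hx) (one_sub_inv_ne hy)))
    + cls F (U F (1 - (x : F)) (one_sub_ne hx)) •
        gen F (U F ((1 - (x : F)) / (1 - (y : F)))
          (div_ne_zero (one_sub_ne hx) (one_sub_ne hy)))

/-- The set of five-term relations. -/
def ftRels : Set (FreeRP F) :=
  {w | ∃ (x y : Fˣ) (hx : (x : F) ≠ 1) (hy : (y : F) ≠ 1), w = FT F x y hx hy}

/-- The relations `ψ₁(x) = [x] + ⟨-1⟩[x⁻¹]`. -/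
def psiRels : Set (FreeRP F) :=
  {w | ∃ x : Fˣ, w = gen F x + cls F (-1) • gen F x⁻¹}

/-- relations `⟨-1⟩[x] = [x]` -/
def minusRels : Set (FreeRP F) :=
  {w | ∃ x : Fˣ, w = cls F (-1) • gen F x - gen F x}

/-- relations `[x⁻¹] = -[x]` -/
def invRels : Set (FreeRP F) :=
  {w | ∃ x : Fˣ, w = gen F x⁻¹ + gen F x}

/-- The module `qRP(F) = RP(F)/⟨ψ₁(x) : x ∈ F^×⟩`. -/
def qRP : Type := FreeRP F ⧸ Submodule.span (RF F) (ftRels F ∪ psiRels F)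

instance : AddCommGroup (qRP F) := by unfold qRP; infer_instance
instance : Module (RF F) (qRP F) := by unfold qRP; infer_instance

/-- `[x] ∈ qRP(F)` -/
def qrp (x : Fˣ) : qRP F := Submodule.Quotient.mk (gen F x)

/-- The module `RP′(F)`. -/
def RP' : Type :=
  FreeRP F ⧸ Submodule.span (RF F)
    ({gen F 1} ∪ ftRels F ∪ minusRels F ∪ invRels F)

instance : AddCommGroup (RP' F) := by unfold RP'; infer_instance
instance : Module (RF F) (RP' F) := by unfold RP'; infer_instance

/-- `[x] ∈ RP′(F)` -/
def rp (x : Fˣ) : RP' F := Submodule.Quotient.mk (gen F x)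

/-- the submodule of `M` generated by the elements `(⟨a⟩ - χ(a))·m`. -/
def chiSub (χ : SqCl F →* ℤˣ) (M : Type) [AddCommGroup M] [Module (RF F) M] :
    Submodule (RF F) M :=
  Submodule.span (RF F)
    {w | ∃ (a : Fˣ) (m : M), w = cls F a • m - ((χ (sqc F a) : ℤ)) • m}

/-- `M_χ` -/
def ChiQuot (χ : SqCl F →* ℤˣ) (M : Type) [AddCommGroup M] [Module (RF F) M] : Type :=
  M ⧸ chiSub F χ M

instance (χ : SqCl F →* ℤˣ) (M : Type) [AddCommGroup M] [Module (RF F) M] :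
    AddCommGroup (ChiQuot F χ M) := by unfold ChiQuot; infer_instance
instance (χ : SqCl F →* ℤˣ) (M : Type) [AddCommGroup M] [Module (RF F) M] :
    Module (RF F) (ChiQuot F χ M) := by unfold ChiQuot; infer_instance

/-- image of `m` in `M_χ` -/
def mkChi (χ : SqCl F →* ℤˣ) {M : Type} [AddCommGroup M] [Module (RF F) M] (m : M) :
    ChiQuot F χ M := Submodule.Quotient.mk m

/-- `M[1/2]`, as an `R_F`-module (localization at the powers of `2`). -/
def Loc2 (M : Type) [AddCommGroup M] [Module (RF F) M] : Type :=
  LocalizedModule (Submonoid.powers (2 : RF F)) M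

instance (M : Type) [AddCommGroup M] [Module (RF F) M] : AddCommGroup (Loc2 F M) := by
  unfold Loc2; infer_instance
instance (M : Type) [AddCommGroup M] [Module (RF F) M] : Module (RF F) (Loc2 F M) := by
  unfold Loc2; infer_instance

/-- the canonical map `M → M[1/2]` -/
def toLoc2 {M : Type} [AddCommGroup M] [Module (RF F) M] (m : M) : Loc2 F M :=
  LocalizedModule.mkLinearMap (Submonoid.powers (2 : RF F)) M m


/-- the square class of a field element (junk value `1` at `0`). -/
def sqv (a : F) : SqCl F := if h : a ≠ 0 then sqc F (U F a h) else 1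

/-- `[a] ∈ RP′(F)` for a field element `a`, where `[0]` is assigned the value `c₀`. -/
def rpc (c₀ : RP' F) (a : F) : RP' F := if h : a ≠ 0 then rp F (U F a h) else c₀


section PreBloch

variable (k : Type) [Field k]

/-- The plain five-term relation in the free abelian group on `k^×`. -/
def FTZ (x y : kˣ) (hx : (x : k) ≠ 1) (hy : (y : k) ≠ 1) : kˣ →₀ ℤ :=
  Finsupp.single x 1 - Finsupp.single y 1 + Finsupp.single (y * x⁻¹) 1
    - Finsupp.single (U k ((1 - (x : k)⁻¹) / (1 - (y : k)⁻¹))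
        (div_ne_zero (one_sub_inv_ne hx) (one_sub_inv_ne hy))) 1
    + Finsupp.single (U k ((1 - (x : k)) / (1 - (y : k)))
        (div_ne_zero (one_sub_ne hx) (one_sub_ne hy))) 1

/-- The pre-Bloch (scissors congruence) group `P(k)`: generators `[x]`, `x ∈ k^×`,
relations `[1] = 0` and the five-term relations. -/
def PBloch : Type :=
  (kˣ →₀ ℤ) ⧸ Submodule.span ℤ
    ({Finsupp.single (1 : kˣ) (1 : ℤ)} ∪
      {w | ∃ (x y : kˣ) (hx : (x : k) ≠ 1) (hy : (y : k) ≠ 1), w = FTZ k x y hx hy})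

instance : AddCommGroup (PBloch k) := by unfold PBloch; infer_instance

/-- `[x] ∈ P(k)` -/
def pb (x : kˣ) : PBloch k := Submodule.Quotient.mk (Finsupp.single x 1)

end PreBloch

section Conventions

variable (k : Type) [Field k]

/-- The augmentation `R_F → ℤ`. -/
def augRF : RF k →+* ℤ := ((MonoidAlgebra.lift ℤ ℤ (SqCl k)) 1).toRingHom

/-- The augmentation ideal `I_F ⊆ R_F`. -/
def augIdeal : Ideal (RF k) := RingHom.ker (augRF k)

/-- the trivial `R_k`-module structure on an abelian group -/
def trivMod (M : Type) [AddCommGroup M] : Module (RF k) M := Module.compHom _ (augRF k)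

/-- `RP′(F₃)`: the appropriate quotient of the cyclic `R_{F₃}`-module generated by
`[-1]` with the relation `2([-1] + ⟨-1⟩[-1]) = 0`. -/
def RP'3 : Type :=
  RF k ⧸ Submodule.span (RF k)
    {(2 : RF k) * (1 + cls k (-1)), cls k (-1) - 1, 1 + cls k (-1)}

instance : AddCommGroup (RP'3 k) := by unfold RP'3; infer_instance
instance : Module (RF k) (RP'3 k) := by unfold RP'3; infer_instance

/-- `qRP(F₃) = RP(F₃)/⟨ψ₁⟩`, where `RP(F₃)` is the cyclic `R_{F₃}`-module generated
by `[-1]` with the relation `2([-1] + ⟨-1⟩[-1]) = 0`. -/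
def qRP3 : Type :=
  RF k ⧸ Submodule.span (RF k) {(2 : RF k) * (1 + cls k (-1)), 1 + cls k (-1)}

instance : AddCommGroup (qRP3 k) := by unfold qRP3; infer_instance
instance : Module (RF k) (qRP3 k) := by unfold qRP3; infer_instance

/-- `RP′(k)` (bundled), with the conventions for the fields with `2` and `3`
elements:  for `|k| = 2` it is `ℤ/3` with the trivial `R_k`-action, and for
`|k| = 3` it is the module `RP'3 k` above. -/
noncomputable def RP'Kb : ModuleCat (RF k) :=
  if Nat.card k = 2 then (letI := trivMod k (ZMod 3); ModuleCat.of (RF k) (ZMod 3))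
  else if Nat.card k = 3 then ModuleCat.of (RF k) (RP'3 k)
  else ModuleCat.of (RF k) (RP' k)

/-- `RP′(k)`, with the conventions for the fields with `2` and `3` elements. -/
noncomputable abbrev RP'K : Type := (RP'Kb k).carrier

/-- the generators `[u]`, `u ∈ k^×`, of `RP′(k)` (with the small-field conventions;
for `|k| = 2` one has `[1] = 0`, and for `|k| = 3`, `[1] = 0` and `[-1]` is the
distinguished generator) -/
noncomputable def rpK : kˣ → RP'K k := by
  unfold RP'K RP'Kb
  by_cases h2 : Nat.card k = 2
  · rw [if_pos h2]; exact fun _ => 0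
  · rw [if_neg h2]
    by_cases h3 : Nat.card k = 3
    · rw [if_pos h3]
      exact fun u => if (u : k) = 1 then 0 else Submodule.Quotient.mk (1 : RF k)
    · rw [if_neg h3]; exact rp k

/-- `qRP(k)` (bundled), with the conventions for the fields with `2` and `3`
elements. -/
noncomputable def qRPKb : ModuleCat (RF k) :=
  if Nat.card k = 2 then (letI := trivMod k (ZMod 3); ModuleCat.of (RF k) (ZMod 3))
  else if Nat.card k = 3 then ModuleCat.of (RF k) (qRP3 k)
  else ModuleCat.of (RF k) (qRP k)

/-- `qRP(k)`, with the conventions for the fields with `2` and `3` elements. -/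
noncomputable abbrev qRPK : Type := (qRPKb k).carrier

/-- the generators `[u]`, `u ∈ k^×`, of `qRP(k)` (with the small-field conventions) -/
noncomputable def qrpK : kˣ → qRPK k := by
  unfold qRPK qRPKb
  by_cases h2 : Nat.card k = 2
  · rw [if_pos h2]; exact fun _ => 0
  · rw [if_neg h2]
    by_cases h3 : Nat.card k = 3
    · rw [if_pos h3]
      exact fun u => if (u : k) = 1 then 0 else Submodule.Quotient.mk (1 : RF k)
    · rw [if_neg h3]; exact qrp k

/-- The scissors congruence group `P(k)`, with the conventions for the fields with
`2` and `3` elements (`P(F₂) = ℤ/3` and `P(F₃) = ℤ/4`, generated by `[-1]`). -/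
def PBK : Type :=
  if Nat.card k = 2 then ZMod 3 else if Nat.card k = 3 then ZMod 4 else PBloch k

noncomputable instance : AddCommGroup (PBK k) := by
  unfold PBK; split
  · infer_instance
  · split <;> infer_instance

/-- the generators `[u]`, `u ∈ k^×`, of `P(k)` (with the small-field conventions) -/
noncomputable def pbK' : kˣ → PBK k := by
  unfold PBK
  by_cases h2 : Nat.card k = 2
  · rw [if_pos h2]; exact fun _ => 0
  · rw [if_neg h2]
    by_cases h3 : Nat.card k = 3
    · rw [if_pos h3]
      exact fun u => if (u : k) = 1 then 0 else (1 : ZMod 4)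
    · rw [if_neg h3]; exact pb k

end Conventions

section ValuedField

variable (F : Type) [Field F] {Γ₀ : Type} [LinearOrderedCommGroupWithZero Γ₀]
variable (v : Valuation F Γ₀)

/-- The residue field `k(v)` of the valuation ring of `v`. -/
def Resk : Type := IsLocalRing.ResidueField ↥v.valuationSubring

instance : Field (Resk F v) := by unfold Resk; infer_instance

/-- the unit group `U_v` of the valuation ring -/
def Uv : Type := (↥v.valuationSubring)ˣ

instance : CommGroup (Uv F v) := by unfold Uv; infer_instance

/-- `ℤ[U_v]` -/
def ZU : Type := MonoidAlgebra ℤ (Uv F v)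

instance : CommRing (ZU F v) := by unfold ZU; infer_instance

/-- `U_v →* F^×` -/
def uvToUnits : Uv F v →* Fˣ := Units.map (v.valuationSubring.subtype).toMonoidHom

/-- `U_v →* k^×` (reduction modulo the maximal ideal) -/
def uvToResUnits : Uv F v →* (Resk F v)ˣ :=
  Units.map (IsLocalRing.residue ↥v.valuationSubring).toMonoidHom

/-- `ℤ[U_v] → R_F` -/
def zuF : ZU F v →+* RF F :=
  MonoidAlgebra.mapDomainRingHom ℤ ((sqc F).comp (uvToUnits F v))

/-- `ℤ[U_v] → R_{k(v)}` -/
def zuK : ZU F v →+* RF (Resk F v) :=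
  MonoidAlgebra.mapDomainRingHom ℤ ((sqc (Resk F v)).comp (uvToResUnits F v))

/-- `Ind_F^k M = R_F ⊗_{ℤ[U_v]} M` for an `R_k`-module `M`. -/
def IndMod (M : Type) [AddCommGroup M] [Module (RF (Resk F v)) M] : Type :=
  @TensorProduct (ZU F v) _ (RF F) M _ _
    (Module.compHom _ (zuF F v)) (Module.compHom _ (zuK F v))

noncomputable instance (M : Type) [AddCommGroup M] [Module (RF (Resk F v)) M] :
    AddCommGroup (IndMod F v M) := by
  unfold IndMod
  letI : Module (ZU F v) (RF F) := Module.compHom _ (zuF F v)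
  letI : Module (ZU F v) M := Module.compHom _ (zuK F v)
  infer_instance

noncomputable instance (M : Type) [AddCommGroup M] [Module (RF (Resk F v)) M] :
    Module (RF F) (IndMod F v M) := by
  unfold IndMod
  letI : Module (ZU F v) (RF F) := Module.compHom _ (zuF F v)
  letI : Module (ZU F v) M := Module.compHom _ (zuK F v)
  letI : SMulCommClass (ZU F v) (RF F) (RF F) :=
    ⟨fun r s t => by
      show zuF F v r * (s * t) = s * (zuF F v r * t)
      ring⟩
  exact TensorProduct.leftModule

/-- the element `r ⊗ m` of `Ind_F^k M` -/
noncomputable def indE (M : Type) [AddCommGroup M] [Module (RF (Resk F v)) M]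
    (r : RF F) (m : M) : IndMod F v M :=
  letI : Module (ZU F v) (RF F) := Module.compHom _ (zuF F v)
  letI : Module (ZU F v) M := Module.compHom _ (zuK F v)
  r ⊗ₜ[ZU F v] m

/-- a unit of `F` of valuation `1` gives a unit of the valuation ring -/
def unitOfVal (x : Fˣ) (hx : v (x : F) = 1) : Uv F v :=
  { val := ⟨(x : F), le_of_eq hx⟩
    inv := ⟨((x : F)⁻¹),
      by
        rw [Valuation.mem_valuationSubring_iff, map_inv₀, hx, inv_one]⟩
    val_inv := by
      apply Subtype.ext
      simp [mul_inv_cancel₀ (Units.ne_zero x)]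
    inv_val := by
      apply Subtype.ext
      simp [inv_mul_cancel₀ (Units.ne_zero x)] }

/-- the image in `k(v)^×` of a unit of `F` of valuation `1` -/
def resUnit (x : Fˣ) (hx : v (x : F) = 1) : (Resk F v)ˣ :=
  uvToResUnits F v (unitOfVal F v x hx)

end ValuedField

section DiscreteValuationChar

variable (F : Type) [Field F]

/-- The character `χ_v : G_F → {±1}`, `⟨a⟩ ↦ (-1)^{v(a)}`, associated to a
homomorphism `v : F^× → ℤ`. -/
def chiV (v : Fˣ → ℤ) (hv : ∀ x y : Fˣ, v (x * y) = v x + v y) : SqCl F →* ℤˣ :=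
  QuotientGroup.lift _
    { toFun := fun x => (-1 : ℤˣ) ^ (v x)
      map_one' := by
        have h1 : v 1 = v 1 + v 1 := by simpa using (hv 1 1).symm
        have h0 : v 1 = 0 := by omega
        simp [h0]
      map_mul' := fun x y => by simp only [hv, zpow_add] }
    (by
      rintro w ⟨y, rfl⟩
      show (-1 : ℤˣ) ^ (v (y ^ 2)) = 1
      have : v (y ^ 2) = v y + v y := by rw [pow_two]; exact hv y y
      rw [this, zpow_add]
      exact Int.units_mul_self _)

/-- The set `U_n = 1 + M_v^n ⊆ F^×` for a discrete valuation `v`. -/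
def UnSet (v : Fˣ → ℤ) (n : ℕ) : Set Fˣ :=
  {u : Fˣ | (u : F) = 1 ∨ ∃ h : (u : F) - 1 ≠ 0, (n : ℤ) ≤ v (U F ((u : F) - 1) h)}

end DiscreteValuationChar

section DiscreteValuationZ

variable (F : Type) [Field F]

/-- the additive value `v(x) ∈ ℤ` of a unit, for a (multiplicatively written)
valuation `v : F → ℤₘ₀` -/
def vzk (v : Valuation F (WithZero (Multiplicative ℤ))) (x : Fˣ) : ℤ :=
  - Multiplicative.toAdd (WithZero.unzero ((Valuation.ne_zero_iff v).mpr (Units.ne_zero x)))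

theorem vzk_mul (v : Valuation F (WithZero (Multiplicative ℤ))) (x y : Fˣ) :
    vzk F v (x * y) = vzk F v x + vzk F v y := by
  have h1 : v ((↑(x * y) : F)) ≠ 0 := (Valuation.ne_zero_iff v).mpr (Units.ne_zero (x * y))
  have h2 : v ((x : F)) ≠ 0 := (Valuation.ne_zero_iff v).mpr (Units.ne_zero x)
  have h3 : v ((y : F)) ≠ 0 := (Valuation.ne_zero_iff v).mpr (Units.ne_zero y)
  have key : WithZero.unzero h1 = WithZero.unzero h2 * WithZero.unzero h3 := by
    rw [← WithZero.coe_inj, WithZero.coe_mul, WithZero.coe_unzero, WithZero.coe_unzero,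
      WithZero.coe_unzero, Units.val_mul, map_mul]
  unfold vzk
  show -Multiplicative.toAdd (WithZero.unzero h1) =
      -Multiplicative.toAdd (WithZero.unzero h2) + -Multiplicative.toAdd (WithZero.unzero h3)
  rw [key, toAdd_mul]
  ring

/-- the character `χ_v` of a (surjective) discrete valuation `v : F → ℤₘ₀` -/
def chiVal (v : Valuation F (WithZero (Multiplicative ℤ))) : SqCl F →* ℤˣ :=
  chiV F (vzk F v) (vzk_mul F v)

/-- The subset `U_n = 1 + M_v^n` of `F^×`, for a surjective discrete valuation
`v : F → ℤₘ₀`:  the units `u` with `v(u - 1) ≥ n` (additively). -/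
def UnV (v : Valuation F (WithZero (Multiplicative ℤ))) (n : ℕ) : Set Fˣ :=
  {u : Fˣ | ∀ h : (u : F) - 1 ≠ 0, (n : ℤ) ≤ vzk F v (U F ((u : F) - 1) h)}

end DiscreteValuationZ

section KvMathlib

variable (F : Type) [Field F] {Γ₀ : Type} [LinearOrderedCommGroupWithZero Γ₀]

/-- `1 + M_v ⊆ F^×` -/
def U1V (v : Valuation F Γ₀) : Set Fˣ := {u : Fˣ | v ((u : F) - 1) < 1}

/-- `K_v ⊆ qRP(F)`: the `R_F`-submodule generated by the `[u]` with `u ∈ 1 + M_v`. -/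
def KvV (v : Valuation F Γ₀) : Submodule (RF F) (qRP F) :=
  Submodule.span (RF F) (qrp F '' U1V F v)

end KvMathlib

/-- the canonical map `M → M[1/2]` (localization of a `ℤ`-module away from `2`) -/
def toLocZ (M : Type) [AddCommGroup M] (m : M) :
    LocalizedModule (Submonoid.powers (2 : ℤ)) M :=
  LocalizedModule.mkLinearMap (Submonoid.powers (2 : ℤ)) M m

/-- real closed fields (elementary characterization):  every element or its negative
is a square, `-1` is not a square, and every polynomial of odd degree has a root -/
def IsRealClosedField (k : Type) [Field k] : Prop :=
  (∀ a : k, IsSquare a ∨ IsSquare (-a)) ∧ ¬IsSquare (-1 : k) ∧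
    ∀ p : Polynomial k, Odd p.natDegree → ∃ x, p.eval x = 0

end


structure Tw {F : Type} [Field F] {A : Type} [AddCommGroup A] (X : F → ℤ) (f : F → A) : Prop where
  mul : ∀ x y, X (x * y) = X x * X y
  pm : ∀ x, x ≠ 0 → X x = 1 ∨ X x = -1
  one : f 1 = 0
  ft : ∀ x y, x ≠ 0 → x ≠ 1 → y ≠ 0 → y ≠ 1 →
    f x - f y + X x • f (y / x) - X (x⁻¹ - 1) • f ((1 - x⁻¹) / (1 - y⁻¹))
      + X (1 - x) • f ((1 - x) / (1 - y)) = 0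
  neg : ∀ x, x ≠ 0 → X (-1) • f x = f x
  inv : ∀ x, x ≠ 0 → f x⁻¹ = - f x
  tt : ∀ a : A, (2 : ℤ) • a = 0 → a = 0

namespace Tw
variable {F : Type} [Field F] {A : Type} [AddCommGroup A] {X : F → ℤ} {f : F → A}

theorem X1 (T : Tw X f) : X 1 = 1 := by
  have h := T.mul 1 1
  rcases T.pm 1 one_ne_zero with h1 | h1
  · exact h1
  · rw [one_mul, h1] at h; norm_num at h

theorem sq (T : Tw X f) (x : F) (hx : x ≠ 0) : X (x * x) = 1 := by
  rw [T.mul]; rcases T.pm x hx with h | h <;> simp [h]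

theorem Xinv (T : Tw X f) (x : F) (hx : x ≠ 0) : X x⁻¹ = X x := by
  have h := T.mul x x⁻¹
  rw [mul_inv_cancel₀ hx, T.X1] at h
  rcases T.pm x hx with h1 | h1 <;> rw [h1] at h ⊢ <;> omega

theorem Xdiv (T : Tw X f) (x y : F) (hy : y ≠ 0) : X (x / y) = X x * X y := by
  rw [div_eq_mul_inv, T.mul, T.Xinv y hy]

theorem Xneg (T : Tw X f) (hm : X (-1) = 1) (x : F) : X (-x) = X x := by
  rw [neg_eq_neg_one_mul, T.mul, hm, one_mul]

theorem Xsub (T : Tw X f) (hm : X (-1) = 1) (x y : F) : X (x - y) = X (y - x) := by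
  rw [← T.Xneg hm, neg_sub]

theorem zero_of_neg (T : Tw X f) (hm : X (-1) ≠ 1) (x : F) (hx : x ≠ 0) : f x = 0 := by
  have h : X (-1) = -1 := (T.pm (-1) (by simp)).resolve_left hm
  have := T.neg x hx
  apply T.tt
  rw [h] at this
  linear_combination (norm := module) -this

/-- normalized five-term relation -/
theorem ft' (T : Tw X f) (_hm : X (-1) = 1) (x y : F) (hx : x ≠ 0) (hx1 : x ≠ 1) (hy : y ≠ 0)
    (hy1 : y ≠ 1) : f x - f y + X x • f (y / x)
      - (X x * X (1 - x)) • f ((1 - x) * y / (x * (1 - y)))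
      + X (1 - x) • f ((1 - x) / (1 - y)) = 0 := by
  have h := T.ft x y hx hx1 hy hy1
  have h1 : 1 - y ≠ 0 := sub_ne_zero.mpr (Ne.symm hy1)
  have h1' : y - 1 ≠ 0 := sub_ne_zero.mpr hy1
  have e1 : X (x⁻¹ - 1) = X x * X (1 - x) := by
    rw [show x⁻¹ - 1 = x⁻¹ * (1 - x) by field_simp, T.mul, T.Xinv x hx]
  have e2 : (1 - x⁻¹) / (1 - y⁻¹) = (1 - x) * y / (x * (1 - y)) := by
    have : 1 - y⁻¹ = (y - 1) / y := by field_simp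
    rw [this]
    field_simp
    ring
  rwa [e1, e2] at h

theorem const (T : Tw X f) (hm : X (-1) = 1) (x y : F) (hx : x ≠ 0) (hx1 : x ≠ 1) (hy : y ≠ 0)
    (hy1 : y ≠ 1) : f x + f (1 - x) = f y + f (1 - y) := by
  have h1x : 1 - x ≠ 0 := sub_ne_zero.mpr (Ne.symm hx1)
  have h1y : 1 - y ≠ 0 := sub_ne_zero.mpr (Ne.symm hy1)
  have h := T.ft' hm x y hx hx1 hy hy1
  have h' := T.ft' hm (1 - x) (1 - y) h1x (by simpa using hx) h1y (by simpa using hy)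
  simp only [sub_sub_cancel] at h'
  have i1 := T.inv ((1 - x) / (1 - y)) (by positivity)
  have i2 := T.inv (y / x) (by positivity)
  have i3 := T.inv ((1 - x) * y / (x * (1 - y))) (by positivity)
  rw [inv_div] at i1 i2 i3
  rw [i1, i2, mul_comm x (1 - y), mul_comm (1 - x) y] at h'
  rw [mul_comm (1 - x) y, mul_comm x (1 - y)] at i3
  rw [mul_comm (1 - x) y, mul_comm x (1 - y)] at h
  rw [mul_comm (1 - y) x] at h' i3
  rw [mul_comm (1 - y) x] at h
  rw [i3] at h'
  have e : X (1 - x) * X x = X x * X (1 - x) := mul_comm _ _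
  rw [e] at h'
  linear_combination (norm := module) h + h'

theorem E_const (T : Tw X f) (hm : X (-1) = 1) (p v : F) (hp0 : p ≠ 0) (hv0 : v ≠ 0)
    (hp : X p = -1) (hv : X v = -1) :
    X (1 - p) • f p = X (1 - v) • f v := by
  have hp1 : p ≠ 1 := by rintro rfl; rw [T.X1] at hp; norm_num at hp
  have hv1 : v ≠ 1 := by rintro rfl; rw [T.X1] at hv; norm_num at hv
  have hp1' : p - 1 ≠ 0 := sub_ne_zero.mpr hp1
  have hv1' : v - 1 ≠ 0 := sub_ne_zero.mpr hv1
  have hp1'' : 1 - p ≠ 0 := sub_ne_zero.mpr (Ne.symm hp1)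
  have hv1'' : 1 - v ≠ 0 := sub_ne_zero.mpr (Ne.symm hv1)
  by_cases hpv : v * p = 1
  · have : p = v⁻¹ := by field_simp; linear_combination hpv
    subst this
    rw [T.inv v hv0]
    have : X (1 - v⁻¹) = - X (1 - v) := by
      rw [show 1 - v⁻¹ = (v - 1) / v by field_simp, T.Xdiv _ _ hv0, T.Xsub hm, hv]; ring
    rw [this]; simp
  have hq : v * p - 1 ≠ 0 := sub_ne_zero.mpr hpv
  have hq2 : p * v - 1 ≠ 0 := by rwa [mul_comm]
  set x := (v - 1) / (v * p - 1) with hx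
  have hx0 : x ≠ 0 := div_ne_zero hv1' hq
  have e1 : 1 - x = v * (p - 1) / (v * p - 1) := by rw [hx]; field_simp; ring
  have h1x : 1 - x ≠ 0 := by rw [e1]; exact div_ne_zero (mul_ne_zero hv0 hp1') hq
  have hx1 : x ≠ 1 := fun h => h1x (by rw [h]; ring)
  have e2 : 1 - p * x = (p - 1) / (v * p - 1) := by rw [hx]; field_simp; ring
  have h1y : 1 - p * x ≠ 0 := by rw [e2]; exact div_ne_zero hp1' hq
  have hy1 : p * x ≠ 1 := fun h => h1y (by rw [h]; ring)
  have hy0 : p * x ≠ 0 := mul_ne_zero hp0 hx0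
  have h := T.ft' hm x (p * x) hx0 hx1 hy0 hy1
  have h' := T.ft' hm (p * x) x hy0 hy1 hx0 hx1
  have q1 : (1 - x) / (1 - p * x) = v := by rw [e1, e2]; field_simp
  have q1' : (1 - p * x) / (1 - x) = v⁻¹ := by rw [e1, e2]; field_simp
  have q2 : p * x / x = p := by field_simp
  have q2' : x / (p * x) = p⁻¹ := by field_simp
  have q3 : (1 - x) * (p * x) / (x * (1 - p * x)) = v * p := by rw [e1, e2]; field_simp
  have q3' : (1 - p * x) * x / (p * x * (1 - x)) = (v * p)⁻¹ := by rw [e1, e2]; field_simp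
  rw [q1, q2, q3] at h
  rw [q1', q2', q3', T.inv v hv0, T.inv p hp0, T.inv (v * p) (mul_ne_zero hv0 hp0)] at h'
  have a1 : X (1 - p * x) = X (1 - p) * X (v * p - 1) := by
    rw [e2, T.Xdiv _ _ hq, T.Xsub hm]
  have a2 : X (1 - x) = - X (1 - p) * X (v * p - 1) := by
    rw [e1, T.Xdiv _ _ hq, T.mul, T.Xsub hm, hv]; ring
  have a3 : X x = X (1 - v) * X (v * p - 1) := by
    rw [hx, T.Xdiv _ _ hq, T.Xsub hm]
  rw [T.mul p x, hp, a1, a3] at h'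
  rw [a2, a3] at h
  apply sub_eq_zero.mp
  apply T.tt
  rcases T.pm _ hp1'' with c1 | c1 <;> rcases T.pm _ hv1'' with c2 | c2 <;>
    rcases T.pm _ hq with c3 | c3 <;> rw [c1, c2, c3] at h h' <;> rw [c1, c2] <;>
    first
    | linear_combination (norm := module) h + h'
    | linear_combination (norm := module) -h - h'

/-- If `χ(x) = -1` then `f x = χ(1-x) C`. -/
theorem valC (T : Tw X f) (hm : X (-1) = 1) (C : A)
    (hC : ∀ x, x ≠ 0 → x ≠ 1 → f x + f (1 - x) = C) (p : F) (hp0 : p ≠ 0) (hp : X p = -1) :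
    f p = X (1 - p) • C ∧ (3 : ℤ) • C = 0 := by
  have key : ∀ r : F, r ≠ 0 → X r = -1 → X (1 - r) = 1 → f r = C ∧ (3 : ℤ) • C = 0 := by
    intro r hr0 hr hr'
    have hr1 : r ≠ 1 := by rintro rfl; rw [T.X1] at hr; norm_num at hr
    have h1r : 1 - r ≠ 0 := sub_ne_zero.mpr (Ne.symm hr1)
    have c1 := hC r hr0 hr1
    have h1r' : 1 - (1 - r)⁻¹ = - (r / (1 - r)) := by field_simp; ring
    have c2 := hC (1 - r)⁻¹ (inv_ne_zero h1r) (by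
      intro h; rw [inv_eq_one] at h; apply hr0; linear_combination -h)
    rw [T.inv _ h1r] at c2
    have hs0 : 1 - (1 - r)⁻¹ ≠ 0 := by rw [h1r']; exact neg_ne_zero.mpr (div_ne_zero hr0 h1r)
    have hs : X (1 - (1 - r)⁻¹) = -1 := by
      rw [h1r', T.Xneg hm, T.Xdiv _ _ h1r, hr, hr']; norm_num
    have e := T.E_const hm r _ hr0 hs0 hr hs
    rw [sub_sub_cancel, T.Xinv _ h1r, hr'] at e
    have hh : f r = C := by
      apply sub_eq_zero.mp; apply T.tt
      linear_combination (norm := module) e + c1 + c2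
    refine ⟨hh, ?_⟩
    -- use r⁻¹
    have ri := T.inv r hr0
    have hri1 : r⁻¹ ≠ 1 := by simpa using hr1
    have c3 := hC r⁻¹ (inv_ne_zero hr0) hri1
    have h4 : 1 - r⁻¹ ≠ 0 := sub_ne_zero.mpr (Ne.symm hri1)
    have h5 : X (1 - r⁻¹) = -1 := by
      rw [show 1 - r⁻¹ = (r - 1) / r by field_simp, T.Xdiv _ _ hr0, T.Xsub hm, hr, hr']; norm_num
    have e2 := T.E_const hm r _ hr0 h4 hr h5
    rw [sub_sub_cancel, T.Xinv _ hr0, hr, hr'] at e2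
    linear_combination (norm := module) e2 - c3 + ri - (2:ℤ) • hh
  have hp1 : p ≠ 1 := by rintro rfl; rw [T.X1] at hp; norm_num at hp
  have h1p : 1 - p ≠ 0 := sub_ne_zero.mpr (Ne.symm hp1)
  rcases T.pm _ h1p with h | h
  · rw [h, one_smul]; exact key p hp0 hp h
  · have h5 : X (1 - p⁻¹) = 1 := by
      rw [show 1 - p⁻¹ = (p - 1) / p by field_simp, T.Xdiv _ _ hp0, T.Xsub hm, hp, h]; norm_num
    obtain ⟨k1, k2⟩ := key p⁻¹ (inv_ne_zero hp0) (by rw [T.Xinv _ hp0, hp]) h5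
    refine ⟨?_, k2⟩
    rw [h]
    rw [T.inv p hp0] at k1
    linear_combination (norm := module) -k1

theorem val0 (T : Tw X f) (hm : X (-1) = 1) (C : A)
    (hC : ∀ x, x ≠ 0 → x ≠ 1 → f x + f (1 - x) = C) (p : F) (hp0 : p ≠ 0) (hp1 : p ≠ 1)
    (hp : X p = 1) (hp' : X (1 - p) = -1) : f p = 0 := by
  have h1p : 1 - p ≠ 0 := sub_ne_zero.mpr (Ne.symm hp1)
  have h := (T.valC hm C hC _ h1p hp').1
  rw [sub_sub_cancel, hp] at h
  linear_combination (norm := module) hC p hp0 hp1 - h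

/-- config lemma for `C = 0` -/
theorem C_zero (T : Tw X f) (hm : X (-1) = 1) (C : A)
    (hC : ∀ x, x ≠ 0 → x ≠ 1 → f x + f (1 - x) = C) (x y : F) (hx0 : x ≠ 0) (hy0 : y ≠ 0)
    (hx : X x = -1) (hy : X y = 1) (hy' : X (1 - y) = -1) (hy1 : y ≠ 1)
    (hxy : X (1 - x) = - X (x - y)) : C = 0 := by
  have hx1 : x ≠ 1 := by rintro rfl; rw [T.X1] at hx; norm_num at hx
  have hne : x - y ≠ 0 := by
    intro h; rw [sub_eq_zero.mp h, hy] at hx; norm_num at hx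
  have h1x : 1 - x ≠ 0 := sub_ne_zero.mpr (Ne.symm hx1)
  have h1y : 1 - y ≠ 0 := sub_ne_zero.mpr (Ne.symm hy1)
  have h := T.ft' hm x y hx0 hx1 hy0 hy1
  have b1 := (T.valC hm C hC x hx0 hx).1
  have b2 := T.val0 hm C hC y hy0 hy1 hy hy'
  have b3 := (T.valC hm C hC (y / x) (div_ne_zero hy0 hx0) (by rw [T.Xdiv _ _ hx0, hx, hy]; simp)).1
  rw [show 1 - y / x = (x - y) / x by field_simp, T.Xdiv _ _ hx0, hx] at b3
  have w1 : 1 - (1 - x) * y / (x * (1 - y)) = (x - y) / (x * (1 - y)) := by field_simp; ring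
  have w2 : 1 - (1 - x) / (1 - y) = (x - y) / (1 - y) := by field_simp; ring
  have n1 : (1 - x) * y / (x * (1 - y)) ≠ 1 := by
    intro h; rw [h, sub_self, eq_comm, div_eq_zero_iff] at w1
    rcases w1 with w | w
    · exact hne w
    · exact mul_ne_zero hx0 h1y w
  have n2 : (1 - x) / (1 - y) ≠ 1 := by
    intro h; rw [h, sub_self, eq_comm, div_eq_zero_iff] at w2
    rcases w2 with w | w
    · exact hne w
    · exact h1y w
  have Y1 : X ((1 - x) * y / (x * (1 - y))) = X (1 - x) := by
    rw [T.Xdiv _ _ (mul_ne_zero hx0 h1y), T.mul, T.mul, hx, hy, hy']; ring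
  have Y1' : X (1 - (1 - x) * y / (x * (1 - y))) = X (x - y) := by
    rw [w1, T.Xdiv _ _ (mul_ne_zero hx0 h1y), T.mul, hx, hy']; ring
  have Y2 : X ((1 - x) / (1 - y)) = - X (1 - x) := by
    rw [T.Xdiv _ _ h1y, hy']; ring
  have Y2' : X (1 - (1 - x) / (1 - y)) = - X (x - y) := by
    rw [w2, T.Xdiv _ _ h1y, hy']; ring
  have N1 : (1 - x) * y / (x * (1 - y)) ≠ 0 := by positivity
  have N2 : (1 - x) / (1 - y) ≠ 0 := by positivity
  rcases T.pm _ hne with c | c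
  · rw [c] at hxy b3 Y1' Y2'
    rw [hxy] at Y1 Y2 b1
    have b4 := (T.valC hm C hC _ N1 Y1).1
    have b5 := T.val0 hm C hC _ N2 n2 (by rw [Y2]; norm_num) Y2'
    rw [Y1'] at b4
    rw [b1, b2, b3, b4, b5, hx, hxy] at h
    linear_combination (norm := module) -h
  · rw [c] at hxy b3 Y1' Y2'
    rw [hxy] at Y1 Y2 b1
    have b4 := T.val0 hm C hC _ N1 n1 (by rw [Y1]; norm_num) Y1'
    have b5 := (T.valC hm C hC _ N2 (by rw [Y2]; norm_num)).1
    rw [Y2'] at b5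
    rw [b1, b2, b3, b4, b5, hx, hxy] at h
    linear_combination (norm := module) h

theorem D_zero (T : Tw X f) (hm : X (-1) = 1)
    (hC : ∀ x, x ≠ 0 → x ≠ 1 → f x + f (1 - x) = 0) (x y : F) (hx0 : x ≠ 0) (hy0 : y ≠ 0)
    (hx : X x = -1) (hy1 : y ≠ 1) (hne : x - y ≠ 0)
    (hxy : X (1 - x) = - X (x - y)) : f y = 0 := by
  have v1 : ∀ p, p ≠ 0 → X p = -1 → f p = 0 := fun p h0 h => by
    rw [(T.valC hm 0 hC p h0 h).1, smul_zero]
  have h1y : 1 - y ≠ 0 := sub_ne_zero.mpr (Ne.symm hy1)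
  rcases T.pm y hy0 with hy | hy
  swap
  · exact v1 y hy0 hy
  rcases T.pm _ h1y with hy' | hy'
  swap
  · exact T.val0 hm 0 hC y hy0 hy1 hy hy'
  have hx1 : x ≠ 1 := by rintro rfl; rw [T.X1] at hx; norm_num at hx
  have h1x : 1 - x ≠ 0 := sub_ne_zero.mpr (Ne.symm hx1)
  have h := T.ft' hm x y hx0 hx1 hy0 hy1
  have b1 := v1 x hx0 hx
  have b3 := v1 (y / x) (div_ne_zero hy0 hx0) (by rw [T.Xdiv _ _ hx0, hx, hy]; simp)
  have w1 : 1 - (1 - x) * y / (x * (1 - y)) = (x - y) / (x * (1 - y)) := by field_simp; ring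
  have w2 : 1 - (1 - x) / (1 - y) = (x - y) / (1 - y) := by field_simp; ring
  have n1 : (1 - x) * y / (x * (1 - y)) ≠ 1 := by
    intro h; rw [h, sub_self, eq_comm, div_eq_zero_iff] at w1
    rcases w1 with w | w
    · exact hne w
    · exact mul_ne_zero hx0 h1y w
  have n2 : (1 - x) / (1 - y) ≠ 1 := by
    intro h; rw [h, sub_self, eq_comm, div_eq_zero_iff] at w2
    rcases w2 with w | w
    · exact hne w
    · exact h1y w
  have Y1 : X ((1 - x) * y / (x * (1 - y))) = - X (1 - x) := by
    rw [T.Xdiv _ _ (mul_ne_zero hx0 h1y), T.mul, T.mul, hx, hy, hy']; ring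
  have Y1' : X (1 - (1 - x) * y / (x * (1 - y))) = - X (x - y) := by
    rw [w1, T.Xdiv _ _ (mul_ne_zero hx0 h1y), T.mul, hx, hy']; ring
  have Y2 : X ((1 - x) / (1 - y)) = X (1 - x) := by
    rw [T.Xdiv _ _ h1y, hy']; ring
  have Y2' : X (1 - (1 - x) / (1 - y)) = X (x - y) := by
    rw [w2, T.Xdiv _ _ h1y, hy']; ring
  have N1 : (1 - x) * y / (x * (1 - y)) ≠ 0 := by positivity
  have N2 : (1 - x) / (1 - y) ≠ 0 := by positivity
  rcases T.pm _ hne with c | c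
  · rw [c] at hxy Y1' Y2'
    rw [hxy] at Y1 Y2
    have b4 := T.val0 hm 0 hC _ N1 n1 (by rw [Y1]; norm_num) Y1'
    have b5 := v1 _ N2 Y2
    rw [b1, b3, b4, b5] at h
    simpa using h
  · rw [c] at hxy Y1' Y2'
    rw [hxy] at Y1 Y2
    have b4 := v1 _ N1 (by rw [Y1]; norm_num)
    have b5 := T.val0 hm 0 hC _ N2 n2 (by rw [Y2]; norm_num) Y2'
    rw [b1, b3, b4, b5] at h
    simpa using h

end Tw


namespace Tw
variable {F : Type} [Field F] {A : Type} [AddCommGroup A] {X : F → ℤ} {f : F → A}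
variable {Γ : Type} [LinearOrderedCommGroupWithZero Γ]

theorem v_one_sub (v : Valuation F Γ) {z : F} (hz : v z < 1) : v (1 - z) = 1 := by
  have := Valuation.map_sub_eq_of_lt_right v (x := z) (y := 1) (by simpa using hz)
  rw [Valuation.map_sub_swap, this, map_one]

theorem one_sub_ne0 (v : Valuation F Γ) {z : F} (hz : v z < 1) : 1 - z ≠ 0 := by
  intro h; have := v_one_sub v hz; rw [h, map_zero] at this; exact zero_ne_one this

/-- it suffices to treat the `y` with `v y ≤ 1` and `v (1-y) = 1` -/
theorem wlog_y (T : Tw X f) (v : Valuation F Γ)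
    (hC : ∀ x, x ≠ 0 → x ≠ 1 → f x + f (1 - x) = 0)
    (h : ∀ y, y ≠ 0 → y ≠ 1 → v y ≤ 1 → v (1 - y) = 1 → f y = 0) (y : F) (hy : y ≠ 0) :
    f y = 0 := by
  have key : ∀ y, y ≠ 0 → v y ≤ 1 → f y = 0 := by
    intro y hy0 hy
    by_cases hy1 : y = 1
    · rw [hy1, T.one]
    have h1y : 1 - y ≠ 0 := sub_ne_zero.mpr (Ne.symm hy1)
    have hle : v (1 - y) ≤ 1 := by
      have := v.map_sub 1 y
      rw [map_one, max_eq_left hy] at this; exact this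
    rcases hle.lt_or_eq with h1 | h1
    · have h2 := v_one_sub v h1
      have := h (1 - y) h1y (by simpa using hy0) hle h2
      have h3 := hC y hy0 hy1
      rwa [this, add_zero] at h3
    · exact h y hy0 hy1 hy h1
  rcases le_or_gt (v y) 1 with h1 | h1
  · exact key y hy h1
  · have := key y⁻¹ (inv_ne_zero hy) (by rw [map_inv₀]; exact inv_le_one_of_one_le₀ h1.le)
    rw [T.inv y hy] at this
    simpa using this

theorem caseA1 (T : Tw X f) (hm : X (-1) = 1) (v : Valuation F Γ) (z0 : F) (hz0 : z0 ≠ 0)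
    (hv0 : v z0 < 1) (hX0 : X (1 - z0) = -1)
    (hK : ∀ z t, v z ≤ v z0 → v t < 1 → X (1 - z * t) = 1) (y : F) (hy : y ≠ 0) : f y = 0 := by
  have shift : ∀ t, v t < 1 → X (1 - z0 * (1 + t)) = -1 := by
    intro t ht
    have h1 := one_sub_ne0 v hv0
    have e : 1 - z0 * (1 + t) = (1 - z0) * (1 - z0 * (t / (1 - z0))) := by field_simp; ring
    rw [e, T.mul, hX0, hK _ _ le_rfl, mul_one]
    rw [map_div₀, v_one_sub v hv0, div_one]; exact ht
  have h10 := one_sub_ne0 v hv0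
  -- both signs
  have both : ∀ c : F, c ≠ 0 → ∀ s : ℤ, (s = 1 ∨ s = -1) → ∃ t, v t < 1 ∧ X (z0 * (1 + t) / c) = s ∧
      1 + t ≠ 0 := by
    intro c hc s hs
    have h0 := T.pm (z0 / c) (div_ne_zero hz0 hc)
    by_cases h : X (z0 / c) = s
    · exact ⟨0, by simp, by simpa using h, by simp⟩
    · refine ⟨-z0, by simpa using hv0, ?_, by simpa [← sub_eq_add_neg] using h10⟩
      rw [show z0 * (1 + -z0) / c = (z0 / c) * (1 - z0) by ring, T.mul, hX0]
      omega
  obtain ⟨C, hC⟩ : ∃ C, ∀ x, x ≠ 0 → x ≠ 1 → f x + f (1 - x) = C :=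
    ⟨_, fun x h h' => T.const hm x z0 h h' hz0 (by rintro rfl; simp at h10)⟩
  have vt : ∀ t, v t < 1 → v (1 + t) = 1 := fun t ht => by
    rw [← sub_neg_eq_add]; exact v_one_sub v (by simpa using ht)
  have hC0 : C = 0 := by
    obtain ⟨t, ht, hXt, ht0⟩ := both 1 one_ne_zero 1 (by simp)
    obtain ⟨t', ht', hXt', ht0'⟩ := both 1 one_ne_zero (-1) (by simp)
    rw [div_one] at hXt hXt'
    have s1 := shift t ht
    have s2 := shift t' ht'
    set z := z0 * (1 + t) with hz
    set z' := z0 * (1 + t') with hz'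
    have vz : v z = v z0 := by rw [hz, map_mul, vt t ht, mul_one]
    have vz' : v z' = v z0 := by rw [hz', map_mul, vt t' ht', mul_one]
    have nz : z ≠ 0 := mul_ne_zero hz0 ht0
    have nz' : z' ≠ 0 := mul_ne_zero hz0 ht0'
    refine T.C_zero hm C hC z'⁻¹ z (inv_ne_zero nz') nz (by rw [T.Xinv _ nz', hXt']) hXt s1 ?_ ?_
    · rintro h; have := one_sub_ne0 v (vz.trans_lt hv0); rw [h] at this; simp at this
    · rw [show 1 - z'⁻¹ = (z' - 1) / z' by field_simp,
        show z'⁻¹ - z = (1 - z * z') / z' by field_simp, T.Xdiv _ _ nz', T.Xdiv _ _ nz',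
        T.Xsub hm z' 1, s2, hK z z' vz.le (vz'.trans_lt hv0), hXt']
      norm_num
  subst hC0
  refine T.wlog_y v hC ?_ y hy
  clear y hy
  intro y hy0 hy1 hvy hv1y
  have h1y : 1 - y ≠ 0 := sub_ne_zero.mpr (Ne.symm hy1)
  obtain ⟨t, ht, hXt, ht0⟩ := both (1 - y) h1y (-1) (by simp)
  set z := z0 * (1 + t) / (1 - y) with hz
  have vz : v z = v z0 := by rw [hz, map_div₀, map_mul, vt t ht, mul_one, hv1y, div_one]
  have nz : z ≠ 0 := div_ne_zero (mul_ne_zero hz0 ht0) h1y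
  have vyz : v (y * z) < 1 := by
    rw [map_mul, vz]; exact (mul_le_of_le_one_left' hvy).trans_lt hv0
  have n1 := one_sub_ne0 v vyz
  clear_value z
  have e : 1 - z = (1 - y * z) * (1 - z0 * (1 + (t + y * z) / (1 - y * z))) := by
    have : z0 * (1 + t) = z * (1 - y) := by rw [hz]; field_simp
    have e2 : 1 + (t + y * z) / (1 - y * z) = (1 + t) / (1 - y * z) := by field_simp; ring
    rw [e2, ← mul_div_assoc, this, mul_sub, mul_div_cancel₀ _ n1]; ring
  have vt' : v ((t + y * z) / (1 - y * z)) < 1 := by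
    rw [map_div₀, v_one_sub v vyz, div_one]
    exact (v.map_add _ _).trans_lt (max_lt ht vyz)
  have hX : X (1 - z) = - X (1 - y * z) := by
    rw [e, T.mul, shift _ vt']; ring
  refine T.D_zero hm hC z⁻¹ y (inv_ne_zero nz) hy0 (by rw [T.Xinv _ nz, hXt]) hy1 ?_ ?_
  · rw [show z⁻¹ - y = (1 - y * z) / z by field_simp]
    exact div_ne_zero n1 nz
  · rw [show 1 - z⁻¹ = (z - 1) / z by field_simp,
        show z⁻¹ - y = (1 - y * z) / z by field_simp, T.Xdiv _ _ nz, T.Xdiv _ _ nz,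
        T.Xsub hm z 1, hX]
    ring

theorem lemQ {K : Type} [Field K] [Finite K] (η : K → ℤ) (hmul : ∀ x y, x ≠ 0 → y ≠ 0 → η (x * y) = η x * η y)
    (hpm : ∀ x, x ≠ 0 → η x = 1 ∨ η x = -1) (n : K) (hn0 : n ≠ 0) (hn : η n = -1)
    (hm : η (-1) = 1) (h1 : η 1 = 1) (y : K) (hy0 : y ≠ 0) (hy1 : y ≠ 1) (hy : η y = 1) :
    ∃ x, x ≠ 0 ∧ η x = -1 ∧ x - y ≠ 0 ∧ 1 - x ≠ 0 ∧ η (1 - x) = - η (x - y) := by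
  by_contra hcon
  push Not at hcon
  have hinv : ∀ x, x ≠ 0 → η x⁻¹ = η x := by
    intro x hx
    have := hmul x x⁻¹ hx (inv_ne_zero hx)
    rw [mul_inv_cancel₀ hx, h1] at this
    rcases hpm x hx with h | h <;> rw [h] at this ⊢ <;> omega
  have nq : ∀ a, a ≠ 0 → η a = 1 → (n * a ≠ 0 ∧ n * a - y ≠ 0 ∧ 1 - n * a ≠ 0 ∧ η (n * a) = -1) := by
    intro a ha0 ha
    have h : η (n * a) = -1 := by rw [hmul _ _ hn0 ha0, hn, ha]; norm_num
    refine ⟨mul_ne_zero hn0 ha0, ?_, ?_, h⟩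
    · intro h'; rw [sub_eq_zero.mp h', hy] at h; norm_num at h
    · intro h'; rw [← sub_eq_zero.mp h', h1] at h; norm_num at h
  let g : {a : K // a ≠ 0 ∧ η a = 1} → {a : K // a ≠ 0 ∧ η a = 1} := fun a =>
    ⟨(1 - n * a.1) / (n * a.1 - y), by
      obtain ⟨h0, h2, h3, h4⟩ := nq a.1 a.2.1 a.2.2
      refine ⟨div_ne_zero h3 h2, ?_⟩
      rw [div_eq_mul_inv, hmul _ _ h3 (inv_ne_zero h2), hinv _ h2]
      have := hcon _ h0 h4 h2 h3
      rcases hpm _ h3 with h5 | h5 <;> rcases hpm _ h2 with h6 | h6 <;> rw [h5, h6] at this ⊢ <;>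
        omega⟩
  have hg : Function.Injective g := by
    rintro ⟨a, ha⟩ ⟨b, hb⟩ hab
    obtain ⟨h0, h2, h3, h4⟩ := nq a ha.1 ha.2
    obtain ⟨h0', h2', h3', h4'⟩ := nq b hb.1 hb.2
    simp only [g, Subtype.mk.injEq] at hab
    rw [div_eq_div_iff h2 h2'] at hab
    have : (1 - y) * n * (a - b) = 0 := by linear_combination -hab
    have h1y : 1 - y ≠ 0 := sub_ne_zero.mpr (Ne.symm hy1)
    have := (mul_eq_zero.mp this).resolve_left (mul_ne_zero h1y hn0)
    exact Subtype.ext (sub_eq_zero.mp this)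
  obtain ⟨⟨a, ha⟩, hb⟩ := (Finite.injective_iff_surjective.mp hg)
    ⟨-1 * y⁻¹, mul_ne_zero (by simp) (inv_ne_zero hy0), by
      rw [hmul _ _ (by simp) (inv_ne_zero hy0), hinv _ hy0, hm, hy]; norm_num⟩
  obtain ⟨h0, h2, h3, h4⟩ := nq a ha.1 ha.2
  simp only [g, Subtype.mk.injEq] at hb
  rw [div_eq_iff h2] at hb
  have : (1 - y) * (n * a) = 0 := by
    field_simp at hb
    linear_combination hb
  have h1y : 1 - y ≠ 0 := sub_ne_zero.mpr (Ne.symm hy1)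
  exact mul_ne_zero h1y h0 this

/-- residual data -/
structure Res {K : Type} [Field K] (v : Valuation F Γ) (ρ : F → K) : Prop where
  sur : ∀ a : K, ∃ x, v x ≤ 1 ∧ ρ x = a
  mul : ∀ x y, v x ≤ 1 → v y ≤ 1 → ρ (x * y) = ρ x * ρ y
  sub : ∀ x y, v x ≤ 1 → v y ≤ 1 → ρ (x - y) = ρ x - ρ y
  one : ρ 1 = 1
  ker : ∀ x, v x ≤ 1 → (ρ x = 0 ↔ v x < 1)

theorem Res.unit {K : Type} [Field K] {v : Valuation F Γ} {ρ : F → K} (R : Res v ρ) {x : F}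
    (hx : v x = 1) : ρ x ≠ 0 := by
  intro h; rw [R.ker x hx.le, hx] at h; exact lt_irrefl _ h

theorem Res.lift {K : Type} [Field K] {v : Valuation F Γ} {ρ : F → K} (R : Res v ρ) {a : K}
    (ha : a ≠ 0) : ∃ x, v x = 1 ∧ ρ x = a := by
  obtain ⟨x, hx, rfl⟩ := R.sur a
  refine ⟨x, ?_, rfl⟩
  by_contra h
  exact ha ((R.ker x hx).mpr (lt_of_le_of_ne hx h))

theorem ne_of_v {v : Valuation F Γ} {x : F} (hx : v x = 1) : x ≠ 0 := by
  rintro rfl; simp at hx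

theorem X_res (T : Tw X f) {K : Type} [Field K] {v : Valuation F Γ} {ρ : F → K} (R : Res v ρ)
    (hU1 : ∀ z, v z < 1 → X (1 - z) = 1) {x y : F} (hx : v x = 1) (hy : v y = 1)
    (h : ρ x = ρ y) : X x = X y := by
  have h1 : v (x - y) < 1 := by
    have hle : v (x - y) ≤ 1 := by
      have := v.map_sub x y; rwa [hx, hy, max_self] at this
    rw [← R.ker _ hle, R.sub _ _ hx.le hy.le, h, sub_self]
  have hy0 := ne_of_v hy
  have : x = y * (1 - (y - x) / y) := by field_simp; ring
  rw [this, T.mul, hU1, mul_one]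
  rw [map_div₀, hy, div_one, Valuation.map_sub_swap]; exact h1

theorem X_sq (T : Tw X f) {K : Type} [Field K] {v : Valuation F Γ} {ρ : F → K} (R : Res v ρ)
    (hU1 : ∀ z, v z < 1 → X (1 - z) = 1) {x : F} (hx : v x = 1) (h : IsSquare (ρ x)) : X x = 1 := by
  obtain ⟨c, hc⟩ := h
  have hc0 : c ≠ 0 := by rintro rfl; exact R.unit hx (by simpa using hc)
  obtain ⟨w, hw, rfl⟩ := R.lift hc0
  rw [T.X_res R hU1 hx (y := w * w) (by simp [hw]) (by rw [hc, R.mul _ _ hw.le hw.le])]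
  exact T.sq w (ne_of_v hw)

theorem caseA2 (T : Tw X f) (hm : X (-1) = 1) {K : Type} [Field K] [Finite K] {v : Valuation F Γ}
    {ρ : F → K} (R : Res v ρ)
    (hU1 : ∀ z, v z < 1 → X (1 - z) = 1) (u : F) (hu : v u = 1) (hXu : X u = -1)
    (y : F) (hy : y ≠ 0) : f y = 0 := by
  classical
  choose! l hl hl' using fun (a : K) (ha : a ≠ 0) => R.lift ha
  set η : K → ℤ := fun a => X (l a) with hη
  have ηρ : ∀ x, v x = 1 → η (ρ x) = X x := fun x hx =>
    T.X_res R hU1 (hl _ (R.unit hx)) hx (hl' _ (R.unit hx))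
  have vle : ∀ x y, v x ≤ 1 → v y ≤ 1 → v (x - y) ≤ 1 := fun x y hx hy =>
    (v.map_sub x y).trans (max_le hx hy)
  have vsub : ∀ x y, v x ≤ 1 → v y ≤ 1 → ρ x - ρ y ≠ 0 → v (x - y) = 1 := by
    intro x y hx hy h
    by_contra h'
    exact h ((R.sub x y hx hy).symm.trans ((R.ker _ (vle x y hx hy)).mpr
      (lt_of_le_of_ne (vle x y hx hy) h')))
  have hη1 : η 1 = 1 := by rw [← R.one, ηρ 1 (map_one v), T.X1]
  have hηm : η (-1) = 1 := by
    have : ρ (-1) = -1 := by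
      have h0 := R.sub 1 1 (by simp) (by simp)
      have := R.sub 0 1 (by simp) (by simp)
      rw [sub_self, sub_self] at h0
      rwa [zero_sub, R.one, h0, zero_sub] at this
    rw [← this, ηρ _ (by simp), hm]
  have Q : ∀ y, v y = 1 → v (1 - y) = 1 → X y = 1 → ∃ x, x ≠ 0 ∧ X x = -1 ∧ x - y ≠ 0 ∧
      X (1 - x) = - X (x - y) := by
    intro y hy h1y hXy
    obtain ⟨a, ha0, ha, ha1, ha2, ha3⟩ := lemQ η (fun a b ha hb => by
        rw [← hl' a ha, ← hl' b hb, ← R.mul _ _ (hl a ha).le (hl b hb).le, ηρ _ (hl a ha),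
          ηρ _ (hl b hb), ηρ _ (by rw [map_mul, hl a ha, hl b hb, one_mul]), T.mul])
      (fun a ha => T.pm _ (ne_of_v (hl a ha))) (ρ u) (R.unit hu) (by rw [ηρ u hu, hXu]) hηm hη1
      (ρ y) (R.unit hy) (by
        intro h
        have := R.unit h1y
        rw [R.sub _ _ (by simp) hy.le, R.one, h, sub_self] at this
        exact this rfl) (by rw [ηρ y hy, hXy])
    obtain ⟨x, hx, rfl⟩ := R.lift ha0
    have v1 := vsub x y hx.le hy.le ha1
    have v2 := vsub 1 x (by simp) hx.le (by rwa [R.one])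
    refine ⟨x, ne_of_v hx, by rw [← ηρ x hx, ha], ne_of_v v1, ?_⟩
    rw [← ηρ _ v1, ← ηρ _ v2, R.sub _ _ hx.le hy.le, R.sub _ _ (by simp) hx.le, R.one, ha3]
  have h1u : ∀ u, v u = 1 → X u = -1 → v (1 - u) = 1 := by
    intro u hu hXu
    by_contra h
    have hlt := lt_of_le_of_ne (vle 1 u (by simp) hu.le) h
    have := hU1 _ hlt
    rw [sub_sub_cancel, hXu] at this
    norm_num at this
  -- a nonsquare `g` with `1 - g` a square
  obtain ⟨g, hg, hXg, hXg'⟩ : ∃ g, v g = 1 ∧ X g = -1 ∧ X (1 - g) = 1 := by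
    have hu0 := ne_of_v hu
    rcases T.pm _ (ne_of_v (h1u u hu hXu)) with h | h
    · exact ⟨u, hu, hXu, h⟩
    · refine ⟨u⁻¹, by simp [hu], by rw [T.Xinv _ hu0, hXu], ?_⟩
      rw [show 1 - u⁻¹ = (u - 1) / u by field_simp, T.Xdiv _ _ hu0, T.Xsub hm, h, hXu]; norm_num
  have hg0 := ne_of_v hg
  have hg1 := ne_of_v (h1u g hg hXg)
  have hg1' : 1 - g ≠ 1 := by simpa using hg0
  obtain ⟨C, hC⟩ : ∃ C, ∀ x, x ≠ 0 → x ≠ 1 → f x + f (1 - x) = C :=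
    ⟨_, fun x h h' => T.const hm x (1 - g) h h' hg1 hg1'⟩
  have hC0 : C = 0 := by
    obtain ⟨x, hx0, hx, -, hx'⟩ := Q (1 - g) (h1u g hg hXg) (by rwa [sub_sub_cancel]) hXg'
    exact T.C_zero hm C hC x (1 - g) hx0 hg1 hx hXg' (by rwa [sub_sub_cancel]) hg1' hx'
  subst hC0
  refine T.wlog_y v hC ?_ y hy
  clear y hy
  intro y hy0 hy1 hvy hv1y
  rcases hvy.lt_or_eq with h | h
  · have e : g - y = g * (1 - y / g) := by field_simp
    have hyg : v (y / g) < 1 := by rwa [map_div₀, hg, div_one]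
    refine T.D_zero hm hC g y hg0 hy0 hXg hy1 ?_ ?_
    · rw [e]; exact mul_ne_zero hg0 (one_sub_ne0 v hyg)
    · rw [e, T.mul, hU1 _ hyg, hXg, hXg']; norm_num
  · rcases T.pm y hy0 with hy | hy
    · obtain ⟨x, hx0, hx, hxy, hx'⟩ := Q y h hv1y hy
      exact T.D_zero hm hC x y hx0 hy0 hx hy1 hxy hx'
    · rw [(T.valC hm 0 hC y hy0 hy).1, smul_zero]

open WithZero in
theorem thmA (T : Tw X f) {K : Type} [Field K] {v : Valuation F (WithZero (Multiplicative ℤ))}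
    {ρ : F → K} (R : Res v ρ)
    (hk : Finite K ∨ (∀ a : K, IsSquare a) ∨ (∀ a : K, IsSquare a ∨ IsSquare (-a)))
    (hU : ∃ n : ℕ, ∀ z, v z ≤ exp (-(n : ℤ)) → X (1 - z) = 1)
    (u : F) (hu : v u = 1) (hXu : X u = -1) (y : F) (hy : y ≠ 0) : f y = 0 := by
  classical
  by_cases hm : X (-1) = 1
  swap
  · exact T.zero_of_neg hm y hy
  by_cases hU1 : ∀ z, v z < 1 → X (1 - z) = 1
  · rcases hk with hk | hk | hk
    · exact T.caseA2 hm R hU1 u hu hXu y hy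
    · rw [T.X_sq R hU1 hu (hk _)] at hXu; norm_num at hXu
    · rcases hk (ρ u) with h | h
      · rw [T.X_sq R hU1 hu h] at hXu; norm_num at hXu
      · have : ρ (-u) = -ρ u := by
          have h0 := R.sub 1 1 (by simp) (by simp)
          have := R.sub 0 u (by simp) hu.le
          rw [sub_self, sub_self] at h0
          rwa [zero_sub, h0, zero_sub] at this
        rw [← this] at h
        have h := T.X_sq R hU1 (by rwa [Valuation.map_neg]) h
        rw [T.Xneg hm, hXu] at h; norm_num at h
  · push Not at hU1
    obtain ⟨w, hw, hXw⟩ := hU1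
    have vlt : ∀ z : F, ∀ n : ℤ, v z < exp (-n) → v z ≤ exp (-(n + 1)) := by
      intro z n h
      by_cases hz : v z = 0
      · rw [hz]; exact zero_le
      · rw [← exp_log hz, exp_lt_exp] at h
        rw [← exp_log hz, exp_le_exp]
        omega
    set n := Nat.find hU with hn
    have hns := Nat.find_spec hU
    rw [← hn] at hns
    have hn2 : n ≠ 0 := by
      intro h
      rw [h] at hns
      exact hXw (hns w (by simpa using hw.le))
    obtain ⟨m, hm'⟩ := Nat.exists_eq_succ_of_ne_zero hn2
    have hlt := Nat.find_min hU (m := m) (by omega)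
    push Not at hlt
    obtain ⟨z0, hz0, hXz0⟩ := hlt
    have hm0 : m ≠ 0 := by
      rintro rfl
      rw [hm'] at hns
      exact hXw (hns w (by simpa using vlt w 0 (by simpa using hw)))
    have hv0 : v z0 < 1 := hz0.trans_lt (by
      rw [← exp_zero, exp_lt_exp]; omega)
    refine T.caseA1 hm v z0 ?_ hv0 ?_ ?_ y hy
    · rintro rfl; exact hXz0 (by rw [sub_zero, T.X1])
    · exact (T.pm _ (one_sub_ne0 v hv0)).resolve_left hXz0
    · intro z t hz ht
      apply hns
      rw [hm', map_mul]
      have h1 := vlt t 0 (by simpa using ht)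
      calc v z * v t ≤ exp (-(m:ℤ)) * exp (-(0+1)) := mul_le_mul' (hz.trans hz0) h1
        _ = _ := by rw [← exp_add]; congr 1; push_cast; ring
end Tw


namespace Tw
variable {F : Type} [Field F] {A : Type} [AddCommGroup A] {X : F → ℤ} {f : F → A}

open WithZero in
theorem thmB (T : Tw X f) {v : Valuation F (WithZero (Multiplicative ℤ))} (C : A)
    (hC : ∀ x, x ≠ 0 → x ≠ 1 → f x + f (1 - x) = C)
    (hX : ∀ x, x ≠ 0 → (X x = 1 ↔ Even (log (v x)))) (π : F) (hπ : v π = exp (-1)) :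
    (∀ y, y ≠ 0 → v y < 1 → f y = C) ∧ (∀ z, v z < 1 → f (1 - z) = 0) ∧
    (∀ x y, v x = 1 → v (1 - x) = 1 → v y = 1 → v (x - y) < 1 → f x = f y) ∧
    (3 : ℤ) • C = 0 := by
  have hu : ∀ x, v x = 1 → X x = 1 := fun x hx => by
    rw [hX x (ne_of_v hx), hx]; simp
  have hm : X (-1) = 1 := hu _ (by simp)
  have hπ0 : π ≠ 0 := by
    rintro rfl; rw [map_zero] at hπ; exact absurd hπ.symm exp_ne_zero
  have hodd : ∀ x, x ≠ 0 → ¬ Even (log (v x)) → X x = -1 := fun x hx h =>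
    (T.pm x hx).resolve_left (fun h' => h ((hX x hx).mp h'))
  have hXπ : X π = -1 := hodd π hπ0 (by rw [hπ, log_exp]; decide)
  have hπ1 : v π < 1 := by rw [hπ, ← exp_zero, exp_lt_exp]; norm_num
  have o : ∀ y, y ≠ 0 → v y < 1 → ¬ Even (log (v y)) → f y = C := by
    intro y hy0 hy h
    rw [(T.valC hm C hC y hy0 (hodd y hy0 h)).1, hu _ (v_one_sub v hy), one_smul]
  have B1 : ∀ y, y ≠ 0 → v y < 1 → f y = C := by
    intro y hy0 hy
    by_cases he : Even (log (v y))
    swap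
    · exact o y hy0 hy he
    have vy0 : v y ≠ 0 := (Valuation.ne_zero_iff v).mpr hy0
    have hlog : log (v y) ≤ -2 := by
      have h := hy
      rw [← exp_log vy0, ← exp_zero, exp_lt_exp] at h
      obtain ⟨r, hr⟩ := he
      omega
    have h1y := one_sub_ne0 v hy
    have h1π := one_sub_ne0 v hπ1
    have hy1 : y ≠ 1 := by rintro rfl; simp at hy
    have hπ1' : π ≠ 1 := by rintro rfl; simp at hπ1
    have lq : log (v (y / π)) = log (v y) + 1 := by
      rw [map_div₀, hπ, log_div vy0 (by simp), log_exp]; ring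
    have q0 : y / π ≠ 0 := div_ne_zero hy0 hπ0
    have q1 : v (y / π) < 1 := by
      rw [← exp_log ((Valuation.ne_zero_iff v).mpr q0), lq, ← exp_zero, exp_lt_exp]; omega
    have qo : ¬ Even (log (v (y / π))) := by
      rw [lq]; obtain ⟨r, hr⟩ := he; rintro ⟨s, hs⟩; omega
    have c1 := o _ q0 q1 qo
    have ew : v ((1 - π) * y / (π * (1 - y))) = v (y / π) := by
      simp only [map_div₀, map_mul, v_one_sub v hπ1, v_one_sub v hy, one_mul, mul_one]
    have c2 := o ((1 - π) * y / (π * (1 - y)))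
      (div_ne_zero (mul_ne_zero h1π hy0) (mul_ne_zero hπ0 h1y)) (by rwa [ew]) (by rwa [ew])
    have hylt : v y < v π := by
      rw [← exp_log vy0, hπ, exp_lt_exp]; omega
    have vs : v (π - y) = v π := by
      rw [Valuation.map_sub_swap]; exact Valuation.map_sub_eq_of_lt_right v hylt
    have eu : 1 - (1 - π) / (1 - y) = (π - y) / (1 - y) := by field_simp; ring
    have vu : v (1 - (1 - π) / (1 - y)) = v π := by
      rw [eu, map_div₀, vs, v_one_sub v hy, div_one]
    have u0 : 1 - (1 - π) / (1 - y) ≠ 0 := by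
      rw [← Valuation.ne_zero_iff v, vu, hπ]; simp
    have c3 := o _ u0 (by rwa [vu]) (by rw [vu, hπ, log_exp]; decide)
    have c4 := hC ((1 - π) / (1 - y)) (div_ne_zero h1π h1y) (by
      intro h; rw [h, sub_self] at u0; exact u0 rfl)
    have c5 := o π hπ0 hπ1 (by rw [hπ, log_exp]; decide)
    have h := T.ft' hm π y hπ0 hπ1' hy0 hy1
    rw [hXπ, hu _ (v_one_sub v hπ1), c1, c2, c5] at h
    rw [c3] at c4
    linear_combination (norm := module) -h + c4
  have B2 : ∀ z, v z < 1 → f (1 - z) = 0 := by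
    intro z hz
    by_cases hz0 : z = 0
    · rw [hz0, sub_zero, T.one]
    · have := hC z hz0 (by rintro rfl; simp at hz)
      rw [B1 z hz0 hz] at this
      simpa using this
  refine ⟨B1, B2, ?_, (T.valC hm C hC π hπ0 hXπ).2⟩
  intro x y hx h1x hy hxy
  have h1y : v (1 - y) = 1 := by
    rw [show 1 - y = (1 - x) + (x - y) by ring,
      Valuation.map_add_eq_of_lt_left v (by rwa [h1x]), h1x]
  have x0 := ne_of_v hx
  have y0 := ne_of_v hy
  have x1 := ne_of_v h1x
  have y1 := ne_of_v h1y
  have h := T.ft' hm x y x0 (by rintro rfl; simp at x1) y0 (by rintro rfl; simp at y1)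
  have b1 : f (y / x) = 0 := by
    rw [show y / x = 1 - (x - y) / x by field_simp; ring]
    exact B2 _ (by rwa [map_div₀, hx, div_one])
  have b2 : f ((1 - x) * y / (x * (1 - y))) = 0 := by
    rw [show (1 - x) * y / (x * (1 - y)) = 1 - (x - y) / (x * (1 - y)) by field_simp; ring]
    exact B2 _ (by rwa [map_div₀, map_mul, hx, h1y, one_mul, div_one])
  have b3 : f ((1 - x) / (1 - y)) = 0 := by
    rw [show (1 - x) / (1 - y) = 1 - (x - y) / (1 - y) by field_simp; ring]
    exact B2 _ (by rwa [map_div₀, h1y, div_one])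
  rw [b1, b2, b3] at h
  simpa [sub_eq_zero] using h

end Tw

theorem addEquiv_of_heq {A B : Type} (i : AddCommGroup A) (j : AddCommGroup B) (h : A = B)
    (hij : HEq i j) : ∃ e : A ≃+ B, ∀ (a : A) (b : B), HEq a b → e a = b := by
  subst h
  obtain rfl := eq_of_heq hij
  exact ⟨AddEquiv.refl _, fun a b h => eq_of_heq h⟩

theorem mpr_heq' {A B : Type} (h : A = B) (b : B) : HEq (h.mpr b) b := by subst h; rfl

theorem app_heq' {W A B : Type} (h : (W → A) = (W → B)) (hAB : A = B) (g : W → B) (u : W) :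
    HEq ((h.mpr g) u) (g u) := by subst hAB; rfl

theorem dcase_pos {p : Prop} {A : Type} (d : Decidable p) (hp : p) (a : ¬p → A) (b : p → A) :
    (Decidable.casesOn (motive := fun _ => A) d a b) = b hp := by
  cases d with
  | isFalse h => exact absurd hp h
  | isTrue h => rfl

theorem dcase_neg {p : Prop} {A : Type} (d : Decidable p) (hp : ¬p) (a : ¬p → A) (b : p → A) :
    (Decidable.casesOn (motive := fun _ => A) d a b) = a hp := by
  cases d with
  | isFalse h => rfl
  | isTrue h => exact absurd h hp

section
variable (k : Type) [Field k]

theorem PBK2 (h : Nat.card k = 2) : ∃ e : PBK k ≃+ ZMod 3, ∀ u, e (pbK' k u) = 0 := by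
  have hT : PBK k = ZMod 3 := if_pos h
  obtain ⟨e, he⟩ := addEquiv_of_heq (A := PBK k) (B := ZMod 3) inferInstance inferInstance hT (by
    show HEq (instAddCommGroupPBK k) _
    unfold instAddCommGroupPBK
    refine (heq_of_eq (dcase_pos _ h _ _)).trans (mpr_heq' _ _))
  refine ⟨e, fun u => he _ _ ?_⟩
  unfold pbK'
  exact (heq_of_eq (congrFun (dif_pos h) u)).trans (app_heq' _ hT _ _)

theorem PBK3 (h : Nat.card k = 3) : ∃ _ : PBK k ≃+ ZMod 4, True := by
  have hT : PBK k = ZMod 4 := by unfold PBK; rw [if_neg (by omega), if_pos h]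
  have h2 : ¬ Nat.card k = 2 := by omega
  obtain ⟨e, he⟩ := addEquiv_of_heq (A := PBK k) (B := ZMod 4) inferInstance inferInstance hT (by
    show HEq (instAddCommGroupPBK k) _
    unfold instAddCommGroupPBK
    refine (heq_of_eq (dcase_neg _ h2 _ _)).trans ((mpr_heq' _ _).trans ?_)
    refine (heq_of_eq (dcase_pos _ h _ _)).trans (mpr_heq' _ _))
  exact ⟨e, trivial⟩

theorem PBK4 (h2 : ¬ Nat.card k = 2) (h3 : ¬ Nat.card k = 3) :
    ∃ e : PBK k ≃+ PBloch k, ∀ u, e (pbK' k u) = pb k u := by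
  have hT : PBK k = PBloch k := by unfold PBK; rw [if_neg h2, if_neg h3]
  obtain ⟨e, he⟩ := addEquiv_of_heq (A := PBK k) (B := PBloch k) inferInstance inferInstance hT (by
    show HEq (instAddCommGroupPBK k) _
    unfold instAddCommGroupPBK
    refine (heq_of_eq (dcase_neg _ h2 _ _)).trans ((mpr_heq' _ _).trans ?_)
    refine (heq_of_eq (dcase_neg _ h3 _ _)).trans (mpr_heq' _ _))
  refine ⟨e, fun u => he _ _ ?_⟩
  unfold pbK'
  refine (heq_of_eq (congrFun (dif_neg h2) u)).trans ?_
  refine (app_heq' _ (if_neg h2) _ _).trans ?_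
  refine (heq_of_eq (congrFun (dif_neg h3) u)).trans ?_
  exact app_heq' _ (if_neg h3) _ _
end


noncomputable section

/-- extension of a character to `F` -/
def Xof {F : Type} [Field F] (χ : SqCl F →* ℤˣ) (a : F) : ℤ :=
  if h : a ≠ 0 then ((χ (sqc F (U F a h)) : ℤˣ) : ℤ) else 0

def fof {F : Type} [Field F] {A : Type} [AddCommGroup A] (φ : RP' F → A) (a : F) : A :=
  if h : a ≠ 0 then φ (rp F (U F a h)) else 0

variable {F : Type} [Field F]

theorem Xof_unit (χ : SqCl F →* ℤˣ) (a : Fˣ) : Xof χ (a : F) = ((χ (sqc F a) : ℤˣ) : ℤ) := by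
  unfold Xof
  rw [dif_pos a.ne_zero]
  congr 3
  ext; rfl

theorem fof_unit {A : Type} [AddCommGroup A] (φ : RP' F → A) (a : Fˣ) :
    fof φ (a : F) = φ (rp F a) := by
  unfold fof
  rw [dif_pos a.ne_zero]
  congr 2
  ext; rfl

theorem mk_rel {w : FreeRP F} (h : w ∈ ({gen F 1} ∪ ftRels F ∪ minusRels F ∪ invRels F)) :
    (Submodule.Quotient.mk w : FreeRP F ⧸ Submodule.span (RF F)
    ({gen F 1} ∪ ftRels F ∪ minusRels F ∪ invRels F)) = 0 :=
  (Submodule.Quotient.mk_eq_zero _).mpr (Submodule.subset_span h)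

/-- the projection as a linear map -/
def prj (F : Type) [Field F] : FreeRP F →ₗ[RF F] RP' F :=
  Submodule.mkQ (Submodule.span (RF F) ({gen F 1} ∪ ftRels F ∪ minusRels F ∪ invRels F))

theorem prj_gen (x : Fˣ) : prj F (gen F x) = rp F x := rfl

theorem prj_rel {w : FreeRP F} (h : w ∈ ({gen F 1} ∪ ftRels F ∪ minusRels F ∪ invRels F)) :
    prj F w = 0 := mk_rel h

theorem rp_induction {p : RP' F → Prop} (h0 : p 0) (hadd : ∀ a b, p a → p b → p (a + b))
    (hsmul : ∀ (r : RF F) a, p a → p (r • a)) (hrp : ∀ x, p (rp F x)) (m : RP' F) : p m := by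
  obtain ⟨w, rfl⟩ : ∃ w, prj F w = m := Submodule.mkQ_surjective _ m
  induction w using Finsupp.induction_linear with
  | zero => simpa using h0
  | add a b ha hb => rw [map_add]; exact hadd _ _ ha hb
  | single x r =>
    have : (Finsupp.single x r : FreeRP F) = r • gen F x := by simp [gen]
    rw [this, map_smul, prj_gen]
    exact hsmul _ _ (hrp x)

theorem mkTw {A : Type} [AddCommGroup A] [Module (RF F) A] (χ : SqCl F →* ℤˣ)
    (φ : RP' F →ₗ[RF F] A)
    (hφ : ∀ (a : Fˣ) m, cls F a • φ m = ((χ (sqc F a) : ℤˣ) : ℤ) • φ m)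
    (tt : ∀ a : A, (2 : ℤ) • a = 0 → a = 0) : Tw (Xof χ) (fof φ) where
  mul x y := by
    by_cases hx : x = 0
    · simp [Xof, hx]
    by_cases hy : y = 0
    · simp [Xof, hy]
    lift x to Fˣ using IsUnit.mk0 x hx
    lift y to Fˣ using IsUnit.mk0 y hy
    rw [← Units.val_mul, Xof_unit, Xof_unit, Xof_unit, map_mul, map_mul, Units.val_mul]
  pm x hx := by
    lift x to Fˣ using IsUnit.mk0 x hx
    rw [Xof_unit]
    rcases Int.units_eq_one_or (χ (sqc F x)) with h | h <;> simp [h]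
  one := by
    rw [← Units.val_one, fof_unit, ← prj_gen, prj_rel (by simp), map_zero]
  ft x y hx hx1 hy hy1 := by
    lift x to Fˣ using IsUnit.mk0 x hx
    lift y to Fˣ using IsUnit.mk0 y hy
    have h := congrArg φ (prj_rel (w := FT F x y hx1 hy1) (by
      left; left; right; exact ⟨x, y, hx1, hy1, rfl⟩))
    simp only [FT, map_add, map_sub, map_smul, prj_gen, map_zero, hφ] at h
    rw [← fof_unit (⇑φ), ← fof_unit (⇑φ), ← fof_unit (⇑φ), ← fof_unit (⇑φ), ← fof_unit (⇑φ), ← Xof_unit, ← Xof_unit,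
      ← Xof_unit] at h
    simp only [U, Units.val_mk0, Units.val_mul, Units.val_inv_eq_inv_val] at h
    rw [div_eq_mul_inv (y : F) x]
    exact h
  neg x hx := by
    lift x to Fˣ using IsUnit.mk0 x hx
    have h := congrArg φ (prj_rel (w := cls F (-1) • gen F x - gen F x) (by
      left; right; exact ⟨x, rfl⟩))
    simp only [map_sub, map_smul, prj_gen, map_zero, hφ] at h
    rw [← fof_unit (⇑φ), ← Xof_unit] at h
    simpa [sub_eq_zero] using h
  inv x hx := by
    lift x to Fˣ using IsUnit.mk0 x hx
    have h := congrArg φ (prj_rel (w := gen F x⁻¹ + gen F x) (by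
      right; exact ⟨x, rfl⟩))
    simp only [map_add, prj_gen, map_zero] at h
    rw [← fof_unit (⇑φ), ← fof_unit (⇑φ)] at h
    rw [← Units.val_inv_eq_inv_val]
    exact eq_neg_of_add_eq_zero_left h
  tt := tt

/-! localization -/

/-- `M → M[1/2]` as a linear map -/
def toL (M : Type) [AddCommGroup M] [Module (RF F) M] : M →ₗ[RF F] Loc2 F M :=
  LocalizedModule.mkLinearMap (Submonoid.powers (2 : RF F)) M

theorem toL_apply {M : Type} [AddCommGroup M] [Module (RF F) M] (m : M) :
    toL M m = toLoc2 F m := rfl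

instance isl (M : Type) [AddCommGroup M] [Module (RF F) M] :
    IsLocalizedModule (Submonoid.powers (2 : RF F)) (toL M) :=
  inferInstanceAs (IsLocalizedModule (Submonoid.powers (2 : RF F))
    (LocalizedModule.mkLinearMap (Submonoid.powers (2 : RF F)) M))

theorem two_smulR {N : Type} [AddCommGroup N] [Module (RF F) N] (n : N) :
    (2 : RF F) • n = (2 : ℤ) • n := by
  rw [two_smul, two_smul]

section
variable {M : Type} [AddCommGroup M] [Module (RF F) M]

theorem loc_bij : Function.Bijective (fun n : Loc2 F M => (2 : ℤ) • n) := by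
  have h := IsLocalizedModule.map_units (S := Submonoid.powers (2 : RF F)) (toL M)
    ⟨2, Submonoid.mem_powers _⟩
  rw [Module.End.isUnit_iff] at h
  have e : (fun n : Loc2 F M => (2 : ℤ) • n) = (fun n : Loc2 F M => (2 : RF F) • n) :=
    funext fun n => (two_smulR n).symm
  rw [e]; exact h

theorem loc_tt (n : Loc2 F M) (h : (2 : ℤ) • n = 0) : n = 0 :=
  loc_bij.1 (by simpa using h)

theorem loc_pow (n : Loc2 F M) (j : ℕ) (h : (2 ^ j : ℤ) • n = 0) : n = 0 := by
  induction j with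
  | zero => simpa using h
  | succ j ih => exact ih (loc_tt _ (by rw [← mul_smul, ← pow_succ']; exact h))

theorem loc_half (n : Loc2 F M) (j : ℕ) : ∃ n' : Loc2 F M, (2 ^ j : ℤ) • n' = n := by
  induction j with
  | zero => exact ⟨n, by simp⟩
  | succ j ih =>
    obtain ⟨n', h⟩ := ih
    obtain ⟨n'', h'⟩ := loc_bij.2 n'
    exact ⟨n'', by rw [pow_succ, mul_smul]; rw [← h]; exact congrArg _ h'⟩

theorem loc_surj (n : Loc2 F M) : ∃ (j : ℕ) (m : M), (2 ^ j : ℤ) • n = toL M m := by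
  obtain ⟨⟨m, s, hs⟩, h⟩ := IsLocalizedModule.surj (S := Submonoid.powers (2 : RF F)) (toL M) n
  obtain ⟨j, rfl⟩ := hs
  refine ⟨j, m, ?_⟩
  have h' : (2 : RF F) ^ j • n = toL M m := h
  rw [← h', ← Int.cast_smul_eq_zsmul (RF F)]
  push_cast
  rfl

end

theorem sqc_surj (g : SqCl F) : ∃ a, sqc F a = g := QuotientGroup.mk'_surjective _ g

theorem sqc_sq (a : Fˣ) : sqc F a * sqc F a = 1 := by
  rw [← map_mul]
  exact (QuotientGroup.eq_one_iff _).mpr ⟨a, pow_two a⟩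

/-- induction over the group ring acting on a module -/
theorem act_mem {N : Type} [AddCommGroup N] [Module (RF F) N] (S : AddSubgroup N)
    (h : ∀ (a : Fˣ) m, m ∈ S → cls F a • m ∈ S) (r : RF F) (m : N) (hm : m ∈ S) : r • m ∈ S := by
  induction r using MonoidAlgebra.induction_on with
  | of g =>
    obtain ⟨a, rfl⟩ := sqc_surj g
    exact h a m hm
  | add a b ha hb => rw [add_smul]; exact S.add_mem ha hb
  | smul n r hr => rw [smul_assoc]; exact S.zsmul_mem hr n

/-- `S` an additive subgroup of `RP'[1/2]` closed under square classes and halving and containing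
all generators is everything -/
theorem loc_top (S : AddSubgroup (Loc2 F (RP' F)))
    (h : ∀ (a : Fˣ) m, m ∈ S → cls F a • m ∈ S)
    (h2 : ∀ m, (2 : ℤ) • m ∈ S → m ∈ S)
    (hg : ∀ x, toL (RP' F) (rp F x) ∈ S) (n : Loc2 F (RP' F)) : n ∈ S := by
  have h2' : ∀ (j : ℕ) m, (2 ^ j : ℤ) • m ∈ S → m ∈ S := by
    intro j
    induction j with
    | zero => intro m hm; simpa using hm
    | succ j ih => intro m hm; exact ih _ (h2 _ (by rw [← mul_smul, ← pow_succ']; exact hm))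
  obtain ⟨j, m, hm⟩ := loc_surj n
  apply h2' j
  rw [hm]
  refine rp_induction (p := fun m => toL (RP' F) m ∈ S) ?_ ?_ ?_ hg m
  · rw [map_zero]; exact S.zero_mem
  · intro a b ha hb; rw [map_add]; exact S.add_mem ha hb
  · intro r a ha; rw [map_smul]; exact act_mem S h r _ ha

/-- local-global principle for characters -/
theorem char_principle {N : Type} [AddCommGroup N] [Module (RF F) N]
    (htt : ∀ n : N, (2 : ℤ) • n = 0 → n = 0) (n : N) (hn : n ≠ 0) :
    ∃ (A : Type) (_ : AddCommGroup A) (_ : Module (RF F) A) (φ : N →ₗ[RF F] A)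
      (χ : SqCl F →* ℤˣ), φ n ≠ 0 ∧ (∀ a : A, (2 : ℤ) • a = 0 → a = 0) ∧
      ∀ (a : Fˣ) (b : A), cls F a • b = ((χ (sqc F a) : ℤˣ) : ℤ) • b := by
  set I : Ideal (RF F) := LinearMap.ker (LinearMap.toSpanSingleton (RF F) N n) with hI
  have memI : ∀ r, r ∈ I ↔ r • n = 0 := fun r => by simp [hI]
  have hdis : Disjoint (I : Set (RF F)) (Submonoid.powers (2 : RF F)) := by
    rw [Set.disjoint_left]
    rintro _ hr ⟨j, rfl⟩
    have h : (2 : RF F) ^ j • n = 0 := (memI _).mp hr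
    clear hr
    induction j with
    | zero => exact hn (by simpa using h)
    | succ j ih =>
      apply ih
      apply htt
      rw [← two_smulR (F := F), ← mul_smul, ← pow_succ']; exact h
  obtain ⟨P, hP, hIP, hPd⟩ := Ideal.exists_le_prime_disjoint I _ hdis
  have h2P : (2 : RF F) ∉ P := fun h => Set.disjoint_left.mp hPd h (Submonoid.mem_powers _)
  have gsq : ∀ g : SqCl F, g * g = 1 := by
    intro g
    obtain ⟨a, rfl⟩ := sqc_surj g
    exact sqc_sq a
  set o : SqCl F → RF F := fun g => MonoidAlgebra.of ℤ (SqCl F) g with ho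
  have omul : ∀ g h, o (g * h) = o g * o h := fun g h => map_mul _ _ _
  have oo : ∀ g, o g * o g = 1 := fun g => by rw [← omul, gsq]; exact map_one _
  have dich : ∀ g, (o g - 1 ∈ P ∧ o g + 1 ∉ P) ∨ (o g - 1 ∉ P ∧ o g + 1 ∈ P) := by
    intro g
    have hz : (o g - 1) * (o g + 1) ∈ P := by
      have : (o g - 1) * (o g + 1) = 0 := by linear_combination oo g
      rw [this]; exact P.zero_mem
    have hnb : ¬ (o g - 1 ∈ P ∧ o g + 1 ∈ P) := by
      rintro ⟨h1, h2⟩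
      apply h2P
      have := P.sub_mem h2 h1
      have e : o g + 1 - (o g - 1) = 2 := by ring
      rwa [e] at this
    rcases hP.mem_or_mem hz with h | h <;> tauto
  have omP : ∀ g, o g ∉ P := by
    intro g h
    apply hP.ne_top
    rw [Ideal.eq_top_iff_one, ← oo g]
    exact P.mul_mem_left _ h
  let χ : SqCl F →* ℤˣ :=
    { toFun := fun g => if o g - 1 ∈ P then 1 else -1
      map_one' := by
        have : o 1 - 1 = 0 := by rw [sub_eq_zero]; exact map_one _
        rw [if_pos (by rw [this]; exact P.zero_mem)]
      map_mul' := by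
        intro g h
        have e : o (g * h) - 1 = (o g - 1) * o h + (o h - 1) := by rw [omul]; ring
        have e' : o (g * h) - 1 = (o g + 1) * o h - (o h + 1) := by rw [omul]; ring
        rcases dich g with ⟨g1, g2⟩ | ⟨g1, g2⟩ <;> rcases dich h with ⟨h1, h2⟩ | ⟨h1, h2⟩
        · rw [if_pos g1, if_pos h1, if_pos, one_mul]
          rw [e]; exact P.add_mem (P.mul_mem_right _ g1) h1
        · rw [if_pos g1, if_neg h1, if_neg, one_mul]
          rw [e]; intro hh; exact h1 ((P.add_mem_iff_right (P.mul_mem_right _ g1)).mp hh)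
        · rw [if_neg g1, if_pos h1, if_neg, mul_one]
          rw [e']; intro hh; exact h2 ((P.sub_mem_iff_right (P.mul_mem_right _ g2)).mp hh)
        · rw [if_neg g1, if_neg h1, if_pos, neg_one_mul, neg_neg]
          rw [e']; exact P.sub_mem (P.mul_mem_right _ g2) h2 }
  have inj : ∀ (s : RF F), s ∉ P → ∀ b : LocalizedModule P.primeCompl N, s • b = 0 → b = 0 := by
    intro s hs b hb
    have h := IsLocalizedModule.map_units (S := P.primeCompl)
      (LocalizedModule.mkLinearMap P.primeCompl N) ⟨s, hs⟩
    rw [Module.End.isUnit_iff] at h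
    exact h.1 (by simpa using hb)
  refine ⟨LocalizedModule P.primeCompl N, inferInstance, inferInstance,
    LocalizedModule.mkLinearMap P.primeCompl N, χ, ?_, ?_, ?_⟩
  · intro h
    rw [IsLocalizedModule.eq_zero_iff P.primeCompl] at h
    obtain ⟨⟨c, hc⟩, h⟩ := h
    exact hc (hIP ((memI c).mpr h))
  · intro a ha
    exact inj 2 h2P a (by rw [two_smulR]; exact ha)
  · intro a b
    have hcl : cls F a = o (sqc F a) := rfl
    rw [hcl]
    set g := sqc F a
    have hz : (o g - 1) * (o g + 1) = 0 := by linear_combination oo g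
    by_cases h1 : o g - 1 ∈ P
    · have hχ : χ g = 1 := if_pos h1
      have h2 : o g + 1 ∉ P := by rcases dich g with h | h; exacts [h.2, absurd h1 h.1]
      have := inj _ h2 ((o g - 1) • b) (by rw [← mul_smul, mul_comm, hz, zero_smul])
      rw [hχ, Units.val_one, one_smul]
      rwa [sub_smul, one_smul, sub_eq_zero] at this
    · have hχ : χ g = -1 := if_neg h1
      have := inj _ h1 ((o g + 1) • b) (by rw [← mul_smul, hz, zero_smul])
      rw [hχ]
      rw [add_smul, one_smul] at this
      simpa using eq_neg_of_add_eq_zero_left this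
end


noncomputable section

variable {F : Type} [Field F]

/-- residue map extended by zero -/
def rho {Γ : Type} [LinearOrderedCommGroupWithZero Γ] (v : Valuation F Γ) (x : F) : Resk F v :=
  if h : v x ≤ 1 then IsLocalRing.residue v.valuationSubring ⟨x, h⟩ else 0

theorem rho_of {Γ : Type} [LinearOrderedCommGroupWithZero Γ] (v : Valuation F Γ) (x : F)
    (h : v x ≤ 1) : rho v x = IsLocalRing.residue v.valuationSubring ⟨x, h⟩ := dif_pos h

theorem rho_res {Γ : Type} [LinearOrderedCommGroupWithZero Γ] (v : Valuation F Γ) :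
    Tw.Res v (rho v) where
  sur a := by
    obtain ⟨⟨x, hx⟩, h⟩ := IsLocalRing.residue_surjective (R := v.valuationSubring) a
    exact ⟨x, hx, by rw [rho_of v x hx]; exact h⟩
  mul x y hx hy := by
    have hxy : v (x * y) ≤ 1 := by rw [map_mul]; exact mul_le_one' hx hy
    rw [rho_of v x hx, rho_of v y hy, rho_of v _ hxy]
    exact map_mul (IsLocalRing.residue v.valuationSubring) ⟨x, hx⟩ ⟨y, hy⟩
  sub x y hx hy := by
    have hxy : v (x - y) ≤ 1 := (v.map_sub x y).trans (max_le hx hy)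
    rw [rho_of v x hx, rho_of v y hy, rho_of v _ hxy]
    exact map_sub (IsLocalRing.residue v.valuationSubring) ⟨x, hx⟩ ⟨y, hy⟩
  one := by
    rw [rho_of v 1 (by simp)]
    exact map_one (IsLocalRing.residue v.valuationSubring)
  ker x hx := by
    rw [rho_of v x hx]
    have h1 := IsLocalRing.residue_eq_zero_iff (R := v.valuationSubring) ⟨x, hx⟩
    refine h1.trans ?_
    exact Valuation.mem_maximalIdeal_iff _ _

theorem resUnit_val {Γ : Type} [LinearOrderedCommGroupWithZero Γ] (v : Valuation F Γ) (x : Fˣ)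
    (hx : v (x : F) = 1) : ((resUnit F v x hx : (Resk F v)ˣ) : Resk F v) = rho v (x : F) := by
  rw [rho_of v _ hx.le]; rfl

variable (v : Valuation F (WithZero (Multiplicative ℤ)))

theorem vzk_log (x : Fˣ) : vzk F v x = - WithZero.log (v (x : F)) := by
  unfold vzk
  have h := (Valuation.ne_zero_iff v).mpr (Units.ne_zero x)
  congr 1
  conv_rhs => rw [← WithZero.coe_unzero h]
  rfl

theorem chiVal_sqc (x : Fˣ) : chiVal F v (sqc F x) = (-1 : ℤˣ) ^ (vzk F v x) := rfl

theorem Xof_chiVal (x : F) (hx : x ≠ 0) :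
    Xof (chiVal F v) x = 1 ↔ Even (WithZero.log (v x)) := by
  lift x to Fˣ using IsUnit.mk0 x hx
  rw [Xof_unit, chiVal_sqc, vzk_log]
  rcases Int.even_or_odd (WithZero.log (v (x : F))) with h | h
  · rw [Even.neg_one_zpow h.neg]; simp [h]
  · rw [Odd.neg_one_zpow h.neg]; simp [h]

theorem hU_conv (hU : ∃ n : ℕ, 0 < n ∧ ∀ u ∈ UnV F v n, ∃ w ∈ UnV F v 1, u = w * w)
    (χ : SqCl F →* ℤˣ) :
    ∃ n : ℕ, ∀ z, v z ≤ WithZero.exp (-(n : ℤ)) → Xof χ (1 - z) = 1 := by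
  obtain ⟨n, hn, h⟩ := hU
  refine ⟨n, fun z hz => ?_⟩
  have hz1 : v z < 1 := lt_of_le_of_lt hz (by
    rw [← WithZero.exp_zero, WithZero.exp_lt_exp]; omega)
  have h0 := Tw.one_sub_ne0 v hz1
  obtain ⟨w, -, hw⟩ := h (U F (1 - z) h0) (by
    intro h1
    rw [vzk_log]
    have e : ((U F (((U F (1 - z) h0 : Fˣ) : F) - 1) h1 : Fˣ) : F) = -z := by simp [U]
    rw [e, Valuation.map_neg]
    have hz0 : v z ≠ 0 := by
      rw [Valuation.ne_zero_iff]; rintro rfl; apply h1; simp [U]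
    have := (WithZero.log_le_iff_le_exp hz0).mpr hz
    omega)
  have : Xof χ (1 - z) = Xof χ ((U F (1 - z) h0 : Fˣ) : F) := rfl
  rw [this, Xof_unit, hw, map_mul, sqc_sq, map_one, Units.val_one]

theorem units_act (hk : Finite (Resk F v) ∨ (∀ a : Resk F v, IsSquare a) ∨
      IsRealClosedField (Resk F v))
    (hU : ∃ n : ℕ, 0 < n ∧ ∀ u ∈ UnV F v n, ∃ w ∈ UnV F v 1, u = w * w)
    (u : Fˣ) (hu : v (u : F) = 1) (m : Loc2 F (RP' F)) : cls F u • m = m := by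
  by_contra hne
  obtain ⟨A, _, _, φ, χ, hφ, htt, hχ⟩ := char_principle (F := F) loc_tt (cls F u • m - m)
    (sub_ne_zero.mpr hne)
  have T := mkTw χ (φ.comp (toL (RP' F))) (fun a m => hχ a _) htt
  have hXu : Xof χ (u : F) = -1 := by
    refine (T.pm _ u.ne_zero).resolve_left fun h => hφ ?_
    rw [Xof_unit] at h
    rw [map_sub, map_smul, hχ, h, one_smul, sub_self]
  have hz := fun y hy => T.thmA (rho_res v) (hk.imp id (Or.imp id fun h => h.1)) (hU_conv v hU χ)
    (u : F) hu hXu y hy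
  apply hφ
  refine loc_top φ.toAddMonoidHom.ker ?_ ?_ ?_ _
  · intro a m hm
    rw [AddMonoidHom.mem_ker] at hm ⊢
    show φ (cls F a • m) = 0
    rw [map_smul, show φ m = 0 from hm, smul_zero]
  · intro m hm
    rw [AddMonoidHom.mem_ker] at hm ⊢
    rw [map_zsmul] at hm
    exact htt _ hm
  · intro x
    rw [AddMonoidHom.mem_ker]
    have := hz x x.ne_zero
    rw [fof_unit] at this
    exact this

/-- all the structure needed for part one -/
structure ActData (π : Fˣ) : Prop where
  even : ∀ a : Fˣ, chiVal F v (sqc F a) = 1 → ∀ m : Loc2 F (RP' F), cls F a • m = m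
  odd : ∀ a : Fˣ, chiVal F v (sqc F a) = -1 → ∀ m : Loc2 F (RP' F), cls F a • m = cls F π • m
  pi : chiVal F v (sqc F π) = -1
  val : v (π : F) = WithZero.exp (-1)

theorem cls_mul (a b : Fˣ) : cls F (a * b) = cls F a * cls F b := by
  unfold cls; rw [map_mul, map_mul]

theorem cls_sq (a : Fˣ) : cls F a * cls F a = 1 := by
  rw [← cls_mul]; unfold cls; rw [map_mul, sqc_sq, map_one]

theorem actData (hsurj : Function.Surjective v)
    (hk : Finite (Resk F v) ∨ (∀ a : Resk F v, IsSquare a) ∨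
      IsRealClosedField (Resk F v))
    (hU : ∃ n : ℕ, 0 < n ∧ ∀ u ∈ UnV F v n, ∃ w ∈ UnV F v 1, u = w * w) :
    ∃ π : Fˣ, ActData v π := by
  obtain ⟨p, hp⟩ := hsurj (WithZero.exp (-1))
  have hp0 : p ≠ 0 := by
    rintro rfl; rw [map_zero] at hp; exact absurd hp.symm WithZero.exp_ne_zero
  lift p to Fˣ using IsUnit.mk0 p hp0
  have hpi : chiVal F v (sqc F p) = -1 := by
    rw [chiVal_sqc, vzk_log, hp, WithZero.log_exp]; rfl
  have hev : ∀ a : Fˣ, chiVal F v (sqc F a) = 1 → ∀ m : Loc2 F (RP' F), cls F a • m = m := by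
    intro a ha m
    have he : Even (WithZero.log (v (a : F))) := by
      rw [← Xof_chiVal v _ a.ne_zero, Xof_unit, ha]; rfl
    obtain ⟨j, hj⟩ := he
    have h1 : v ((a * (p ^ j * p ^ j) : Fˣ) : F) = 1 := by
      have hva := (Valuation.ne_zero_iff v).mpr a.ne_zero
      have e : v ((p ^ j : Fˣ) : F) = WithZero.exp (-j) := by
        rw [Units.val_zpow_eq_zpow_val, map_zpow₀, hp, ← WithZero.exp_zsmul]; simp
      rw [Units.val_mul, Units.val_mul, map_mul, map_mul, e, ← WithZero.exp_log hva, hj,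
        ← WithZero.exp_add, ← WithZero.exp_add, ← WithZero.exp_zero]
      congr 1; ring
    have := units_act v hk hU _ h1 m
    rwa [cls_mul, cls_mul, cls_sq, mul_one] at this
  refine ⟨p, hev, ?_, hpi, hp⟩
  intro a ha m
  have := hev (a * p) (by rw [map_mul, map_mul, ha, hpi]; rfl) (cls F p • m)
  rwa [← mul_smul, cls_mul, mul_assoc, cls_sq, mul_one] at this

variable {v}

theorem aug1 (g : SqCl F) : augRF F (MonoidAlgebra.of ℤ (SqCl F) g) = 1 := by
  unfold augRF
  exact MonoidAlgebra.lift_of _ _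

theorem ActData.act {π : Fˣ} (D : ActData v π) (r : RF F) :
    ∃ α β : ℤ, α + β = augRF F r ∧ ∀ n : Loc2 F (RP' F), r • n = α • n + β • cls F π • n := by
  induction r using MonoidAlgebra.induction_on with
  | of g =>
    obtain ⟨a, rfl⟩ := sqc_surj g
    rcases Int.units_eq_one_or (chiVal F v (sqc F a)) with h | h
    · refine ⟨1, 0, by rw [aug1]; rfl, fun n => ?_⟩
      rw [one_smul, zero_smul, add_zero]; exact D.even a h n
    · refine ⟨0, 1, by rw [aug1]; rfl, fun n => ?_⟩
      rw [one_smul, zero_smul, zero_add]; exact D.odd a h n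
  | add a b ha hb =>
    obtain ⟨α, β, h1, h2⟩ := ha
    obtain ⟨α', β', h1', h2'⟩ := hb
    refine ⟨α + α', β + β', by rw [map_add]; omega, fun n => ?_⟩
    rw [add_smul, h2, h2']; module
  | smul c r hr =>
    obtain ⟨α, β, h1, h2⟩ := hr
    refine ⟨c * α, c * β, by rw [map_zsmul, ← h1, smul_eq_mul]; ring, fun n => ?_⟩
    rw [smul_assoc, h2]; module

theorem ActData.pp {π : Fˣ} (n : Loc2 F (RP' F)) : cls F π • cls F π • n = n := by
  rw [← mul_smul, cls_sq, one_smul]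

theorem ActData.onI {π : Fˣ} (D : ActData v π) (m : Loc2 F (RP' F))
    (hm : m ∈ augIdeal F • (⊤ : Submodule (RF F) (Loc2 F (RP' F)))) : cls F π • m = -m := by
  refine Submodule.smul_induction_on hm ?_ ?_
  · intro r hr n _
    obtain ⟨α, β, h1, h2⟩ := D.act r
    have h0 : augRF F r = 0 := hr
    have hb : β = -α := by omega
    rw [h2, hb, smul_add, smul_comm, smul_comm (cls F π) (-α), ActData.pp]
    module
  · intro x y hx hy
    rw [smul_add, hx, hy, neg_add]

theorem ActData.onChi {π : Fˣ} (D : ActData v π) (m : Loc2 F (RP' F))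
    (hm : m ∈ chiSub F (chiVal F v) (Loc2 F (RP' F))) : cls F π • m = m := by
  refine Submodule.span_induction ?_ ?_ ?_ ?_ hm
  · rintro _ ⟨a, n, rfl⟩
    rcases Int.units_eq_one_or (chiVal F v (sqc F a)) with h | h
    · rw [h, D.even a h]; simp
    · rw [h, D.odd a h, smul_sub, ActData.pp]
      simp [smul_neg, add_comm]
  · simp
  · intro x y _ _ hx hy; rw [smul_add, hx, hy]
  · intro r x _ hx; rw [smul_comm, hx]

theorem ActData.surj {π : Fˣ} (D : ActData v π) (n : Loc2 F (RP' F)) :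
    ∃ m ∈ augIdeal F • (⊤ : Submodule (RF F) (Loc2 F (RP' F))),
      m - n ∈ chiSub F (chiVal F v) (Loc2 F (RP' F)) := by
  obtain ⟨n', hn⟩ := loc_bij.2 n
  have hn : (2 : ℤ) • n' = n := hn
  refine ⟨(1 - cls F π) • n', ?_, ?_⟩
  · refine Submodule.smul_mem_smul ?_ trivial
    show augRF F (1 - cls F π) = 0
    rw [map_sub, map_one, show augRF F (cls F π) = 1 from aug1 _, sub_self]
  · have : (1 - cls F π) • n' - n = (-1 : RF F) •
        (cls F π • n' - ((chiVal F v (sqc F π) : ℤˣ) : ℤ) • n') := by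
      rw [D.pi, ← hn, sub_smul, one_smul, neg_smul, one_smul, Units.val_neg, Units.val_one]
      module
    rw [this]
    exact Submodule.smul_mem _ _ (Submodule.subset_span ⟨π, n', rfl⟩)

theorem ActData.inj {π : Fˣ} (D : ActData v π) (m : Loc2 F (RP' F))
    (hm : m ∈ augIdeal F • (⊤ : Submodule (RF F) (Loc2 F (RP' F))))
    (hm' : m ∈ chiSub F (chiVal F v) (Loc2 F (RP' F))) : m = 0 := by
  have h1 := D.onI m hm
  rw [D.onChi m hm'] at h1
  apply loc_tt
  rw [two_smul]
  nth_rewrite 1 [h1]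
  simp

theorem ActData.part1 {π : Fˣ} (D : ActData v π) : Function.Bijective
      ((chiSub F (chiVal F v) (Loc2 F (RP' F))).mkQ.comp
        (augIdeal F • (⊤ : Submodule (RF F) (Loc2 F (RP' F)))).subtype) := by
  constructor
  · rw [injective_iff_map_eq_zero]
    rintro ⟨m, hm⟩ h
    have h' : m ∈ chiSub F (chiVal F v) (Loc2 F (RP' F)) :=
      (Submodule.Quotient.mk_eq_zero _).mp h
    exact Subtype.ext (D.inj m hm h')
  · intro q
    obtain ⟨n, rfl⟩ := Submodule.mkQ_surjective _ q
    obtain ⟨m, hm, h⟩ := D.surj n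
    exact ⟨⟨m, hm⟩, (Submodule.Quotient.eq _).mpr h⟩

end


noncomputable section

variable {F : Type} [Field F] {v : Valuation F (WithZero (Multiplicative ℤ))}

theorem resUnit_eq (x : Fˣ) (hx : v (x : F) = 1) (u : (Resk F v)ˣ) (h : rho v (x : F) = u) :
    resUnit F v x hx = u := by
  ext; rw [resUnit_val, h]

theorem res_lift (u : (Resk F v)ˣ) : ∃ (x : Fˣ) (hx : v (x : F) = 1), resUnit F v x hx = u := by
  obtain ⟨x, hx, h⟩ := (rho_res v).lift u.ne_zero
  have hx0 : x ≠ 0 := Tw.ne_of_v hx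
  lift x to Fˣ using IsUnit.mk0 x hx0
  exact ⟨x, hx, resUnit_eq x hx u h⟩

theorem exists_third {k : Type} [Field k] (h2 : ¬ Nat.card k = 2) : ∃ u : k, u ≠ 0 ∧ u ≠ 1 := by
  by_contra h
  push Not at h
  apply h2
  rw [Nat.card_eq_two_iff]
  refine ⟨0, 1, zero_ne_one, ?_⟩
  ext x
  by_cases hx : x = 0
  · simp [hx]
  · simp [h x hx]

theorem pow_card' {k : Type} [Field k] (n : ℕ) (hn : Nat.card k = n) (h0 : n ≠ 0) (a : k)
    (ha : a ≠ 0) : a ^ (n - 1) = 1 := by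
  have : Finite k := Nat.finite_of_card_ne_zero (by omega)
  have := Fintype.ofFinite k
  rw [← hn, Nat.card_eq_fintype_card]
  exact FiniteField.pow_card_sub_one_eq_one a ha

theorem zmod3 {A : Type} [AddCommGroup A] (C : A) (hC : (3 : ℤ) • C = 0) (c : ZMod 3)
    (hc : c ≠ 0) : ∃ t : ZMod 3 →+ A, t c = C := by
  have key : ∀ D : A, (3 : ℤ) • D = 0 → ∃ t : ZMod 3 →+ A, t 1 = D := by
    intro D hD
    refine ⟨ZMod.lift 3 ⟨zmultiplesHom A D, by simpa using hD⟩, ?_⟩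
    have := ZMod.lift_coe 3 ⟨zmultiplesHom A D, by simpa using hD⟩ 1
    simpa using this
  have : c = 1 ∨ c = 1 + 1 := by
    revert c; decide
  rcases this with rfl | rfl
  · exact key C hC
  · obtain ⟨t, ht⟩ := key ((2 : ℤ) • C) (by rw [smul_comm, hC, smul_zero])
    refine ⟨t, ?_⟩
    rw [map_add, ht]
    have : (2 : ℤ) • C + (2 : ℤ) • C = (3 : ℤ) • C + C := by module
    rw [this, hC, zero_add]

theorem t0_exists {A : Type} [AddCommGroup A] {X : F → ℤ} {f : F → A} (T : Tw X f) (C : A)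
    (hC : ∀ x, x ≠ 0 → x ≠ 1 → f x + f (1 - x) = C)
    (hX : ∀ x, x ≠ 0 → (X x = 1 ↔ Even (WithZero.log (v x)))) (π : F)
    (hπ : v π = WithZero.exp (-1))
    (cpk : PBK (Resk F v))
    (hcpk : ∀ (u : (Resk F v)ˣ) (hu : (u : Resk F v) ≠ 1),
      cpk = pbK' _ u + pbK' _ (U (Resk F v) (1 - (u : Resk F v)) (one_sub_ne hu)))
    (hcpk2 : Nat.card (Resk F v) = 2 → cpk ≠ 0) :
    ∃ t0 : PBK (Resk F v) →+ A,
      (∀ (x : Fˣ) (hx : v (x : F) = 1), t0 (pbK' _ (resUnit F v x hx)) = f x) ∧ t0 cpk = C := by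
  obtain ⟨B1, B2, B3, B4⟩ := T.thmB C hC hX π hπ
  have R := rho_res v
  have hX1 : ∀ x, v x = 1 → X x = 1 := fun x hx => by
    rw [hX x (Tw.ne_of_v hx), hx]; simp
  have fw : ∀ x y, v x = 1 → v y = 1 → rho v x = rho v y → f x = f y := by
    intro x y hx hy hxy
    have hlt : v (x - y) < 1 := by
      rw [← R.ker _ ((v.map_sub x y).trans (max_le hx.le hy.le)), R.sub _ _ hx.le hy.le, hxy,
        sub_self]
    have h1 : ∀ x, v x = 1 → v (1 - x) ≤ 1 := fun x hx => by
      have := v.map_sub 1 x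
      rwa [map_one, hx, max_self] at this
    rcases (h1 x hx).lt_or_eq with h | h
    · have h' : v (1 - y) < 1 := by
        rw [← R.ker _ (h1 y hy), R.sub _ _ (by simp) hy.le, ← hxy, ← R.sub _ _ (by simp) hx.le,
          R.ker _ (h1 x hx)]
        exact h
      have e1 := B2 _ h
      have e2 := B2 _ h'
      rw [sub_sub_cancel] at e1 e2
      rw [e1, e2]
    · exact B3 x y hx h hy hlt
  have third : ¬ Nat.card (Resk F v) = 2 → ∃ x : Fˣ, v (x : F) = 1 ∧ v (1 - (x : F)) = 1 ∧
      (x : F) ≠ 1 ∧ rho v (x : F) ≠ 1 := by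
    intro h2
    obtain ⟨u, hu0, hu1⟩ := exists_third h2
    obtain ⟨x, hx, rfl⟩ := R.lift hu0
    have hx0 : x ≠ 0 := Tw.ne_of_v hx
    lift x to Fˣ using IsUnit.mk0 x hx0
    refine ⟨x, hx, ?_, ?_, hu1⟩
    · have hle : v (1 - (x : F)) ≤ 1 := by
        have := v.map_sub 1 (x : F)
        rwa [map_one, hx, max_self] at this
      refine le_antisymm hle (not_lt.mp fun h => ?_)
      rw [← R.ker _ hle, R.sub _ _ (by simp) hx.le, R.one, sub_eq_zero] at h
      exact hu1 h.symm
    · intro h; rw [h, R.one] at hu1; exact hu1 rfl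
  by_cases h2 : Nat.card (Resk F v) = 2
  · obtain ⟨e, he⟩ := PBK2 _ h2
    have hc : e cpk ≠ 0 := fun h => hcpk2 h2 (by simpa using h)
    obtain ⟨t, ht⟩ := zmod3 C B4 _ hc
    refine ⟨t.comp e.toAddMonoidHom, ?_, ht⟩
    intro x hx
    have e1 : rho v (x : F) = rho v 1 := by
      rw [R.one]
      simpa using pow_card' 2 h2 (by norm_num) _ (R.unit hx)
    rw [fw _ _ hx (by simp) e1, T.one]
    exact (congrArg t (he _)).trans (map_zero t)
  by_cases h3 : Nat.card (Resk F v) = 3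
  · have hm1 : f (-1) = 0 := by
      apply T.tt
      have := T.inv (-1) (by simp)
      rw [inv_neg, inv_one] at this
      rw [two_smul]
      nth_rewrite 1 [this]
      simp
    have hf : ∀ x, v x = 1 → f x = 0 := by
      intro x hx
      have hp := pow_card' 3 h3 (by norm_num) _ (R.unit hx)
      have hp : rho v x ^ 2 = 1 := hp
      rcases (sq_eq_sq_iff_eq_or_eq_neg.mp (hp.trans (one_pow 2).symm)) with h | h
      · rw [fw x 1 hx (by simp) (by rw [h, R.one]), T.one]
      · rw [fw x (-1) hx (by simp) ?_, hm1]
        have h0 := R.sub 0 1 (by simp) (by simp)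
        have h00 := R.sub 0 0 (by simp) (by simp)
        rw [sub_self, sub_self] at h00
        rw [zero_sub, R.one, h00, zero_sub] at h0
        rw [h, h0]
    refine ⟨0, fun x hx => (hf x hx).symm, ?_⟩
    obtain ⟨x, hx, hx1, hne, -⟩ := third h2
    rw [← hC x x.ne_zero hne, hf _ hx, hf _ hx1]
    simp
  · obtain ⟨e, he⟩ := PBK4 _ h2 h3
    let g : (Resk F v)ˣ → A := fun u => f (res_lift u).choose
    have hg : ∀ (u : (Resk F v)ˣ) a, v a = 1 → rho v a = u → g u = f a := by
      intro u a ha h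
      obtain ⟨h1, h2⟩ := (res_lift u).choose_spec
      refine fw _ _ h1 ha ?_
      have h5 := resUnit_val v _ h1
      rw [h2] at h5
      rw [h, h5]
    have rdiv : ∀ a b, v a = 1 → v b = 1 → rho v (a / b) = rho v a / rho v b := by
      intro a b ha hb
      rw [eq_div_iff (R.unit hb), ← R.mul _ _ (by rw [map_div₀, ha, hb, div_one]) hb.le,
        div_mul_cancel₀ _ (Tw.ne_of_v hb)]
    have vdiv : ∀ a b, v a = 1 → v b = 1 → v (a / b) = 1 := by
      intro a b ha hb
      rw [map_div₀, ha, hb, div_one]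
    have key : Submodule.span ℤ
        ({Finsupp.single (1 : (Resk F v)ˣ) (1 : ℤ)} ∪
          {w | ∃ (x y : (Resk F v)ˣ) (hx : (x : Resk F v) ≠ 1) (hy : (y : Resk F v) ≠ 1),
            w = FTZ _ x y hx hy}) ≤ LinearMap.ker (Finsupp.linearCombination ℤ g) := by
      rw [Submodule.span_le]
      rintro w (hw | ⟨x, y, hx, hy, rfl⟩)
      · rw [Set.mem_singleton_iff] at hw
        subst hw
        show Finsupp.linearCombination ℤ g _ = 0
        rw [Finsupp.linearCombination_single, one_smul, hg 1 1 (by simp) (by simp [R.one]), T.one]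
      · show Finsupp.linearCombination ℤ g _ = 0
        unfold FTZ
        simp only [map_add, map_sub, Finsupp.linearCombination_single, one_smul]
        obtain ⟨a, ha, hxa⟩ := R.lift x.ne_zero
        obtain ⟨b, hb, hyb⟩ := R.lift y.ne_zero
        have one_s : ∀ a, v a = 1 → rho v a ≠ 1 → v (1 - a) = 1 ∧ rho v (1 - a) = 1 - rho v a := by
          intro a ha h
          have h1 := R.sub 1 a (by simp) ha.le
          rw [R.one] at h1
          refine ⟨?_, h1⟩
          have hle : v (1 - a) ≤ 1 := by
            have := v.map_sub 1 a
            rwa [map_one, ha, max_self] at this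
          refine le_antisymm hle (not_lt.mp fun h' => ?_)
          rw [← R.ker _ hle, h1, sub_eq_zero] at h'
          exact h h'.symm
        have ninv : ∀ a, v a = 1 → v a⁻¹ = 1 ∧ rho v a⁻¹ = (rho v a)⁻¹ := by
          intro a ha
          have := rdiv 1 a (by simp) ha
          rw [one_div, R.one, one_div] at this
          exact ⟨by rw [map_inv₀, ha, inv_one], this⟩
        rw [← hxa] at hx
        rw [← hyb] at hy
        obtain ⟨h1, h1'⟩ := one_s a ha hx
        obtain ⟨h2, h2'⟩ := one_s b hb hy
        obtain ⟨h3, h3'⟩ := ninv a ha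
        obtain ⟨h4, h4'⟩ := ninv b hb
        obtain ⟨h5, h5'⟩ := one_s _ h3 (by rw [h3']; simpa using hx)
        obtain ⟨h6, h6'⟩ := one_s _ h4 (by rw [h4']; simpa using hy)
        have ha1 : a ≠ 1 := by rintro rfl; exact hx R.one
        have hb1 : b ≠ 1 := by rintro rfl; exact hy R.one
        have hft := T.ft a b (Tw.ne_of_v ha) ha1 (Tw.ne_of_v hb) hb1
        rw [hX1 a ha, hX1 (1 - a) h1, hX1 (a⁻¹ - 1) (by rw [Valuation.map_sub_swap]; exact h5),
          one_smul, one_smul, one_smul] at hft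
        rw [hg x a ha hxa, hg y b hb hyb, hg (y * x⁻¹) (b / a) (vdiv _ _ hb ha) (by
          rw [rdiv _ _ hb ha, hxa, hyb]; simp [div_eq_mul_inv]),
          hg _ ((1 - a⁻¹) / (1 - b⁻¹)) (vdiv _ _ h5 h6) (by
            rw [rdiv _ _ h5 h6, h5', h6', h3', h4', hxa, hyb]; rfl),
          hg _ ((1 - a) / (1 - b)) (vdiv _ _ h1 h2) (by
            rw [rdiv _ _ h1 h2, h1', h2', hxa, hyb]; rfl)]
        exact hft
    let t1 : PBloch (Resk F v) →+ A := (Submodule.liftQ _ _ key).toAddMonoidHom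
    have ht1 : ∀ u, t1 (pb _ u) = g u := by
      intro u
      show Finsupp.linearCombination ℤ g _ = _
      rw [Finsupp.linearCombination_single, one_smul]
    have ht : ∀ u, (t1.comp e.toAddMonoidHom) (pbK' _ u) = g u := by
      intro u
      show t1 (e _) = _
      rw [he, ht1]
    refine ⟨t1.comp e.toAddMonoidHom, ?_, ?_⟩
    · intro x hx
      rw [ht, hg _ (x : F) hx (resUnit_val v x hx).symm]
    · obtain ⟨x, hx, hx1, hne, hr⟩ := third h2
      have hr' : ((resUnit F v x hx : (Resk F v)ˣ) : Resk F v) ≠ 1 := by rwa [resUnit_val]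
      rw [hcpk _ hr', map_add, ht, ht, hg _ (x : F) hx (resUnit_val v x hx).symm,
        hg _ (1 - (x : F)) hx1 ?_]
      · exact hC _ x.ne_zero hne
      · rw [R.sub _ _ (by simp) hx.le, R.one, ← resUnit_val v x hx]; rfl

end


noncomputable section

variable {F : Type} [Field F] {v : Valuation F (WithZero (Multiplicative ℤ))}

theorem ActData.chi_of {π : Fˣ} (D : ActData v π) (m : Loc2 F (RP' F)) (h : cls F π • m = m) :
    m ∈ chiSub F (chiVal F v) (Loc2 F (RP' F)) := by
  obtain ⟨n, hn⟩ := loc_bij.2 m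
  have hn : (2 : ℤ) • n = m := hn
  have hpn : cls F π • n = n := by
    rw [← sub_eq_zero]
    apply loc_tt
    rw [smul_sub, smul_comm, hn, h, sub_self]
  have e : m = cls F π • n - ((chiVal F v (sqc F π) : ℤˣ) : ℤ) • n := by
    rw [D.pi, hpn, ← hn, Units.val_neg, Units.val_one]; module
  rw [e]
  exact Submodule.subset_span ⟨π, n, rfl⟩

/-- the coinvariants -/
abbrev QA (v : Valuation F (WithZero (Multiplicative ℤ))) : Type :=
  Loc2 F (RP' F) ⧸ chiSub F (chiVal F v) (Loc2 F (RP' F))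

theorem QA_act (a : Fˣ) (b : QA v) : cls F a • b = ((chiVal F v (sqc F a) : ℤˣ) : ℤ) • b := by
  obtain ⟨n, rfl⟩ := Submodule.mkQ_surjective _ b
  rw [← map_smul, ← map_zsmul]
  exact (Submodule.Quotient.eq _).mpr (Submodule.subset_span ⟨a, n, rfl⟩)

theorem ActData.QA_tt {π : Fˣ} (D : ActData v π) (b : QA v) (h : (2 : ℤ) • b = 0) : b = 0 := by
  obtain ⟨n, rfl⟩ := Submodule.mkQ_surjective _ b
  rw [← map_zsmul] at h
  have h := (Submodule.Quotient.mk_eq_zero _).mp h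
  refine (Submodule.Quotient.mk_eq_zero _).mpr (D.chi_of n ?_)
  have h1 := D.onChi _ h
  rw [← sub_eq_zero]
  apply loc_tt
  rw [smul_sub, smul_comm, h1, sub_self]

theorem ActData.QA_pow {π : Fˣ} (D : ActData v π) (j : ℕ) (b : QA v) (h : (2 ^ j : ℤ) • b = 0) :
    b = 0 := by
  induction j with
  | zero => simpa using h
  | succ j ih => exact ih (D.QA_tt _ (by rw [← mul_smul, ← pow_succ']; exact h))

section locz
variable {P : Type} [AddCommGroup P]

theorem lg_zero {R : Type} [CommRing R] (r : R) {P : Type} [AddCommGroup P] [Module R P] (p : P)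
    (h : LocalizedModule.mkLinearMap (Submonoid.powers r) P p = 0) : ∃ i : ℕ, r ^ i • p = 0 := by
  rw [IsLocalizedModule.eq_zero_iff (Submonoid.powers r)] at h
  obtain ⟨⟨c, i, hc⟩, h⟩ := h
  refine ⟨i, ?_⟩
  have hc : r ^ i = c := hc
  rw [hc]; exact h

theorem lg_inj {R : Type} [CommRing R] {P : Type} [AddCommGroup P] [Module R P]
    (b : LocalizedModule (Submonoid.powers (2 : R)) P) (h : b + b = 0) : b = 0 := by
  have h1 := IsLocalizedModule.map_units (S := Submonoid.powers (2 : R))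
    (LocalizedModule.mkLinearMap (Submonoid.powers (2 : R)) P) ⟨2, Submonoid.mem_powers _⟩
  rw [Module.End.isUnit_iff] at h1
  refine h1.1 ?_
  rw [map_zero]
  exact (two_smul R b).trans h

theorem lg_surj {R : Type} [CommRing R] {P : Type} [AddCommGroup P] [Module R P]
    (b : LocalizedModule (Submonoid.powers (2 : R)) P) :
    ∃ (j : ℕ) (p : P), (2 ^ j : ℕ) • b =
      LocalizedModule.mkLinearMap (Submonoid.powers (2 : R)) P p := by
  obtain ⟨⟨m, s, hs⟩, h⟩ := IsLocalizedModule.surj (S := Submonoid.powers (2 : R))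
    (LocalizedModule.mkLinearMap (Submonoid.powers (2 : R)) P) b
  obtain ⟨j, rfl⟩ := hs
  refine ⟨j, m, ?_⟩
  rw [← Nat.cast_smul_eq_nsmul R]
  push_cast
  exact h

/-- abstract localization away from two -/
structure LZ {P B : Type} [AddCommGroup P] [AddCommGroup B] (τ : P →+ B) : Prop where
  zero : ∀ p, τ p = 0 → ∃ i : ℕ, (2 ^ i : ℤ) • p = 0
  tt' : ∀ b : B, b + b = 0 → b = 0
  surj' : ∀ b : B, ∃ (j : ℕ) (p : P), (2 ^ j : ℕ) • b = τ p

theorem LZ.tt {B : Type} [AddCommGroup B] {τ : P →+ B} (Z : LZ τ) (b : B)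
    (h : (2 : ℤ) • b = 0) : b = 0 := Z.tt' b (by rwa [← two_smul ℤ b])

theorem LZ.pow {B : Type} [AddCommGroup B] {τ : P →+ B} (Z : LZ τ) (j : ℕ) (b : B)
    (h : (2 ^ j : ℤ) • b = 0) : b = 0 := by
  induction j with
  | zero => simpa using h
  | succ j ih => exact ih (Z.tt _ (by rw [← mul_smul, ← pow_succ']; exact h))

theorem LZ.surj {B : Type} [AddCommGroup B] {τ : P →+ B} (Z : LZ τ) (b : B) :
    ∃ (j : ℕ) (p : P), (2 ^ j : ℤ) • b = τ p := by
  obtain ⟨j, p, h⟩ := Z.surj' b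
  refine ⟨j, p, ?_⟩
  rw [← h, ← natCast_zsmul]; push_cast; rfl

/-- additive version of `toLocZ` -/
def tz (P : Type) [AddCommGroup P] : P →+ LocalizedModule (Submonoid.powers (2 : ℤ)) P :=
  LinearMap.toAddMonoidHom (LocalizedModule.mkLinearMap (Submonoid.powers (2 : ℤ)) P)

theorem tzLZ (P : Type) [AddCommGroup P] : LZ (tz P) where
  zero p h := lg_zero (2 : ℤ) p h
  tt' b h := lg_inj (R := ℤ) b h
  surj' b := lg_surj (R := ℤ) b

end locz

theorem ActData.part2 {π : Fˣ} (D : ActData v π)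
    (cpk : PBK (Resk F v))
    (hcpk : ∀ (u : (Resk F v)ˣ) (hu : (u : Resk F v) ≠ 1),
      cpk = pbK' _ u + pbK' _ (U (Resk F v) (1 - (u : Resk F v)) (one_sub_ne hu)))
    (hcpk2 : Nat.card (Resk F v) = 2 → cpk ≠ 0)
    {B : Type} [AddCommGroup B] {τ : PBK (Resk F v) →+ B} (Z : LZ τ)
    (s : Loc2 F (RP' F) →+ B)
    (hs : ∀ (a : Fˣ) (m : Loc2 F (RP' F)),
        s (cls F a • m) = ((chiVal F v (sqc F a) : ℤˣ) : ℤ) • s m)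
    (hs1 : ∀ (x : Fˣ) (hx : v (x : F) = 1),
        s (toLoc2 F (rp F x)) = τ (pbK' _ (resUnit F v x hx)))
    (hs2 : ∀ x : Fˣ, v (x : F) < 1 → s (toLoc2 F (rp F x)) = τ cpk)
    (hs3 : ∀ x : Fˣ, 1 < v (x : F) → s (toLoc2 F (rp F x)) = -τ cpk) :
    Function.Bijective
        (fun m : ↥(augIdeal F • (⊤ : Submodule (RF F) (Loc2 F (RP' F)))) =>
          s (m : Loc2 F (RP' F))) := by
  set q := (chiSub F (chiVal F v) (Loc2 F (RP' F))).mkQ with hq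
  have T := mkTw (chiVal F v) (q.comp (toL (RP' F))) (fun a m => QA_act a _) D.QA_tt
  set f := fof (q.comp (toL (RP' F))) with hf
  have hX := Xof_chiVal v
  have hm : Xof (chiVal F v) (-1 : F) = 1 := by rw [hX _ (by simp)]; simp
  have hπ1 : v (π : F) < 1 := by
    rw [D.val, ← WithZero.exp_zero, WithZero.exp_lt_exp]; norm_num
  have hπne : (π : F) ≠ 1 := by intro h; rw [h, map_one] at hπ1; exact lt_irrefl _ hπ1
  have hC : ∀ x, x ≠ 0 → x ≠ 1 → f x + f (1 - x) = f π + f (1 - π) := fun x hx hx1 =>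
    T.const hm x π hx hx1 π.ne_zero hπne
  obtain ⟨B1, -⟩ := T.thmB _ hC hX (π : F) D.val
  obtain ⟨t, ht1, ht2⟩ := t0_exists T _ hC hX (π : F) D.val cpk hcpk hcpk2
  generalize f π + f (1 - π) = C at *
  have hfu : ∀ x : Fˣ, q (toL (RP' F) (rp F x)) = f x := fun x =>
    (fof_unit (⇑(q.comp (toL (RP' F)))) x).symm
  let S : AddSubgroup (Loc2 F (RP' F)) :=
    { carrier := {n | ∃ (j : ℕ) (p : PBK (Resk F v)), (2 ^ j : ℤ) • q n = t p ∧
        (2 ^ j : ℤ) • s n = τ p}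
      zero_mem' := ⟨0, 0, by simp, by simp⟩
      add_mem' := by
        rintro n n' ⟨j, p, h1, h2⟩ ⟨j', p', h1', h2'⟩
        refine ⟨j + j', (2 ^ j' : ℤ) • p + (2 ^ j : ℤ) • p', ?_, ?_⟩
        · rw [map_add, map_add, map_zsmul, map_zsmul, ← h1, ← h1', pow_add]; module
        · rw [map_add, map_add, map_zsmul, map_zsmul, ← h2, ← h2', pow_add]; module
      neg_mem' := by
        rintro n ⟨j, p, h1, h2⟩
        exact ⟨j, -p, by rw [map_neg, map_neg, smul_neg, h1],
          by rw [map_neg, map_neg, smul_neg, h2]⟩ }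
  have hS : ∀ n, ∃ (j : ℕ) (p : PBK (Resk F v)), (2 ^ j : ℤ) • q n = t p ∧
        (2 ^ j : ℤ) • s n = τ p := by
    refine loc_top S ?_ ?_ ?_
    · rintro a m ⟨j, p, h1, h2⟩
      refine ⟨j, ((chiVal F v (sqc F a) : ℤˣ) : ℤ) • p, ?_, ?_⟩
      · rw [map_smul, QA_act, smul_comm, h1, map_zsmul]
      · rw [hs, smul_comm, h2, map_zsmul]
    · rintro m ⟨j, p, h1, h2⟩
      refine ⟨j + 1, p, ?_, ?_⟩
      · rw [pow_succ, mul_smul, ← map_zsmul, h1]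
      · rw [pow_succ, mul_smul, ← map_zsmul, h2]
    · intro x
      rcases lt_trichotomy (v (x : F)) 1 with hx | hx | hx
      · refine ⟨0, cpk, ?_, ?_⟩
        · rw [pow_zero, one_smul, hfu, ht2, B1 _ x.ne_zero hx]
        · rw [pow_zero, one_smul]; exact hs2 x hx
      · refine ⟨0, pbK' _ (resUnit F v x hx), ?_, ?_⟩
        · rw [pow_zero, one_smul, hfu, ht1]
        · rw [pow_zero, one_smul]; exact hs1 x hx
      · refine ⟨0, -cpk, ?_, ?_⟩
        · rw [pow_zero, one_smul, hfu, map_neg, ht2]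
          have h1 := T.inv _ x.ne_zero
          rw [B1 _ (inv_ne_zero x.ne_zero) (by rw [map_inv₀]; exact inv_lt_one_of_one_lt₀ hx)] at h1
          rw [h1, neg_neg]
        · rw [pow_zero, one_smul, map_neg]; exact hs3 x hx
  constructor
  · rintro ⟨m, hm1⟩ ⟨m', hm2⟩ h
    have h : s m = s m' := h
    apply Subtype.ext
    show m = m'
    rw [← sub_eq_zero]
    refine D.inj _ (Submodule.sub_mem _ hm1 hm2) ((Submodule.Quotient.mk_eq_zero _).mp ?_)
    obtain ⟨j, p, h1, h2⟩ := hS (m - m')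
    rw [map_sub s, h, sub_self, smul_zero] at h2
    obtain ⟨i, hi⟩ := Z.zero p h2.symm
    refine D.QA_pow (i + j) _ ?_
    rw [pow_add, mul_smul]
    refine (congrArg _ h1).trans ?_
    rw [← map_zsmul, hi, map_zero]
  · have half : ∀ b, (2 : ℤ) • b ∈ s.range → b ∈ s.range := by
      rintro b ⟨n, hn⟩
      obtain ⟨n', hn'⟩ := loc_bij.2 n
      have hn' : (2 : ℤ) • n' = n := hn'
      refine ⟨n', ?_⟩
      rw [← sub_eq_zero]
      apply Z.tt
      rw [smul_sub, ← map_zsmul, hn', hn, sub_self]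
    have half' : ∀ (j : ℕ) b, (2 ^ j : ℤ) • b ∈ s.range → b ∈ s.range := by
      intro j
      induction j with
      | zero => intro m hm; simpa using hm
      | succ j ih =>
        intro m hm
        exact ih _ (half _ (by rw [← mul_smul, ← pow_succ']; exact hm))
    have hcp : τ cpk ∈ s.range := ⟨_, hs2 π hπ1⟩
    have hu : ∀ u, τ (pbK' _ u) ∈ s.range := by
      intro u
      obtain ⟨x, hx, rfl⟩ := res_lift u
      exact ⟨_, hs1 x hx⟩
    have all : ∀ p, τ p ∈ s.range := by
      by_cases h2 : Nat.card (Resk F v) = 2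
      · obtain ⟨e, -⟩ := PBK2 _ h2
        intro p
        have hc : e cpk ≠ 0 := fun h => hcpk2 h2 (by simpa using h)
        have key : ∀ a c : ZMod 3, c ≠ 0 → (a * c).val • c = a := by decide
        have : (e p * e cpk).val • cpk = p := by
          apply e.injective
          rw [map_nsmul, key _ _ hc]
        rw [← this, map_nsmul]
        exact AddSubgroup.nsmul_mem _ hcp _
      by_cases h3 : Nat.card (Resk F v) = 3
      · obtain ⟨e, -⟩ := PBK3 _ h3
        intro p
        have h4 : (4 : ℤ) • p = 0 := by
          apply e.injective
          rw [map_zsmul, map_zero]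
          generalize e p = a
          revert a; decide
        have : τ p = 0 := by
          apply Z.pow 2
          rw [← map_zsmul]
          rw [show (2 : ℤ) ^ 2 = 4 by norm_num, h4, map_zero]
        rw [this]; exact AddSubgroup.zero_mem _
      · obtain ⟨e, he⟩ := PBK4 _ h2 h3
        have key : ∀ w : (Resk F v)ˣ →₀ ℤ,
            τ (e.symm (Submodule.Quotient.mk w : PBloch (Resk F v))) ∈ s.range := by
          let L : ((Resk F v)ˣ →₀ ℤ) →+ PBloch (Resk F v) :=
            (Submodule.mkQ (Submodule.span ℤ
    ({Finsupp.single (1 : (Resk F v)ˣ) (1 : ℤ)} ∪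
      {w | ∃ (x y : (Resk F v)ˣ) (hx : (x : Resk F v) ≠ 1) (hy : (y : Resk F v) ≠ 1),
        w = FTZ _ x y hx hy}))).toAddMonoidHom
          intro w
          show τ (e.symm (L w)) ∈ s.range
          induction w using Finsupp.induction_linear with
          | zero => rw [map_zero, map_zero, map_zero]; exact AddSubgroup.zero_mem _
          | add a b ha hb =>
            rw [map_add, map_add, map_add]; exact AddSubgroup.add_mem _ ha hb
          | single u n =>
            have e1 : (Finsupp.single u n : (Resk F v)ˣ →₀ ℤ) = n • Finsupp.single u 1 := by simp
            rw [e1, map_zsmul, map_zsmul, map_zsmul]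
            refine AddSubgroup.zsmul_mem _ ?_ _
            have e2 : e.symm (L (Finsupp.single u 1)) = pbK' _ u := by
              rw [AddEquiv.symm_apply_eq, he]; rfl
            rw [e2]; exact hu u
        intro p
        obtain ⟨w, hw⟩ := Submodule.mkQ_surjective _ (e p)
        have h4 : e.symm (Submodule.Quotient.mk w : PBloch (Resk F v)) = p := by
          exact e.symm_apply_eq.mpr hw
        rw [← h4]; exact key w
    intro b
    obtain ⟨j, p, hp⟩ := Z.surj b
    obtain ⟨n, rfl⟩ := half' j b (hp ▸ all p)
    obtain ⟨m, hm1, hm2⟩ := D.surj n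
    refine ⟨⟨m, hm1⟩, ?_⟩
    show s m = s n
    rw [← sub_eq_zero, ← map_sub]
    have hcls : ∀ (a : Fˣ) m, m ∈ s.ker → cls F a • m ∈ s.ker := by
      intro a m hm
      rw [AddMonoidHom.mem_ker] at hm ⊢
      rw [hs, hm, smul_zero]
    refine Submodule.span_induction (p := fun x _ => s x = 0) ?_ ?_ ?_ ?_ hm2
    · rintro _ ⟨a, n, rfl⟩
      rw [map_sub, hs, map_zsmul, sub_self]
    · exact map_zero s
    · intro x y _ _ hx hy; rw [map_add, hx, hy, add_zero]
    · intro r x _ hx; exact act_mem s.ker hcls r x hx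

end

theorem statement13 (F : Type) [Field F] (hcard : 4 ≤ Cardinal.mk F)
    (v : Valuation F (WithZero (Multiplicative ℤ))) (hsurj : Function.Surjective v)
    (hk : Finite (Resk F v) ∨ (∀ a : Resk F v, IsSquare a) ∨
      IsRealClosedField (Resk F v))
    (hU : ∃ n : ℕ, 0 < n ∧ ∀ u ∈ UnV F v n, ∃ w ∈ UnV F v 1, u = w * w)
    (cpk : PBK (Resk F v))
    (hcpk : ∀ (u : (Resk F v)ˣ) (hu : (u : Resk F v) ≠ 1),
      cpk = pbK' _ u + pbK' _ (U (Resk F v) (1 - (u : Resk F v)) (one_sub_ne hu)))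
    (hcpk2 : Nat.card (Resk F v) = 2 → cpk ≠ 0) :
    Function.Bijective
      ((chiSub F (chiVal F v) (Loc2 F (RP' F))).mkQ.comp
        (augIdeal F • (⊤ : Submodule (RF F) (Loc2 F (RP' F)))).subtype) ∧
    ∀ s : Loc2 F (RP' F) →+ LocalizedModule (Submonoid.powers (2 : ℤ)) (PBK (Resk F v)),
      (∀ (a : Fˣ) (m : Loc2 F (RP' F)),
        s (cls F a • m) = ((chiVal F v (sqc F a) : ℤˣ) : ℤ) • s m) →
      (∀ (x : Fˣ) (hx : v (x : F) = 1),
        s (toLoc2 F (rp F x)) = toLocZ _ (pbK' _ (resUnit F v x hx))) →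
      (∀ x : Fˣ, v (x : F) < 1 → s (toLoc2 F (rp F x)) = toLocZ _ cpk) →
      (∀ x : Fˣ, 1 < v (x : F) → s (toLoc2 F (rp F x)) = -toLocZ _ cpk) →
      Function.Bijective
        (fun m : ↥(augIdeal F • (⊤ : Submodule (RF F) (Loc2 F (RP' F)))) =>
          s (m : Loc2 F (RP' F))) := by
  obtain ⟨π, D⟩ := actData v hsurj hk hU
  refine ⟨D.part1, fun s h h1 h2 h3 => D.part2 cpk hcpk hcpk2 (tzLZ _) s ?_ h1 h2 h3⟩
  intro a m
  refine (h a m).trans ?_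
  rcases Int.units_eq_one_or (chiVal F v (sqc F a)) with hh | hh
  · rw [hh]
  · rw [hh]
end

section
/- Let F be a field with at least 4 elements and χ : G_F → {±1} a character with χ(−1) = 1. Let ℓ ∈ F^× satisfy χ(ℓ) = −1 and χ(1−ℓ) = 1. Then [a]_χ = [(1−ℓ)a]_χ in (RP′(F)[1/2])_χ for all a ∈ F^×. -/
open scoped Classical

structure Dat {F A : Type} [Field F] [AddCommGroup A] (s : F → ℤ) (f : F → A) : Prop where
  tf : ∀ a : A, a + a = 0 → a = 0
  pm : ∀ x, s x = 1 ∨ s x = -1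
  mul : ∀ x y, x ≠ 0 → y ≠ 0 → s (x * y) = s x * s y
  m1 : s (-1) = 1
  one : f 1 = 0
  finv : ∀ x, x ≠ 0 → f x⁻¹ = - f x
  ft : ∀ x y, x ≠ 0 → y ≠ 0 → x ≠ 1 → y ≠ 1 →
    f x - f y + s x • f (y / x) - s (x⁻¹ - 1) • f ((1 - x⁻¹) / (1 - y⁻¹))
      + s (1 - x) • f ((1 - x) / (1 - y)) = 0

namespace Dat
variable {F A : Type} [Field F] [AddCommGroup A] {s : F → ℤ} {f : F → A}

theorem s1 (D : Dat s f) : s 1 = 1 := by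
  have h := D.mul 1 1 one_ne_zero one_ne_zero
  rw [mul_one] at h
  rcases D.pm 1 with h1 | h1 <;> rw [h1] at h ⊢ <;> norm_num at h

theorem neg (D : Dat s f) (x : F) (hx : x ≠ 0) : s (-x) = s x := by
  have h := D.mul (-1) x (by simp) hx
  rw [D.m1, one_mul, neg_one_mul] at h
  exact h

theorem inv (D : Dat s f) (x : F) (hx : x ≠ 0) : s x⁻¹ = s x := by
  have h := D.mul x x⁻¹ hx (inv_ne_zero hx)
  rw [mul_inv_cancel₀ hx, D.s1] at h
  rcases D.pm x with h1 | h1 <;> rcases D.pm x⁻¹ with h2 | h2 <;> rw [h1, h2] at h <;>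
    norm_num at h <;> rw [h1, h2]

theorem div (D : Dat s f) (x y : F) (hx : x ≠ 0) (hy : y ≠ 0) : s (x / y) = s x * s y := by
  rw [div_eq_mul_inv, D.mul x _ hx (inv_ne_zero hy), D.inv y hy]

theorem sw (D : Dat s f) (x y : F) (h : x ≠ y) : s (x - y) = s (y - x) := by
  rw [← D.neg _ (sub_ne_zero.2 h), neg_sub]

theorem finv' (D : Dat s f) (x y : F) (hx : x ≠ 0) (hy : y ≠ 0) : f (x / y) = - f (y / x) := by
  rw [← D.finv _ (div_ne_zero hy hx), inv_div]

theorem ft' (D : Dat s f) (x y : F) (hx : x ≠ 0) (hy : y ≠ 0) (hx1 : x ≠ 1) (hy1 : y ≠ 1) :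
    f x - f y + s x • f (y / x) - (s x * s (1 - x)) • f ((1 - x⁻¹) / (1 - y⁻¹))
      + s (1 - x) • f ((1 - x) / (1 - y)) = 0 := by
  have h := D.ft x y hx hy hx1 hy1
  have e : x⁻¹ - 1 = (1 - x) / x := by field_simp
  rw [e, D.div _ _ (sub_ne_zero.2 hx1.symm) hx, mul_comm (s (1 - x))] at h
  exact h

theorem cst (D : Dat s f) (z w : F) (hz0 : z ≠ 0) (hw0 : w ≠ 0) (hz : s z = -1) (hw : s w = -1) :
    f z = (s (1 - w) * s (1 - z)) • f w := by
  have hz1 : z ≠ 1 := by rintro rfl; rw [D.s1] at hz; norm_num at hz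
  have hw1 : w ≠ 1 := by rintro rfl; rw [D.s1] at hw; norm_num at hw
  have z1 : 1 - z ≠ 0 := sub_ne_zero.2 hz1.symm
  have w1 : 1 - w ≠ 0 := sub_ne_zero.2 hw1.symm
  by_cases hzw : w * z = 1
  · obtain rfl : z = w⁻¹ := by field_simp; rw [mul_comm]; exact hzw
    have e : 1 - w⁻¹ = (w - 1) / w := by field_simp
    rw [e, D.div _ _ (sub_ne_zero.2 hw1) hw0, D.sw _ _ hw1, hw, D.finv _ hw0]
    rcases D.pm (1 - w) with h | h <;> simp [h]
  have h0 : 1 - w * z ≠ 0 := sub_ne_zero.2 (Ne.symm hzw)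
  set x := (1 - w) / (1 - w * z) with hx
  have x0 : x ≠ 0 := div_ne_zero w1 h0
  have y0 : z * x ≠ 0 := mul_ne_zero hz0 x0
  have ex : 1 - x = w * (1 - z) / (1 - w * z) := by rw [hx]; field_simp; ring
  have ey : 1 - z * x = (1 - z) / (1 - w * z) := by
    rw [hx, eq_div_iff h0, sub_mul, mul_assoc, div_mul_cancel₀ _ h0]; ring
  have x1' : 1 - x ≠ 0 := by rw [ex]; exact div_ne_zero (mul_ne_zero hw0 z1) h0
  have y1' : 1 - z * x ≠ 0 := by rw [ey]; exact div_ne_zero z1 h0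
  have x1 : x ≠ 1 := (sub_ne_zero.1 x1').symm
  have y1 : z * x ≠ 1 := (sub_ne_zero.1 y1').symm
  have a1 := D.ft' x (z * x) x0 y0 x1 y1
  have a2 := D.ft' (z * x) x y0 x0 y1 x1
  have i1 : 1 - x⁻¹ ≠ 0 := by
    intro h; apply x1; rw [sub_eq_zero] at h; exact (inv_eq_one.1 h.symm)
  have i2 : 1 - (z * x)⁻¹ ≠ 0 := by
    intro h; apply y1; rw [sub_eq_zero] at h; exact (inv_eq_one.1 h.symm)
  have e1 : z * x / x = z := by field_simp
  have e2 : (1 - x) / (1 - z * x) = w := by rw [ex, ey]; field_simp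
  have sx : s x = s (1 - w) * s (1 - w * z) := D.div _ _ w1 h0
  have sy : s (z * x) = - s x := by rw [D.mul _ _ hz0 x0, hz]; ring
  have s1x : s (1 - x) = - (s (1 - z) * s (1 - w * z)) := by
    rw [ex, D.div _ _ (mul_ne_zero hw0 z1) h0, D.mul _ _ hw0 z1, hw]; ring
  have s1y : s (1 - z * x) = s (1 - z) * s (1 - w * z) := by
    rw [ey, D.div _ _ z1 h0]
  rw [D.finv' x _ x0 y0, D.finv' _ (1 - x⁻¹) i2 i1, D.finv' _ (1 - x) y1' x1', e1, e2, sy, s1y, sx] at a2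
  rw [e1, e2, sx, s1x] at a1
  generalize f ((1 - x⁻¹) / (1 - (z * x)⁻¹)) = q at a1 a2
  rw [← sub_eq_zero]
  apply D.tf
  rcases D.pm (1 - w) with h | h <;> rcases D.pm (1 - z) with h' | h' <;>
    rcases D.pm (1 - w * z) with h'' | h'' <;> simp only [h, h', h''] at a1 a2 ⊢ <;>
    first
    | linear_combination (norm := module) a1 + a2
    | linear_combination (norm := module) - a1 - a2

/-- values off the kernel -/
theorem off (D : Dat s f) (l : F) (hl0 : l ≠ 0) (hl : s l = -1) (hl1 : s (1 - l) = 1)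
    (z : F) (hz0 : z ≠ 0) (hz : s z = -1) : f z = s (1 - z) • f l := by
  rw [D.cst z l hz0 hl0 hz hl, hl1, one_mul]

theorem ne1 (D : Dat s f) {z : F} (hz : s z = -1) : z ≠ 1 := by
  rintro rfl; rw [D.s1] at hz; norm_num at hz

theorem inM (D : Dat s f) (l : F) (hl0 : l ≠ 0) (hl : s l = -1) (hl1 : s (1 - l) = 1)
    (x y : F) (hx0 : x ≠ 0) (hx : s x = -1) (hx1 : s (1 - x) = 1)
    (hy0 : y ≠ 0) (hyn : y ≠ 1) (hy : s y = 1) (hy1 : s (1 - y) = 1) :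
    f y = f l + f ((1 - x) / (1 - y)) := by
  have xn := D.ne1 hx
  have a := D.ft' x y hx0 hy0 xn hyn
  have O := D.off l hl0 hl hl1
  have x1 : 1 - x ≠ 0 := sub_ne_zero.2 xn.symm
  have y1 : 1 - y ≠ 0 := sub_ne_zero.2 hyn.symm
  have xy : x - y ≠ 0 := by
    intro h; rw [sub_eq_zero] at h; rw [h, hy] at hx; norm_num at hx
  have e : (1 - x⁻¹) / (1 - y⁻¹) = y * (1 - x) / (x * (1 - y)) := by
    have : y - 1 ≠ 0 := sub_ne_zero.2 hyn
    field_simp; ring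
  have e' : 1 - y * (1 - x) / (x * (1 - y)) = (x - y) / (x * (1 - y)) := by
    field_simp; ring
  have e'' : 1 - y / x = (x - y) / x := by field_simp
  rw [e, O x hx0 hx, O (y / x) (div_ne_zero hy0 hx0) (by rw [D.div _ _ hy0 hx0, hx, hy]; rfl),
    O (y * (1 - x) / (x * (1 - y))) (div_ne_zero (mul_ne_zero hy0 x1) (mul_ne_zero hx0 y1))
     (by rw [D.div _ _ (mul_ne_zero hy0 x1) (mul_ne_zero hx0 y1), D.mul _ _ hy0 x1,
          D.mul _ _ hx0 y1, hx, hy, hx1, hy1]; rfl), e', e'', D.div _ _ xy hx0,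
     D.div _ _ xy (mul_ne_zero hx0 y1), D.mul _ _ hx0 y1, hx, hx1, hy1] at a
  rcases D.pm (x - y) with h | h <;> rw [h] at a <;>
    linear_combination (norm := module) - a

theorem inN (D : Dat s f) (l : F) (hl0 : l ≠ 0) (hl : s l = -1) (hl1 : s (1 - l) = 1)
    (x y : F) (hx0 : x ≠ 0) (hx : s x = -1) (hx1 : s (1 - x) = 1)
    (hy0 : y ≠ 0) (hyn : y ≠ 1) (hy : s y = 1) (hy1 : s (1 - y) = -1) :
    f y = f l + f (y * (1 - x) / (x * (1 - y))) := by
  have xn := D.ne1 hx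
  have a := D.ft' x y hx0 hy0 xn hyn
  have O := D.off l hl0 hl hl1
  have x1 : 1 - x ≠ 0 := sub_ne_zero.2 xn.symm
  have y1 : 1 - y ≠ 0 := sub_ne_zero.2 hyn.symm
  have xy : x - y ≠ 0 := by
    intro h; rw [sub_eq_zero] at h; rw [h, hy] at hx; norm_num at hx
  have e : (1 - x⁻¹) / (1 - y⁻¹) = y * (1 - x) / (x * (1 - y)) := by
    have : y - 1 ≠ 0 := sub_ne_zero.2 hyn
    field_simp; ring
  have e' : 1 - (1 - x) / (1 - y) = (x - y) / (1 - y) := by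
    field_simp; ring
  have e'' : 1 - y / x = (x - y) / x := by field_simp
  rw [e, O x hx0 hx, O (y / x) (div_ne_zero hy0 hx0) (by rw [D.div _ _ hy0 hx0, hx, hy]; rfl),
    O ((1 - x) / (1 - y)) (div_ne_zero x1 y1)
     (by rw [D.div _ _ x1 y1, hx1, hy1]; rfl), e', e'', D.div _ _ xy hx0,
     D.div _ _ xy y1, hx, hx1, hy1] at a
  rcases D.pm (x - y) with h | h <;> rw [h] at a <;>
    linear_combination (norm := module) - a

theorem inN2 (D : Dat s f) (l : F) (hl0 : l ≠ 0) (hl : s l = -1) (hl1 : s (1 - l) = 1)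
    (p t : F) (hp0 : p ≠ 0) (hp : s p = -1) (hp1 : s (1 - p) = -1)
    (ht0 : t ≠ 0) (ht : s t = -1) (ht1 : s (1 - t) = -1) :
    f (t / (t - 1)) = f l + f (p * t) := by
  have pn := D.ne1 hp
  have tn := D.ne1 ht
  have p1 : 1 - p ≠ 0 := sub_ne_zero.2 pn.symm
  have t1 : 1 - t ≠ 0 := sub_ne_zero.2 tn.symm
  have t1' : t - 1 ≠ 0 := sub_ne_zero.2 tn
  have e : 1 - 1 / (1 - p) = - (p / (1 - p)) := by field_simp; ring
  have e2 : 1 - t / (t - 1) = 1 / (1 - t) := by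
    field_simp; ring
  have h := D.inN l hl0 hl hl1 (1 / (1 - p)) (t / (t - 1)) (div_ne_zero one_ne_zero p1)
    (by rw [D.div _ _ one_ne_zero p1, D.s1, hp1]; rfl)
    (by rw [e, D.neg _ (div_ne_zero hp0 p1), D.div _ _ hp0 p1, hp, hp1]; rfl)
    (div_ne_zero ht0 t1')
    (by intro h; field_simp at h; simpa using h.symm)
    (by rw [D.div _ _ ht0 t1', D.sw _ _ tn, ht, ht1]; rfl)
    (by rw [e2, D.div _ _ one_ne_zero t1, D.s1, ht1]; rfl)
  rw [h]
  congr 2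
  rw [e, e2]; field_simp; ring

theorem fN (D : Dat s f) (l : F) (hl0 : l ≠ 0) (hl : s l = -1) (hl1 : s (1 - l) = 1)
    (y : F) (hy0 : y ≠ 0) (hyn : y ≠ 1) (hy : s y = 1) (hy1 : s (1 - y) = -1) : f y = 0 := by
  have y1 : 1 - y ≠ 0 := sub_ne_zero.2 hyn.symm
  have y1' : y - 1 ≠ 0 := sub_ne_zero.2 hyn
  have e1 : 1 - y / (y - 1) = 1 / (1 - y) := by field_simp; ring
  have e2 : 1 - 1 / (1 - y) = y / (y - 1) := by field_simp; ring
  have a1 : s (y / (y - 1)) = -1 := by rw [D.div _ _ hy0 y1', D.sw _ _ hyn, hy, hy1]; rfl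
  have a2 : s (1 / (1 - y)) = -1 := by rw [D.div _ _ one_ne_zero y1, D.s1, hy1]; rfl
  have b1 : y / (y - 1) ≠ 0 := div_ne_zero hy0 y1'
  have b2 : 1 / (1 - y) ≠ 0 := div_ne_zero one_ne_zero y1
  have h1 := D.inN2 l hl0 hl hl1 _ _ b1 a1 (e1 ▸ a2) b2 a2 (e2 ▸ a1)
  have h2 := D.inN2 l hl0 hl hl1 _ _ b2 a2 (e2 ▸ a1) b1 a1 (e1 ▸ a2)
  have g1 : 1 / (1 - y) / (1 / (1 - y) - 1) = y⁻¹ := by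
    have : 1 / (1 - y) - 1 = y / (1 - y) := by field_simp; ring
    rw [this]; field_simp
  have g2 : y / (y - 1) / (y / (y - 1) - 1) = y := by
    have : y / (y - 1) - 1 = 1 / (y - 1) := by field_simp; ring
    rw [this]; field_simp
  rw [g1, D.finv _ hy0] at h1
  rw [g2, mul_comm] at h2
  apply D.tf
  linear_combination (norm := module) h2 - h1

theorem Lprod (D : Dat s f) (l : F) (hl0 : l ≠ 0) (hl : s l = -1) (hl1 : s (1 - l) = 1)
    (hc : f l ≠ 0)
    (p t : F) (hp0 : p ≠ 0) (hp : s p = -1) (hp1 : s (1 - p) = -1)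
    (ht0 : t ≠ 0) (ht : s t = -1) (ht1 : s (1 - t) = -1) : s (1 - p * t) = 1 := by
  by_contra hn
  have hm := (D.pm (1 - p * t)).resolve_left hn
  have tn := D.ne1 ht
  have t1 : 1 - t ≠ 0 := sub_ne_zero.2 tn.symm
  have t1' : t - 1 ≠ 0 := sub_ne_zero.2 tn
  have e2 : 1 - t / (t - 1) = 1 / (1 - t) := by
    field_simp; ring
  have h := D.inN2 l hl0 hl hl1 p t hp0 hp hp1 ht0 ht ht1
  have pt : p * t ≠ 1 := by
    intro hh
    have : t = 1 / p := by field_simp; rw [mul_comm]; exact hh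
    rw [this] at ht1
    have e : 1 - 1 / p = -((1 - p) / p) := by field_simp; ring
    have p1 : 1 - p ≠ 0 := sub_ne_zero.2 (D.ne1 hp).symm
    rw [e, D.neg _ (div_ne_zero p1 hp0), D.div _ _ p1 hp0, hp, hp1] at ht1
    norm_num at ht1
  rw [D.fN l hl0 hl hl1 (t / (t - 1)) (div_ne_zero ht0 t1')
    (by intro h; field_simp at h; simpa using h.symm)
    (by rw [D.div _ _ ht0 t1', D.sw _ _ tn, ht, ht1]; rfl)
    (by rw [e2, D.div _ _ one_ne_zero t1, D.s1, ht1]; rfl),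
    D.fN l hl0 hl hl1 (p * t) (mul_ne_zero hp0 ht0) pt (by rw [D.mul _ _ hp0 ht0, hp, ht]; rfl) hm]
    at h
  apply hc
  simpa using h.symm

theorem s1inv (D : Dat s f) {a : F} (h0 : a ≠ 0) (h1 : a ≠ 1) : s (1 - a⁻¹) = s a * s (1 - a) := by
  have e : 1 - a⁻¹ = - ((1 - a) / a) := by field_simp; ring
  have p1 : 1 - a ≠ 0 := sub_ne_zero.2 h1.symm
  rw [e, D.neg _ (div_ne_zero p1 h0), D.div _ _ p1 h0, mul_comm]

theorem Lprod2 (D : Dat s f) (l : F) (hl0 : l ≠ 0) (hl : s l = -1) (hl1 : s (1 - l) = 1)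
    (hc : f l ≠ 0)
    (p t : F) (hp0 : p ≠ 0) (hp : s p = -1) (hp1 : s (1 - p) = 1)
    (ht0 : t ≠ 0) (ht : s t = -1) (ht1 : s (1 - t) = 1) : s (1 - p * t) = 1 := by
  by_cases h1 : p * t = 1
  · have h2 : t = p⁻¹ := by field_simp; rw [mul_comm]; exact h1
    rw [h2, D.s1inv hp0 (D.ne1 hp), hp, hp1] at ht1
    norm_num at ht1
  have h := D.Lprod l hl0 hl hl1 hc p⁻¹ t⁻¹ (inv_ne_zero hp0) (by rw [D.inv _ hp0, hp])
    (by rw [D.s1inv hp0 (D.ne1 hp), hp, hp1]; rfl) (inv_ne_zero ht0) (by rw [D.inv _ ht0, ht])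
    (by rw [D.s1inv ht0 (D.ne1 ht), ht, ht1]; rfl)
  rw [← mul_inv, D.s1inv (mul_ne_zero hp0 ht0) h1, D.mul _ _ hp0 ht0, hp, ht] at h
  simpa using h

/-- `a ∈ L` -/
theorem offL (D : Dat s f) (l : F) (hl0 : l ≠ 0) (hl : s l = -1) (hl1 : s (1 - l) = 1)
    (a : F) (ha0 : a ≠ 0) (ha : s a = -1) (ha1 : s (1 - a) = 1) :
    f ((1 - l) * a) = f a := by
  have O := D.off l hl0 hl hl1
  have l1 : 1 - l ≠ 0 := sub_ne_zero.2 (D.ne1 hl).symm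
  have a1 : 1 - a ≠ 0 := sub_ne_zero.2 (D.ne1 ha).symm
  have hla : s ((1 - l) * a) = -1 := by rw [D.mul _ _ l1 ha0, hl1, ha]; rfl
  rw [O a ha0 ha, O _ (mul_ne_zero l1 ha0) hla, ha1]
  by_cases hc : f l = 0
  · simp [hc]
  have b0 : -(a / (1 - a)) ≠ 0 := neg_ne_zero.2 (div_ne_zero ha0 a1)
  have e : 1 - -(a / (1 - a)) = 1 / (1 - a) := by field_simp; ring
  have h := D.Lprod2 l hl0 hl hl1 hc (-(a / (1 - a))) l b0
    (by rw [D.neg _ (div_ne_zero ha0 a1), D.div _ _ ha0 a1, ha, ha1]; rfl)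
    (by rw [e, D.div _ _ one_ne_zero a1, D.s1, ha1]; rfl) hl0 hl hl1
  have e' : 1 - -(a / (1 - a)) * l = (1 - (1 - l) * a) / (1 - a) := by field_simp; ring
  rw [e', D.div _ _ (sub_ne_zero.2 (D.ne1 hla).symm) a1, ha1, mul_one] at h
  rw [h]

theorem Linv (D : Dat s f) (l : F) (hl0 : l ≠ 0) (hl : s l = -1) (hl1 : s (1 - l) = 1) :
    ∃ m, m ≠ 0 ∧ s m = -1 ∧ s (1 - m) = 1 ∧ 1 - m = (1 - l)⁻¹ ∧ f m = f l := by
  have l1 : 1 - l ≠ 0 := sub_ne_zero.2 (D.ne1 hl).symm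
  have e : 1 - -(l / (1 - l)) = (1 - l)⁻¹ := by field_simp; ring
  have m0 : -(l / (1 - l)) ≠ 0 := neg_ne_zero.2 (div_ne_zero hl0 l1)
  have ms : s (-(l / (1 - l))) = -1 := by
    rw [D.neg _ (div_ne_zero hl0 l1), D.div _ _ hl0 l1, hl, hl1]; rfl
  have m1 : s (1 - -(l / (1 - l))) = 1 := by rw [e, D.inv _ l1, hl1]
  refine ⟨_, m0, ms, m1, e, ?_⟩
  rw [D.off l hl0 hl hl1 _ m0 ms, m1, one_smul]

theorem offK (D : Dat s f) (l : F) (hl0 : l ≠ 0) (hl : s l = -1) (hl1 : s (1 - l) = 1)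
    (a : F) (ha0 : a ≠ 0) (ha : s a = -1) : f ((1 - l) * a) = f a := by
  have l1 : 1 - l ≠ 0 := sub_ne_zero.2 (D.ne1 hl).symm
  rcases D.pm (1 - a) with ha1 | ha1
  · exact D.offL l hl0 hl hl1 a ha0 ha ha1
  obtain ⟨m, m0, ms, m1, e, -⟩ := D.Linv l hl0 hl hl1
  have h := D.offL m m0 ms m1 a⁻¹ (inv_ne_zero ha0) (by rw [D.inv _ ha0, ha])
    (by rw [D.s1inv ha0 (D.ne1 ha), ha, ha1]; rfl)
  rw [e, ← mul_inv, D.finv _ (mul_ne_zero l1 ha0), D.finv _ ha0] at h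
  exact neg_injective h

/-- `a ∈ M` -/
theorem onM0 (D : Dat s f) (l : F) (hl0 : l ≠ 0) (hl : s l = -1) (hl1 : s (1 - l) = 1)
    (a : F) (ha0 : a ≠ 0) (han : a ≠ 1) (ha : s a = 1) (ha1 : s (1 - a) = 1) :
    f (1 - a⁻¹) = f l + f ((1 - l) * a) := by
  have i1 : 1 - a⁻¹ ≠ 0 := by
    rw [sub_ne_zero]; intro h; exact han (inv_eq_one.1 h.symm)
  have h := D.inM l hl0 hl hl1 l (1 - a⁻¹) hl0 hl hl1 i1 (by simp [ha0])
    (by rw [D.s1inv ha0 han, ha, ha1]; rfl) (by rw [sub_sub_cancel, D.inv _ ha0, ha])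
  rw [h, sub_sub_cancel, div_inv_eq_mul]

theorem diff (D : Dat s f) (l : F) (hl0 : l ≠ 0) (hl : s l = -1) (hl1 : s (1 - l) = 1)
    (a : F) (ha0 : a ≠ 0) (han : a ≠ 1) (ha : s a = 1) (ha1 : s (1 - a) = 1) :
    f (1 - a) + f (1 - a⁻¹) = f l + f l := by
  have l1 : 1 - l ≠ 0 := sub_ne_zero.2 (D.ne1 hl).symm
  obtain ⟨m, m0, ms, m1, e, em⟩ := D.Linv l hl0 hl hl1
  have h := D.onM0 m m0 ms m1 a⁻¹ (inv_ne_zero ha0) (by simpa using han) (by rw [D.inv _ ha0, ha])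
    (by rw [D.s1inv ha0 han, ha, ha1]; rfl)
  rw [inv_inv, e, ← mul_inv, D.finv _ (mul_ne_zero l1 ha0), em] at h
  have h2 := D.onM0 l hl0 hl hl1 a ha0 han ha ha1
  rw [h, h2]; abel

theorem onM (D : Dat s f) (l : F) (hl0 : l ≠ 0) (hl : s l = -1) (hl1 : s (1 - l) = 1)
    (a : F) (ha0 : a ≠ 0) (han : a ≠ 1) (ha : s a = 1) (ha1 : s (1 - a) = 1) :
    f ((1 - l) * a) = f a := by
  have a1 : 1 - a ≠ 0 := sub_ne_zero.2 han.symm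
  have i1 : 1 - a⁻¹ ≠ 0 := by
    rw [sub_ne_zero]; intro h; exact han (inv_eq_one.1 h.symm)
  have h0 := D.onM0 l hl0 hl hl1 a ha0 han ha ha1
  have d1 := D.diff l hl0 hl hl1 a ha0 han ha ha1
  have d2 := D.diff l hl0 hl hl1 (1 - a) a1 (by simpa using ha0) ha1 (by rw [sub_sub_cancel, ha])
  have d3 := D.diff l hl0 hl hl1 (1 - a⁻¹) i1 (by simpa using ha0)
    (by rw [D.s1inv ha0 han, ha, ha1]; rfl) (by rw [sub_sub_cancel, D.inv _ ha0, ha])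
  have e2 : 1 - (1 - a)⁻¹ = (1 - a⁻¹)⁻¹ := by
    have : a - 1 ≠ 0 := sub_ne_zero.2 han
    field_simp; ring
  have e3 : 1 - (1 - a⁻¹)⁻¹ = (1 - a)⁻¹ := by rw [← e2, sub_sub_cancel]
  rw [sub_sub_cancel, e2, D.finv _ i1] at d2
  rw [sub_sub_cancel, e3, D.finv _ a1, D.finv _ ha0] at d3
  have c3 : f l + f l + f l = 0 := by
    apply D.tf
    linear_combination (norm := module) - d1 - d2 - d3
  linear_combination (norm := module) - c3 - d2 - h0

theorem main (D : Dat s f) (l : F) (hl0 : l ≠ 0) (hl : s l = -1) (hl1 : s (1 - l) = 1)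
    (a : F) (ha0 : a ≠ 0) : f ((1 - l) * a) = f a := by
  have l1 : 1 - l ≠ 0 := sub_ne_zero.2 (D.ne1 hl).symm
  rcases D.pm a with ha | ha
  swap
  · exact D.offK l hl0 hl hl1 a ha0 ha
  have Z : ∀ b, b ≠ 0 → s b = 1 → ¬ (b ≠ 1 ∧ s (1 - b) = 1) → f b = 0 := by
    intro b hb0 hb h
    by_cases hb1 : b = 1
    · rw [hb1, D.one]
    · exact D.fN l hl0 hl hl1 b hb0 hb1 hb ((D.pm _).resolve_left fun h' => h ⟨hb1, h'⟩)
  have la0 := mul_ne_zero l1 ha0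
  have la : s ((1 - l) * a) = 1 := by rw [D.mul _ _ l1 ha0, hl1, ha]; rfl
  by_cases h1 : a ≠ 1 ∧ s (1 - a) = 1
  · exact D.onM l hl0 hl hl1 a ha0 h1.1 ha h1.2
  by_cases h2 : (1 - l) * a ≠ 1 ∧ s (1 - (1 - l) * a) = 1
  · obtain ⟨m, m0, ms, m1, e, -⟩ := D.Linv l hl0 hl hl1
    have h := D.onM m m0 ms m1 _ la0 h2.1 la h2.2
    rw [e, inv_mul_cancel_left₀ l1] at h
    exact h.symm
  rw [Z a ha0 ha h1, Z _ la0 la h2]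

end Dat

theorem loc2_tf (F : Type) [Field F] (χ : SqCl F →* ℤˣ) (M : Type) [AddCommGroup M]
    [Module (RF F) M] (q : ChiQuot F χ (Loc2 F M)) (hq : q + q = 0) : q = 0 := by
  obtain ⟨n, rfl⟩ := Submodule.Quotient.mk_surjective (chiSub F χ (Loc2 F M)) q
  have h1 : n + n ∈ chiSub F χ (Loc2 F M) :=
    (Submodule.Quotient.mk_eq_zero (chiSub F χ (Loc2 F M))).1 hq
  let d : Loc2 F M →ₗ[RF F] Loc2 F M :=
    LocalizedModule.divBy (⟨2, Submonoid.mem_powers _⟩ : Submonoid.powers (2 : RF F))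
  have hd : d (n + n) = n := by
    have := LocalizedModule.divBy_mul_by
      (⟨2, Submonoid.mem_powers _⟩ : Submonoid.powers (2 : RF F)) (n : LocalizedModule _ M)
    rw [← two_smul (RF F) n]
    exact this
  have hle : chiSub F χ (Loc2 F M) ≤ (chiSub F χ (Loc2 F M)).comap d := by
    refine Submodule.span_le.2 ?_
    rintro _ ⟨a, m, rfl⟩
    refine Submodule.subset_span ⟨a, d m, ?_⟩
    rw [map_sub, map_smul, map_zsmul]
  refine (Submodule.Quotient.mk_eq_zero (chiSub F χ (Loc2 F M))).2 ?_
  have := hle h1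
  rw [Submodule.mem_comap, hd] at this
  exact this

/-- the linear map from the free module to the target -/
noncomputable def toA (F : Type) [Field F] (χ : SqCl F →* ℤˣ) :
    FreeRP F →ₗ[RF F] ChiQuot F χ (Loc2 F (RP' F)) :=
  (Submodule.mkQ (chiSub F χ (Loc2 F (RP' F)))).comp
    ((LocalizedModule.mkLinearMap (Submonoid.powers (2 : RF F)) (RP' F)).comp
      (Submodule.mkQ (Submodule.span (RF F)
        ({gen F 1} ∪ ftRels F ∪ minusRels F ∪ invRels F))))

theorem toA_gen (F : Type) [Field F] (χ : SqCl F →* ℤˣ) (x : Fˣ) :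
    toA F χ (gen F x) = mkChi F χ (toLoc2 F (rp F x) : Loc2 F (RP' F)) := rfl

theorem toA_rel (F : Type) [Field F] (χ : SqCl F →* ℤˣ) (w : FreeRP F)
    (hw : w ∈ ({gen F 1} ∪ ftRels F ∪ minusRels F ∪ invRels F : Set (FreeRP F))) :
    toA F χ w = 0 := by
  have h : Submodule.mkQ (Submodule.span (RF F)
        ({gen F 1} ∪ ftRels F ∪ minusRels F ∪ invRels F)) w = 0 := by
    rw [Submodule.mkQ_apply, Submodule.Quotient.mk_eq_zero]
    exact Submodule.subset_span hw
  change (Submodule.mkQ (chiSub F χ (Loc2 F (RP' F))))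
    ((LocalizedModule.mkLinearMap (Submonoid.powers (2 : RF F)) (RP' F))
      (Submodule.mkQ (Submodule.span (RF F)
        ({gen F 1} ∪ ftRels F ∪ minusRels F ∪ invRels F)) w)) = 0
  rw [h]
  erw [map_zero, map_zero]

theorem cls_act (F : Type) [Field F] (χ : SqCl F →* ℤˣ) (M : Type) [AddCommGroup M]
    [Module (RF F) M] (a : Fˣ) (q : ChiQuot F χ M) :
    cls F a • q = (χ (sqc F a) : ℤ) • q := by
  obtain ⟨n, rfl⟩ := Submodule.Quotient.mk_surjective (chiSub F χ M) q
  have h : cls F a • n - (χ (sqc F a) : ℤ) • n ∈ chiSub F χ M :=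
    Submodule.subset_span ⟨a, n, rfl⟩
  exact (Submodule.Quotient.eq (chiSub F χ M)).2 h

theorem sqv_ne (F : Type) [Field F] (x : F) (h : x ≠ 0) : sqv F x = sqc F (U F x h) := by
  unfold sqv; rw [dif_pos h]

theorem rpc_ne (F : Type) [Field F] (x : F) (h : x ≠ 0) : rpc F 0 x = rp F (U F x h) := by
  unfold rpc; rw [dif_pos h]

theorem theDat (F : Type) [Field F] (χ : SqCl F →* ℤˣ) (hχm1 : χ (sqc F (-1)) = 1) :
    Dat (fun x : F => ((χ (sqv F x) : ℤˣ) : ℤ))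
      (fun x : F => mkChi F χ (toLoc2 F (rpc F 0 x) : Loc2 F (RP' F))) where
  tf := loc2_tf F χ _
  pm x := by
    rcases Int.units_eq_one_or (χ (sqv F x)) with h | h <;> simp [h]
  mul x y hx hy := by
    have e : U F (x * y) (mul_ne_zero hx hy) = U F x hx * U F y hy := Units.ext rfl
    simp only [sqv_ne F x hx, sqv_ne F y hy, sqv_ne F _ (mul_ne_zero hx hy), e, map_mul,
      Units.val_mul]
  m1 := by
    have e : U F (-1) (neg_ne_zero.2 one_ne_zero) = -1 := Units.ext rfl
    simp only [sqv_ne F (-1) (neg_ne_zero.2 one_ne_zero), e, hχm1, Units.val_one]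
  one := by
    have e : U F 1 one_ne_zero = 1 := Units.ext rfl
    simp only [rpc_ne F 1 one_ne_zero, e, ← toA_gen]
    exact toA_rel F χ _ (by simp)
  finv x hx := by
    have e : U F x⁻¹ (inv_ne_zero hx) = (U F x hx)⁻¹ := Units.ext (by simp [U])
    simp only [rpc_ne F x hx, rpc_ne F _ (inv_ne_zero hx), e, ← toA_gen]
    rw [← add_eq_zero_iff_eq_neg, ← map_add]
    exact toA_rel F χ _ (Or.inr ⟨_, rfl⟩)
  ft x y hx hy hx1 hy1 := by
    have h := toA_rel F χ (FT F (U F x hx) (U F y hy) hx1 hy1)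
      (Or.inl (Or.inl (Or.inr ⟨_, _, _, _, rfl⟩)))
    have e : U F y hy * (U F x hx)⁻¹ = U F (y / x) (div_ne_zero hy hx) :=
      Units.ext (by simp [U, div_eq_mul_inv])
    unfold FT at h
    simp only [map_add, map_sub, map_smul, cls_act, toA_gen, e] at h
    rw [← rpc_ne, ← rpc_ne, ← rpc_ne, ← rpc_ne, ← rpc_ne, ← sqv_ne, ← sqv_ne, ← sqv_ne] at h
    exact h

/-- Let `F` be a field with at least 4 elements and `χ : G_F → {±1}`
a character with `χ(-1) = 1`.  Let `ℓ ∈ F^×` satisfy `χ(ℓ) = -1` and `χ(1-ℓ) = 1`.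
Then `[a]_χ = [(1-ℓ)a]_χ` in `(RP′(F)[1/2])_χ` for all `a ∈ F^×`.
(Note that `χ(ℓ) = -1` forces `ℓ ≠ 1`, so `1 - ℓ ∈ F^×` and `(1-ℓ)a ∈ F^×`; the
functions `sqv` and `rpc` take junk values at `0`, which are therefore irrelevant.) -/
theorem statement15 (F : Type) [Field F] (hcard : 4 ≤ Cardinal.mk F)
    (χ : SqCl F →* ℤˣ) (hχm1 : χ (sqc F (-1)) = 1)
    (l : Fˣ) (hl : χ (sqc F l) = -1) (hχ1 : χ (sqv F (1 - (l : F))) = 1)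
    (a : Fˣ) :
    mkChi F χ (toLoc2 F (rp F a) : Loc2 F (RP' F)) =
      mkChi F χ (toLoc2 F (rpc F 0 ((1 - (l : F)) * (a : F)))) := by
  have D := theDat F χ hχm1
  have h := D.main (l : F) l.ne_zero
    (by
      have e : U F (l : F) l.ne_zero = l := Units.ext rfl
      simp only [sqv_ne F _ l.ne_zero, e, hl]; rfl)
    (by simp only [hχ1]; rfl) (a : F) a.ne_zero
  have e : U F (a : F) a.ne_zero = a := Units.ext rfl
  simp only [rpc_ne F _ a.ne_zero, e] at h
  exact h.symm
end

section
/- Let F be a field with at least 4 elements and χ : G_F → {±1} a character with χ(−1) = 1. Let ℓ ∈ F^× satisfy χ(ℓ) = −1 and χ(1−ℓ) = 1. Then [a]_χ = [a + tℓ]_χ in (RP′(F)[1/2])_χ for all a ∈ F and all t ∈ ℤ, where by convention [0] := C_F. -/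
open scoped Classical

section Abstract

variable {F A : Type} [Field F] [AddCommGroup A]

structure Setup (f : F → A) (e : F → ℤ) (C : A) : Prop where
  h2 : ∀ a : A, a + a = 0 → a = 0
  emul : ∀ x y, e (x * y) = e x * e y
  epm : ∀ x, x ≠ 0 → e x = 1 ∨ e x = -1
  eneg : e (-1) = 1
  f0 : f 0 = C
  f1 : f 1 = 0
  finv : ∀ x, x ≠ 0 → f x⁻¹ = - f x
  fC : ∀ x, x ≠ 0 → x ≠ 1 → C = f x + f (1 - x)
  ft : ∀ x y, x ≠ 0 → x ≠ 1 → y ≠ 0 → y ≠ 1 →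
    f x - f y + e x • f (y * x⁻¹) - e (x⁻¹ - 1) • f ((1 - x⁻¹) / (1 - y⁻¹))
      + e (1 - x) • f ((1 - x) / (1 - y)) = 0

namespace Setup

variable {f : F → A} {e : F → ℤ} {C : A} (S : Setup f e C)

theorem e1 (S : Setup f e C) : e 1 = 1 := by
  have h := S.emul (-1) (-1)
  rw [S.eneg] at h
  simpa using h

theorem einv (S : Setup f e C) (x : F) (hx : x ≠ 0) : e x⁻¹ = e x := by
  have h := S.emul x x⁻¹
  rw [mul_inv_cancel₀ hx, S.e1] at h
  rcases S.epm x hx with h1 | h1 <;> rw [h1] at h ⊢ <;> omega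

theorem ediv (S : Setup f e C) (x y : F) (hy : y ≠ 0) : e (x / y) = e x * e y := by
  rw [div_eq_mul_inv, S.emul, S.einv y hy]

theorem enegx (S : Setup f e C) (x : F) : e (-x) = e x := by
  have h := S.emul (-1) x
  rw [S.eneg] at h
  simpa using h

theorem esub (S : Setup f e C) (x y : F) : e (x - y) = e (y - x) := by
  rw [← S.enegx, neg_sub]

theorem fC' (S : Setup f e C) (x : F) : f x + f (1 - x) = C := by
  by_cases h0 : x = 0
  · simp [h0, S.f0, S.f1]
  by_cases h1 : x = 1
  · simp [h1, S.f0, S.f1]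
  exact (S.fC x h0 h1).symm

/-- five-term relation, cleaned. -/
theorem ft' (S : Setup f e C) (x y : F) (hx : x ≠ 0) (hx1 : x ≠ 1) (hy : y ≠ 0) (hy1 : y ≠ 1) :
    f x - f y + e x • f (y / x) - (e x * e (1 - x)) • f (y * (1 - x) / (x * (1 - y)))
      + e (1 - x) • f ((1 - x) / (1 - y)) = 0 := by
  have h := S.ft x y hx hx1 hy hy1
  have a1 : x⁻¹ - 1 = (1 - x) / x := by field_simp
  have hx' : 1 - x ≠ 0 := sub_ne_zero.mpr (Ne.symm hx1)
  have hy' : 1 - y ≠ 0 := sub_ne_zero.mpr (Ne.symm hy1)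
  have a2 : (1 - x⁻¹) / (1 - y⁻¹) = y * (1 - x) / (x * (1 - y)) := by
    have b1 : 1 - x⁻¹ = -((1 - x) / x) := by field_simp; ring
    have b2 : 1 - y⁻¹ = -((1 - y) / y) := by field_simp; ring
    rw [b1, b2]
    field_simp
  rw [a2, a1, S.ediv _ _ hx, mul_comm (e (1 - x)) (e x), ← div_eq_mul_inv] at h
  exact h

theorem gconst (S : Setup f e C) (u v : F) (hu : u ≠ 0) (hu1 : u ≠ 1) (hv : v ≠ 0) (hv1 : v ≠ 1)
    (eu : e u = -1) (ev : e v = -1) : e (1 - u) • f u = e (1 - v) • f v := by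
  by_cases huv : u = v
  · rw [huv]
  have hd : u - v ≠ 0 := sub_ne_zero.mpr huv
  have hu' : 1 - u ≠ 0 := sub_ne_zero.mpr (Ne.symm hu1)
  have hv' : 1 - v ≠ 0 := sub_ne_zero.mpr (Ne.symm hv1)
  have x1 : 1 - (u - v) / (u * (1 - v)) = v * (1 - u) / (u * (1 - v)) := by field_simp; ring
  have y1 : 1 - (u - v) / (1 - v) = (1 - u) / (1 - v) := by field_simp; ring
  have hx : (u - v) / (u * (1 - v)) ≠ 0 := div_ne_zero hd (mul_ne_zero hu hv')
  have hy : (u - v) / (1 - v) ≠ 0 := div_ne_zero hd hv'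
  have hx1 : (u - v) / (u * (1 - v)) ≠ 1 := by
    intro h; rw [h, sub_self] at x1
    exact div_ne_zero (mul_ne_zero hv hu') (mul_ne_zero hu hv') x1.symm
  have hy1 : (u - v) / (1 - v) ≠ 1 := by
    intro h; rw [h, sub_self] at y1
    exact div_ne_zero hu' hv' y1.symm
  have r1 := S.ft' _ _ hx hx1 hy hy1
  have r2 := S.ft' _ _ hy hy1 hx hx1
  rw [x1, y1] at r1 r2
  rw [S.ediv _ _ (mul_ne_zero hu hv'), S.ediv _ _ (mul_ne_zero hu hv'), S.emul v, S.emul u,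
    eu, ev] at r1
  rw [S.ediv _ _ hv', S.ediv _ _ hv'] at r2
  have p1 : (u - v) / (1 - v) / ((u - v) / (u * (1 - v))) = u := by field_simp
  have p2 : (u - v) / (u * (1 - v)) / ((u - v) / (1 - v)) = u⁻¹ := by field_simp
  have p3 : (u - v) / (1 - v) * (v * (1 - u) / (u * (1 - v))) /
      ((u - v) / (u * (1 - v)) * ((1 - u) / (1 - v))) = v := by field_simp
  have p4 : (u - v) / (u * (1 - v)) * ((1 - u) / (1 - v)) /
      ((u - v) / (1 - v) * (v * (1 - u) / (u * (1 - v)))) = v⁻¹ := by field_simp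
  have p5 : v * (1 - u) / (u * (1 - v)) / ((1 - u) / (1 - v)) = v / u := by field_simp
  have p6 : (1 - u) / (1 - v) / (v * (1 - u) / (u * (1 - v))) = (v / u)⁻¹ := by field_simp
  rw [p1, p3, p5] at r1
  rw [p2, p4, p6, S.finv _ hu, S.finv _ hv, S.finv _ (div_ne_zero hv hu)] at r2
  rcases S.epm _ hd with h1 | h1 <;> rcases S.epm _ hu' with h3 | h3 <;>
    rcases S.epm _ hv' with h4 | h4 <;> rw [h1, h3, h4] at r1 r2 <;> rw [h3, h4] <;>
    simp only [mul_neg, mul_one, neg_neg, one_smul, neg_smul, smul_neg] at r1 r2 ⊢ <;>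
    refine sub_eq_zero.mp (S.h2 _ ?_)
  all_goals first
    | (linear_combination (norm := module) r1 + r2)
    | (linear_combination (norm := module) - r1 - r2)

section L
variable {l : F}

/-- `l`-like. -/
def Lk (e : F → ℤ) (l : F) : Prop := l ≠ 0 ∧ l ≠ 1 ∧ e l = -1 ∧ e (1 - l) = 1

theorem C_eq (S : Setup f e C) (hl : Lk e l) : f l = C := by
  obtain ⟨h0, h1, h2, h3⟩ := hl
  have h1' : 1 - l ≠ 0 := sub_ne_zero.mpr (Ne.symm h1)
  -- w = 1 - (1-l)⁻¹ = -l/(1-l)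
  have hw : 1 - (1 - l)⁻¹ = -(l / (1 - l)) := by field_simp; ring
  have hw' : 1 - -(l / (1 - l)) = (1 - l)⁻¹ := by field_simp; ring
  have g := S.gconst l (-(l / (1 - l))) h0 h1 (neg_ne_zero.mpr (div_ne_zero h0 h1'))
    (by intro h; rw [h, sub_self] at hw'; exact inv_ne_zero h1' hw'.symm) h2
    (by rw [S.enegx, S.ediv _ _ h1', h2, h3]; rfl)
  rw [hw', S.einv _ h1', h3, one_smul, one_smul] at g
  have c1 := S.fC' (1 - l)⁻¹
  rw [hw, S.finv _ h1', ← g] at c1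
  have c2 := S.fC' l
  refine sub_eq_zero.mp (S.h2 _ ?_)
  linear_combination (norm := module) c1 + c2

theorem fneg (S : Setup f e C) (hl : Lk e l) (u : F) (hu : u ≠ 0) (eu : e u = -1) :
    f u = e (1 - u) • C := by
  have hu1 : u ≠ 1 := by rintro rfl; rw [S.e1] at eu; omega
  have hC := S.C_eq hl
  obtain ⟨h0, h1, h2, h3⟩ := hl
  have g := S.gconst l u h0 h1 hu hu1 h2 eu
  rw [h3, one_smul, hC] at g
  rw [g, smul_smul]
  rcases S.epm (1 - u) (sub_ne_zero.mpr (Ne.symm hu1)) with h | h <;> rw [h] <;> simp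

theorem fpos (S : Setup f e C) (hl : Lk e l) (u : F) (hu1 : u ≠ 1) (eu : e u = 1)
    (eu' : e (1 - u) = -1) : f u = 0 := by
  have g := S.fneg hl (1 - u) (sub_ne_zero.mpr (Ne.symm hu1)) eu'
  rw [sub_sub_cancel, eu, one_smul] at g
  have c := S.fC' u
  rw [g] at c
  simpa using c

theorem rule (S : Setup f e C) (hl : Lk e l) (y : F) (hy : y ≠ 0) (hy1 : y ≠ 1) (hyl : y ≠ l)
    (ey : e y = 1) (ey1 : e (1 - y) = 1) :
    (e (y - l) = -1 → f y = C) ∧ (f ((y - l) / (1 - l)) = f y) := by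
  have hl' := hl
  have hC := S.C_eq hl
  obtain ⟨h0, h1, h2, h3⟩ := hl
  have h1' : 1 - l ≠ 0 := sub_ne_zero.mpr (Ne.symm h1)
  have hy' : 1 - y ≠ 0 := sub_ne_zero.mpr (Ne.symm hy1)
  have hd : y - l ≠ 0 := sub_ne_zero.mpr hyl
  have r := S.ft' l y h0 h1 hy hy1
  have g1 := S.fneg hl' (y / l) (div_ne_zero hy h0) (by rw [S.ediv _ _ h0, ey, h2]; rfl)
  have q1 : 1 - y / l = (l - y) / l := by field_simp
  have g2 := S.fneg hl' (y * (1 - l) / (l * (1 - y)))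
    (div_ne_zero (mul_ne_zero hy h1') (mul_ne_zero h0 hy'))
    (by rw [S.ediv _ _ (mul_ne_zero h0 hy'), S.emul, S.emul, ey, h2, h3, ey1]; rfl)
  have q2 : 1 - y * (1 - l) / (l * (1 - y)) = (l - y) / (l * (1 - y)) := by field_simp; ring
  rw [q1, S.ediv _ _ h0, S.esub, h2] at g1
  rw [q2, S.ediv _ _ (mul_ne_zero h0 hy'), S.emul, S.esub, h2, ey1] at g2
  rw [g1, g2, hC, h2, h3] at r
  have q3 : 1 - (1 - l) / (1 - y) = (l - y) / (1 - y) := by field_simp; ring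
  have r' : f ((1 - l) / (1 - y)) = f y - C := by
    simp only [mul_neg, mul_one, neg_neg, one_smul, neg_smul, smul_neg] at r
    linear_combination (norm := module) r
  constructor
  · intro hm
    have := S.fpos hl' ((1 - l) / (1 - y))
      (by
        intro h; rw [h, sub_self] at q3
        exact div_ne_zero (by rw [← neg_sub]; exact neg_ne_zero.mpr hd) hy' q3.symm)
      (by rw [S.ediv _ _ hy', h3, ey1]; rfl)
      (by rw [q3, S.ediv _ _ hy', S.esub, hm, ey1]; rfl)
    rw [this] at r'
    exact (sub_eq_zero.mp r'.symm)
  · have i := S.finv _ (div_ne_zero h1' hy')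
    rw [r', inv_div] at i
    have c := S.fC' ((1 - y) / (1 - l))
    have q4 : 1 - (1 - y) / (1 - l) = (y - l) / (1 - l) := by field_simp; ring
    rw [q4, i] at c
    linear_combination (norm := module) c

/-- first half of scaling: knowing `χ(y)=χ(1-y)=1`, `y = z(1-l)`. -/
theorem scale1 (S : Setup f e C) (hl : Lk e l) (y : F) (hy : y ≠ 0) (hy1 : y ≠ 1)
    (hyl : y ≠ 1 - l) (ey : e y = 1) (ey1 : e (1 - y) = 1) :
    (e (1 - l - y) = -1 → f y = 0) ∧ f (y / (1 - l)) = f y := by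
  have h1' : 1 - l ≠ 0 := sub_ne_zero.mpr (Ne.symm hl.2.1)
  have r := S.rule hl (1 - y) (sub_ne_zero.mpr (Ne.symm hy1))
    (by intro h; apply hy; linear_combination -h) (by intro h; apply hyl; linear_combination -h)
    ey1 (by rw [sub_sub_cancel, ey])
  have c := S.fC' y
  constructor
  · intro h
    have := r.1 (by rw [← h]; congr 1; ring)
    rw [this] at c; simpa using c
  · have r2 := r.2
    have c2 := S.fC' (y / (1 - l))
    have q : 1 - y / (1 - l) = (1 - y - l) / (1 - l) := by field_simp; ring
    rw [q, r2] at c2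
    linear_combination (norm := module) c2 - c

theorem Czero (S : Setup f e C) (hl : Lk e l) (m : F) (hm : Lk e m) (h : e (1 - l - m) = -1)
    (hne : 1 - l - m ≠ 0) : C = 0 := by
  have hC := S.C_eq hl
  have hl' := hl
  obtain ⟨h0, h1, h2, h3⟩ := hl
  obtain ⟨m0, m1, m2, m3⟩ := hm
  have h1' : 1 - l ≠ 0 := sub_ne_zero.mpr (Ne.symm h1)
  have m1' : 1 - m ≠ 0 := sub_ne_zero.mpr (Ne.symm m1)
  have r := S.ft' l (1 - m) h0 h1 m1' (by intro h; apply m0; linear_combination -h)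
  rw [sub_sub_cancel] at r
  have g0 := S.fpos hl' (1 - m) (by intro h; apply m0; linear_combination -h) m3
    (by rw [sub_sub_cancel, m2])
  have g1 := S.fneg hl' ((1 - m) / l) (div_ne_zero m1' h0) (by rw [S.ediv _ _ h0, m3, h2]; rfl)
  have q1 : 1 - (1 - m) / l = -((1 - l - m) / l) := by field_simp; ring
  rw [q1, S.enegx, S.ediv _ _ h0, h, h2] at g1
  have q2 : 1 - (1 - m) * (1 - l) / (l * m) = -((1 - l - m) / (l * m)) := by field_simp; ring
  have g2 := S.fpos hl' ((1 - m) * (1 - l) / (l * m))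
    (by
      intro hh; rw [hh, sub_self] at q2
      exact neg_ne_zero.mpr (div_ne_zero hne (mul_ne_zero h0 m0)) q2.symm)
    (by rw [S.ediv _ _ (mul_ne_zero h0 m0), S.emul, S.emul, m2, m3, h2, h3]; rfl)
    (by rw [q2, S.enegx, S.ediv _ _ (mul_ne_zero h0 m0), S.emul, m2, h2, h]; rfl)
  have q3 : 1 - (1 - l) / m = -((1 - l - m) / m) := by field_simp; ring
  have g3 := S.fneg hl' ((1 - l) / m) (div_ne_zero h1' m0) (by rw [S.ediv _ _ m0, m2, h3]; rfl)
  rw [q3, S.enegx, S.ediv _ _ m0, h, m2] at g3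
  rw [g0, g1, g2, g3, hC, h2, h3] at r
  simpa using r

theorem f1l (S : Setup f e C) (hl : Lk e l) : f (1 - l) = 0 := by
  have c := S.fC' l
  rw [S.C_eq hl] at c
  simpa using c

theorem inv_like (S : Setup f e C) (hl : Lk e l) : Lk e (1 - (1 - l)⁻¹) := by
  obtain ⟨h0, h1, h2, h3⟩ := hl
  have h1' : 1 - l ≠ 0 := sub_ne_zero.mpr (Ne.symm h1)
  have hw : 1 - (1 - l)⁻¹ = -(l / (1 - l)) := by field_simp; ring
  refine ⟨?_, ?_, ?_, ?_⟩
  · rw [hw]; exact neg_ne_zero.mpr (div_ne_zero h0 h1')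
  · intro h; apply inv_ne_zero h1'; linear_combination -h
  · rw [hw, S.enegx, S.ediv _ _ h1', h2, h3]; rfl
  · rw [sub_sub_cancel, S.einv _ h1', h3]

/-- scaling, in the case `χ(1-y)=1`. -/
theorem scale2 (S : Setup f e C) (hl : Lk e l) (y : F) (hy : y ≠ 0) (hy1 : y ≠ 1)
    (ey1 : e (1 - y) = 1) : f (y / (1 - l)) = f y := by
  have h1' : 1 - l ≠ 0 := sub_ne_zero.mpr (Ne.symm hl.2.1)
  by_cases hyl : y = 1 - l
  · rw [hyl, div_self h1', S.f1, S.f1l hl]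
  have hz : y / (1 - l) ≠ 0 := div_ne_zero hy h1'
  rcases S.epm y hy with ey | ey
  · exact (S.scale1 hl y hy hy1 hyl ey ey1).2
  have hd : 1 - l - y ≠ 0 := sub_ne_zero.mpr (Ne.symm hyl)
  have q : 1 - y / (1 - l) = (1 - l - y) / (1 - l) := by field_simp
  rw [S.fneg hl y hy ey, S.fneg hl _ hz (by rw [S.ediv _ _ h1', ey, hl.2.2.2]; rfl), q,
    S.ediv _ _ h1', hl.2.2.2, ey1]
  rcases S.epm _ hd with h | h
  · rw [h]; simp
  · rw [S.Czero hl y ⟨hy, hy1, ey, ey1⟩ h hd]; simp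

theorem scale (S : Setup f e C) (hl : Lk e l) (y : F) : f (y / (1 - l)) = f y := by
  have h1' : 1 - l ≠ 0 := sub_ne_zero.mpr (Ne.symm hl.2.1)
  by_cases hy : y = 0
  · simp [hy]
  by_cases hy1 : y = 1
  · rw [hy1, one_div, S.finv _ h1', S.f1l hl, S.f1, neg_zero]
  rcases S.epm (1 - y) (sub_ne_zero.mpr (Ne.symm hy1)) with ey1 | ey1
  · exact S.scale2 hl y hy hy1 ey1
  by_cases hyl : y = 1 - l
  · rw [hyl, div_self h1', S.f1, S.f1l hl]
  have hz : y / (1 - l) ≠ 0 := div_ne_zero hy h1'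
  have hz1 : y / (1 - l) ≠ 1 := by
    intro h; apply hyl; rwa [div_eq_one_iff_eq h1'] at h
  have ez : e (y / (1 - l)) = e y := by rw [S.ediv _ _ h1', hl.2.2.2, mul_one]
  rcases S.epm (1 - y / (1 - l)) (sub_ne_zero.mpr (Ne.symm hz1)) with ez1 | ez1
  · have := S.scale2 (S.inv_like hl) (y / (1 - l)) hz hz1 ez1
    rw [sub_sub_cancel, div_inv_eq_mul, div_mul_cancel₀ _ h1'] at this
    exact this.symm
  · rcases S.epm y hy with ey | ey
    · rw [S.fpos hl y hy1 ey ey1, S.fpos hl _ hz1 (by rw [ez, ey]) ez1]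
    · rw [S.fneg hl y hy ey, S.fneg hl _ hz (by rw [ez, ey]), ey1, ez1]

theorem shift (S : Setup f e C) (hl : Lk e l) (y : F) : f (y - l) = f y := by
  have h1' : 1 - l ≠ 0 := sub_ne_zero.mpr (Ne.symm hl.2.1)
  have c1 := S.fC' y
  have c2 := S.fC' ((y - l) / (1 - l))
  have q : 1 - (y - l) / (1 - l) = (1 - y) / (1 - l) := by field_simp; ring
  rw [q, S.scale hl, S.scale hl] at c2
  linear_combination (norm := module) c2 - c1

theorem shiftZ (S : Setup f e C) (hl : Lk e l) (a : F) (t : ℤ) : f (a + (t : F) * l) = f a := by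
  induction t using Int.induction_on with
  | zero => simp
  | succ n ih =>
    rw [← ih, ← S.shift hl]
    congr 1; push_cast; ring
  | pred n ih =>
    rw [← ih, ← S.shift hl (a + ((-(n : ℤ) : ℤ) : F) * l)]
    congr 1; push_cast; ring

end L
end Setup
end Abstract

section Concrete

variable (F : Type) [Field F]

noncomputable def evF (χ : SqCl F →* ℤˣ) (x : F) : ℤ :=
  if h : x ≠ 0 then (χ (sqc F (U F x h)) : ℤ) else 0

noncomputable def phi (χ : SqCl F →* ℤˣ) :
    RP' F →ₗ[RF F] ChiQuot F χ (Loc2 F (RP' F)) :=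
  (Submodule.mkQ (chiSub F χ (Loc2 F (RP' F)))).comp
    (LocalizedModule.mkLinearMap (Submonoid.powers (2 : RF F)) (RP' F))

theorem phi_apply (χ : SqCl F →* ℤˣ) (m : RP' F) :
    phi F χ m = mkChi F χ (toLoc2 F m) := rfl

theorem chi_smul (χ : SqCl F →* ℤˣ) (a : Fˣ) (m : ChiQuot F χ (Loc2 F (RP' F))) :
    cls F a • m = (χ (sqc F a) : ℤ) • m := by
  obtain ⟨m, rfl⟩ := Submodule.mkQ_surjective (chiSub F χ (Loc2 F (RP' F))) m
  refine (Submodule.Quotient.eq (chiSub F χ (Loc2 F (RP' F)))).mpr ?_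
  exact Submodule.subset_span ⟨a, m, rfl⟩

theorem two_tf (χ : SqCl F →* ℤˣ) (m : ChiQuot F χ (Loc2 F (RP' F))) (h : m + m = 0) : m = 0 := by
  obtain ⟨m, rfl⟩ := Submodule.mkQ_surjective (chiSub F χ (Loc2 F (RP' F))) m
  have h2 : m + m ∈ chiSub F χ (Loc2 F (RP' F)) :=
    (Submodule.Quotient.mk_eq_zero (chiSub F χ (Loc2 F (RP' F)))).mp h
  refine (Submodule.Quotient.mk_eq_zero (chiSub F χ (Loc2 F (RP' F)))).mpr ?_
  have hu : IsUnit (algebraMap (RF F) (Module.End (RF F) (Loc2 F (RP' F))) 2) :=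
    IsLocalizedModule.map_units
      (LocalizedModule.mkLinearMap (Submonoid.powers (2 : RF F)) (RP' F))
      ⟨2, Submonoid.mem_powers _⟩
  obtain ⟨u, hu⟩ := hu
  let k : Module.End (RF F) (Loc2 F (RP' F)) := (u⁻¹ : (Module.End (RF F) (Loc2 F (RP' F)))ˣ)
  have hk : ∀ n, k (n + n) = n := by
    intro n
    have e1 : n + n = (u : Module.End (RF F) (Loc2 F (RP' F))) n := by
      rw [hu, Module.algebraMap_end_apply, two_smul]
    rw [e1]
    change (k * (u : Module.End (RF F) (Loc2 F (RP' F)))) n = n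
    simp [k]
  have hle : chiSub F χ (Loc2 F (RP' F)) ≤ (chiSub F χ (Loc2 F (RP' F))).comap k := by
    refine Submodule.span_le.mpr ?_
    rintro _ ⟨a, n, rfl⟩
    refine Submodule.subset_span ⟨a, k n, ?_⟩
    rw [map_sub, map_smul, map_zsmul]
  have := hle h2
  rw [Submodule.mem_comap, hk] at this
  exact this

theorem rp_rel (w : FreeRP F)
    (h : w ∈ ({gen F 1} ∪ ftRels F ∪ minusRels F ∪ invRels F : Set (FreeRP F))) :
    (Submodule.mkQ (Submodule.span (RF F)
      ({gen F 1} ∪ ftRels F ∪ minusRels F ∪ invRels F)) w : RP' F) = 0 :=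
  (Submodule.Quotient.mk_eq_zero _).mpr (Submodule.subset_span h)

noncomputable def pr : FreeRP F →ₗ[RF F] RP' F :=
  Submodule.mkQ (Submodule.span (RF F)
      ({gen F 1} ∪ ftRels F ∪ minusRels F ∪ invRels F))

theorem pr_gen (x : Fˣ) : pr F (gen F x) = rp F x := rfl

theorem setup (c : RP' F)
    (hc : ∀ (x : Fˣ) (hx : (x : F) ≠ 1),
      c = rp F x + rp F (U F (1 - (x : F)) (one_sub_ne hx)))
    (χ : SqCl F →* ℤˣ) (hχm1 : χ (sqc F (-1)) = 1) :
    Setup (fun a => phi F χ (rpc F c a)) (evF F χ) (phi F χ c) where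
  h2 := two_tf F χ
  emul x y := by
    by_cases hx : x = 0
    · simp [evF, hx]
    by_cases hy : y = 0
    · simp [evF, hy]
    have : U F (x * y) (mul_ne_zero hx hy) = U F x hx * U F y hy := by
      ext; rfl
    simp [evF, hx, hy, this]
  epm x hx := by
    simp only [evF, dif_pos hx]
    rcases Int.units_eq_one_or (χ (sqc F (U F x hx))) with h | h <;> rw [h] <;> simp
  eneg := by
    have h : (-1 : F) ≠ 0 := by simp
    have : U F (-1) h = -1 := by ext; rfl
    simp only [evF, dif_pos h, this, hχm1]; rfl
  f0 := by simp [rpc]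
  f1 := by
    have : U F 1 one_ne_zero = 1 := by ext; rfl
    have h := rp_rel F (gen F 1) (by simp)
    have h' : rp F 1 = 0 := h
    simp [rpc, this, h']
  finv x hx := by
    have : U F x⁻¹ (inv_ne_zero hx) = (U F x hx)⁻¹ := by ext; simp [U]
    have h : pr F _ = 0 := rp_rel F (gen F (U F x hx)⁻¹ + gen F (U F x hx)) (Or.inr ⟨_, rfl⟩)
    rw [map_add, pr_gen, pr_gen] at h
    simp only [rpc, dif_pos hx, dif_pos (inv_ne_zero hx), this]
    rw [eq_neg_of_add_eq_zero_left h, map_neg]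
  fC x hx hx1 := by
    have h1 : 1 - x ≠ 0 := sub_ne_zero.mpr (Ne.symm hx1)
    simp only [rpc, dif_pos hx, dif_pos h1]
    rw [← map_add]
    exact congrArg _ (hc (U F x hx) hx1)
  ft x y hx hx1 hy hy1 := by
    have h : pr F _ = 0 := rp_rel F (FT F (U F x hx) (U F y hy) hx1 hy1)
      (Or.inl (Or.inl (Or.inr ⟨_, _, _, _, rfl⟩)))
    have h' := congrArg (phi F χ) h
    simp only [FT, map_add, map_sub, map_smul, pr_gen, map_zero, chi_smul] at h'
    have h1 : y * x⁻¹ ≠ 0 := mul_ne_zero hy (inv_ne_zero hx)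
    have h2 := inv_sub_one_ne (x := U F x hx) hx1
    have h3 := one_sub_ne (x := U F x hx) hx1
    have h4 := div_ne_zero (one_sub_inv_ne (x := U F x hx) hx1)
      (one_sub_inv_ne (x := U F y hy) hy1)
    have h5 := div_ne_zero (one_sub_ne (x := U F x hx) hx1) (one_sub_ne (x := U F y hy) hy1)
    have h6 : U F (y * x⁻¹) h1 = U F y hy * (U F x hx)⁻¹ := by ext; simp [U]
    change x⁻¹ - 1 ≠ 0 at h2
    change 1 - x ≠ 0 at h3
    change (1 - x⁻¹) / (1 - y⁻¹) ≠ 0 at h4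
    change (1 - x) / (1 - y) ≠ 0 at h5
    simp only [rpc, evF, dif_pos hx, dif_pos hy, dif_pos h1, dif_pos h2, dif_pos h3, dif_pos h4,
      dif_pos h5, h6]
    exact h'

end Concrete

/-- Let `F` be a field with at least 4 elements and `χ : G_F → {±1}`
a character with `χ(-1) = 1`.  Let `ℓ ∈ F^×` satisfy `χ(ℓ) = -1` and `χ(1-ℓ) = 1`.
Then `[a]_χ = [a + tℓ]_χ` in `(RP′(F)[1/2])_χ` for all `a ∈ F` and all `t ∈ ℤ`,
where by convention `[0] := C_F` (and `C_F` is the common value of `[x] + [1-x]`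
over `x ∈ F^× \ {1}`). -/
theorem statement16 (F : Type) [Field F] (hcard : 4 ≤ Cardinal.mk F)
    (c : RP' F)
    (hc : ∀ (x : Fˣ) (hx : (x : F) ≠ 1),
      c = rp F x + rp F (U F (1 - (x : F)) (one_sub_ne hx)))
    (χ : SqCl F →* ℤˣ) (hχm1 : χ (sqc F (-1)) = 1)
    (l : Fˣ) (hl : χ (sqc F l) = -1) (hχ1 : χ (sqv F (1 - (l : F))) = 1)
    (a : F) (t : ℤ) :
    mkChi F χ (toLoc2 F (rpc F c a) : Loc2 F (RP' F)) =
      mkChi F χ (toLoc2 F (rpc F c (a + (t : F) * (l : F)))) := by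
  have S := setup F c hc χ hχm1
  have hl0 : (l : F) ≠ 0 := l.ne_zero
  have hU : U F (l : F) hl0 = l := by ext; rfl
  have el : evF F χ (l : F) = -1 := by
    simp only [evF, dif_pos hl0, hU, hl]; rfl
  have hl1 : (l : F) ≠ 1 := by
    intro h
    rw [h, S.e1] at el
    omega
  have h1 : 1 - (l : F) ≠ 0 := one_sub_ne hl1
  have hk : Setup.Lk (evF F χ) (l : F) := by
    refine ⟨hl0, hl1, el, ?_⟩
    simp only [sqv, dif_pos h1] at hχ1
    simp only [evF, dif_pos h1, hχ1]; rfl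
  exact (S.shiftZ hk a t).symm
end
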